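/- arXiv:1808.04148 — 3 statements merged into one kernel-verified Lean document; each statement's English description precedes it below -/
import Mathlib

section
/- Let G be a finite simple graph with vertices x_1, …, x_n and suppose a grounded 1-string representation of G is given, inducing the order x_1 < ⋯ < x_n. Then there exist a cycle extension H of (G,<) and a grounded 1-string representation of H whose restriction to the vertices x_1, …, x_n coincides with the given representation of G. -/
/-- A grounded 1-string representation of a simple graph `G`:
each vertex is represented by an injective continuous curve `gam v : [0,1] → ℝ²`
starting at its anchor `(a v, 0)` on the grounding line and staying strictly below
it afterwards; distinct strings meet in at most one point, no endpoint of a string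
lies on another string, and adjacency corresponds to intersection of the strings. -/
structure Grounded1StringRep {V : Type} (G : SimpleGraph V) where
  gam : V → ℝ → ℝ × ℝ
  a : V → ℝ
  cont : ∀ v, ContinuousOn (gam v) (Set.Icc 0 1)
  inj : ∀ v, Set.InjOn (gam v) (Set.Icc 0 1)
  start : ∀ v, gam v 0 = (a v, 0)
  below : ∀ v, ∀ t ∈ Set.Ioc (0 : ℝ) 1, (gam v t).2 < 0
  a_inj : Function.Injective a
  one_string : ∀ u v, u ≠ v →
    (gam u '' Set.Icc 0 1 ∩ gam v '' Set.Icc 0 1).Subsingleton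
  endpoints_off : ∀ u v, u ≠ v →
    gam v 0 ∉ gam u '' Set.Icc 0 1 ∧ gam v 1 ∉ gam u '' Set.Icc 0 1
  adj_iff : ∀ u v, u ≠ v →
    (G.Adj u v ↔ (gam u '' Set.Icc 0 1 ∩ gam v '' Set.Icc 0 1).Nonempty)

/-- `H` is a cycle extension of the graph `G` on `Fin n` taken with its natural
vertex order: the `Sum.inl` vertices induce `G`, the `Sum.inr` vertices induce
exactly the cycle `y_0 y_1 ⋯ y_{5n-1} y_0`, and (in 0-indexed notation) each
`x_i` is adjacent either exactly to `y_{5i+4}`, or exactly to `y_{5i+3}` and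
`y_{5i+4}`, among the cycle vertices. -/
def IsCycleExtension (n : ℕ) (G : SimpleGraph (Fin n))
    (H : SimpleGraph (Fin n ⊕ Fin (5 * n))) : Prop :=
  (∀ i j : Fin n, H.Adj (Sum.inl i) (Sum.inl j) ↔ G.Adj i j) ∧
  (∀ i j : Fin (5 * n), H.Adj (Sum.inr i) (Sum.inr j) ↔
    ((i.val + 1) % (5 * n) = j.val ∨ (j.val + 1) % (5 * n) = i.val)) ∧
  (∀ i : Fin n,
    (∀ j : Fin (5 * n), H.Adj (Sum.inl i) (Sum.inr j) ↔ j.val = 5 * i.val + 4) ∨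
    (∀ j : Fin (5 * n), H.Adj (Sum.inl i) (Sum.inr j) ↔
      (j.val = 5 * i.val + 3 ∨ j.val = 5 * i.val + 4)))

section

open Set Filter Topology Metric

theorem exists_continuous_exp_eq {X : Type*} [TopologicalSpace X] [SimplyConnectedSpace X]
    [LocallyPathConnectedSpace X] {f : X → ℂ} (hf : Continuous f) (h0 : ∀ x, f x ≠ 0) :
    ∃ g : X → ℂ, Continuous g ∧ ∀ x, Complex.exp (g x) = f x := by
  obtain ⟨x₀⟩ : Nonempty X := inferInstance
  obtain ⟨F, ⟨-, hF⟩, -⟩ := Complex.isCoveringMapOn_exp.existsUnique_continuousMap_lifts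
    ⟨f, hf⟩ (a₀ := x₀) (e₀ := Complex.log (f x₀)) (Complex.exp_log (h0 x₀)) (fun a => h0 a)
  exact ⟨F, F.continuous, fun x => congrFun hF x⟩

theorem sub_eq_sub_of_exp_eq {X : Type*} [TopologicalSpace X] {S : Set X} (hS : IsPreconnected S)
    {f g : X → ℂ} (hf : ContinuousOn f S) (hg : ContinuousOn g S)
    (h : ∀ x ∈ S, Complex.exp (f x) = Complex.exp (g x)) {x y : X} (hx : x ∈ S) (hy : y ∈ S) :
    f x - g x = f y - g y := by
  have key : ∀ z ∈ S, ∃ n : ℤ, (n : ℝ) = (f z - g z).im / (2 * Real.pi) ∧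
      f z - g z = n * (2 * Real.pi * Complex.I) := by
    intro z hz
    obtain ⟨n, hn⟩ := Complex.exp_eq_exp_iff_exists_int.1 (h z hz)
    refine ⟨n, ?_, by rw [hn]; ring⟩
    have : f z - g z = n * (2 * Real.pi * Complex.I) := by rw [hn]; ring
    rw [this]
    have := Real.pi_ne_zero
    simp
  have hc : ContinuousOn (fun z => (f z - g z).im / (2 * Real.pi)) S :=
    (Complex.continuous_im.comp_continuousOn (hf.sub hg)).div_const _
  have hm : MapsTo (fun z => (f z - g z).im / (2 * Real.pi)) S (range ((↑) : ℤ → ℝ)) := by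
    intro z hz
    obtain ⟨n, hn, -⟩ := key z hz
    exact ⟨n, hn⟩
  have hd : DiscreteTopology (range ((↑) : ℤ → ℝ)) :=
    Int.isClosedEmbedding_coe_real.isEmbedding.toHomeomorph.discreteTopology
  have := hS.constant_of_mapsTo ⟨hd⟩ hc hm hx hy
  obtain ⟨n, hn, hn'⟩ := key x hx
  obtain ⟨m, hm, hm'⟩ := key y hy
  rw [← hn, ← hm] at this
  rw [hn', hm', Int.cast_injective this]

/-- A plane curve that starts at a real point between the endpoints of `C`, with `C` above its
end and the curve off the outward horizontal rays at the ends of `C`, must meet `C`. -/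
theorem exists_crossing {γ C : ℝ → ℂ} (hγ : ContinuousOn γ (Icc 0 1))
    (hC : ContinuousOn C (Icc 0 1))
    (h0 : ∀ t ∈ Icc (0:ℝ) 1, γ 0 - C t ∈ Complex.slitPlane ∧ 0 ≤ (γ 0 - C t).im)
    (h1 : ∀ t ∈ Icc (0:ℝ) 1, (γ 1 - C t).im < 0)
    (hl : ∀ s ∈ Icc (0:ℝ) 1, γ s - C 0 ∈ Complex.slitPlane)
    (hr : ∀ s ∈ Icc (0:ℝ) 1, C 1 - γ s ∈ Complex.slitPlane)
    (hr0 : 0 < (γ 0 - C 1).im) :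
    ∃ s ∈ Icc (0:ℝ) 1, ∃ t ∈ Icc (0:ℝ) 1, γ s = C t := by
  by_contra! hne
  set p : ℝ → ℝ := fun s => projIcc (0:ℝ) 1 zero_le_one s
  have hp : Continuous p := continuous_subtype_val.comp continuous_projIcc
  have hpm : ∀ s, p s ∈ Icc (0:ℝ) 1 := fun s => (projIcc (0:ℝ) 1 zero_le_one s).2
  have hpe : ∀ s ∈ Icc (0:ℝ) 1, p s = s := fun s hs => by simp [p, projIcc_of_mem _ hs]
  obtain ⟨g, hg, hge⟩ := exists_continuous_exp_eq (X := ℝ × ℝ)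
    (f := fun q => γ (p q.1) - C (p q.2))
    ((hγ.comp_continuous (hp.comp continuous_fst) fun q => hpm _).sub
      (hC.comp_continuous (hp.comp continuous_snd) fun q => hpm _))
    (fun q => sub_ne_zero.2 (hne _ (hpm _) _ (hpm _)))
  have z : (0:ℝ) ∈ Icc (0:ℝ) 1 := by simp
  have o : (1:ℝ) ∈ Icc (0:ℝ) 1 := by simp
  have hpc : IsPreconnected (Icc (0:ℝ) 1) := isPreconnected_Icc
  have hs1 : ∀ t ∈ Icc (0:ℝ) 1, γ 1 - C t ∈ Complex.slitPlane := fun t ht =>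
    Complex.mem_slitPlane_iff.2 (Or.inr (h1 t ht).ne)
  have A1 := sub_eq_sub_of_exp_eq hpc (f := fun s => g (s, 0))
    (g := fun s => Complex.log (γ s - C 0)) (by fun_prop)
    ((hγ.sub continuousOn_const).clog hl) (fun s hs => by
      simp only [hge, hpe s hs, hpe 0 z, Complex.exp_log (Complex.slitPlane_ne_zero (hl s hs))])
      z o
  have A2 := sub_eq_sub_of_exp_eq hpc (f := fun t => g (1, t))
    (g := fun t => Complex.log (γ 1 - C t)) (by fun_prop)
    ((continuousOn_const.sub hC).clog hs1) (fun t ht => by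
      simp only [hge, hpe t ht, hpe 1 o, Complex.exp_log (Complex.slitPlane_ne_zero (hs1 t ht))])
      z o
  have A3 := sub_eq_sub_of_exp_eq hpc (f := fun t => g (0, t))
    (g := fun t => Complex.log (γ 0 - C t)) (by fun_prop)
    ((continuousOn_const.sub hC).clog fun t ht => (h0 t ht).1) (fun t ht => by
      simp only [hge, hpe t ht, hpe 0 z,
        Complex.exp_log (Complex.slitPlane_ne_zero (h0 t ht).1)]) z o
  have A4 := sub_eq_sub_of_exp_eq hpc (f := fun s => g (s, 1))
    (g := fun s => Complex.log (C 1 - γ s) + Real.pi * Complex.I) (by fun_prop)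
    (((continuousOn_const.sub hγ).clog hr).add continuousOn_const) (fun s hs => by
      simp only [hge, hpe s hs, hpe 1 o, Complex.exp_add, Complex.exp_pi_mul_I,
        Complex.exp_log (Complex.slitPlane_ne_zero (hr s hs))]
      ring) z o
  have B0 : (Complex.log (C 1 - γ 0)).im = (Complex.log (γ 0 - C 1)).im - Real.pi := by
    rw [Complex.log_im, Complex.log_im, ← neg_sub, Complex.arg_neg_eq_arg_sub_pi_of_im_pos hr0]
  have B1 : (Complex.log (C 1 - γ 1)).im = (Complex.log (γ 1 - C 1)).im + Real.pi := by
    rw [Complex.log_im, Complex.log_im, ← neg_sub,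
      Complex.arg_neg_eq_arg_add_pi_of_im_neg (h1 1 o)]
  have E1 := congrArg Complex.im A1
  have E2 := congrArg Complex.im A2
  have E3 := congrArg Complex.im A3
  have E4 := congrArg Complex.im A4
  simp only [Complex.sub_im (g _), Complex.add_im, B0, B1] at E1 E2 E3 E4
  have := Real.pi_pos
  simp at E1 E2 E3 E4
  linarith

/-- Alexander's lemma for a small set meeting a closed set in one point: it cannot separate two
points far from it that the closed set does not separate. -/
theorem joinedIn_compl_union_of_subset_ball {K₁ K₂ : Set ℂ} (h₁ : IsClosed K₁) (h₂ : IsClosed K₂)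
    {c : ℂ} {r : ℝ} (hr : 0 < r) (hc₁ : c ∈ K₁) (hc₂ : c ∈ K₂)
    (hK : ∀ x ∈ K₁, x ∈ K₂ → x = c) (hb : K₂ ⊆ ball c r) {L R : ℂ} (hL : r ≤ ‖L - c‖)
    (hR : r ≤ ‖R - c‖) (hJ : JoinedIn K₁ᶜ L R) : JoinedIn (K₁ ∪ K₂)ᶜ L R := by
  classical
  by_contra hRA
  set U : Set ℂ := (K₁ ∪ K₂)ᶜ with hU
  have hUo : IsOpen U := (h₁.union h₂).isOpen_compl
  set A := pathComponentIn U L with hA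
  have hAo : IsOpen A := hUo.pathComponentIn L
  have hAU : A ⊆ U := pathComponentIn_subset
  have hfr : ∀ x ∈ frontier A, x ∈ K₁ ∨ x ∈ K₂ := by
    intro x hx
    by_contra hxU
    have hxU : x ∈ U := hxU
    obtain ⟨y, hy, hyA⟩ := mem_closure_iff.1 hx.1 _ (hUo.pathComponentIn x)
      (mem_pathComponentIn_self hxU)
    have hy : JoinedIn U x y := hy
    have hyA : JoinedIn U L y := hyA
    have : x ∈ A := hyA.trans hy.symm
    rw [hAo.frontier_eq] at hx
    exact hx.2 this
  have n₁ : K₁.Nonempty := ⟨c, hc₁⟩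
  have n₂ : K₂.Nonempty := ⟨c, hc₂⟩
  set φ : ℂ → ℝ := fun x => infDist x K₁ / (infDist x K₁ + infDist x K₂) with hφ
  have z₁ : ∀ x, x ∈ K₁ → φ x = 0 := fun x hx => by simp [hφ, infDist_zero_of_mem hx]
  have z₂ : ∀ x, x ≠ c → x ∈ K₂ → φ x = 1 := fun x hxc hx => by
    have : infDist x K₁ ≠ 0 := fun h =>
      hxc (hK x ((h₁.mem_iff_infDist_zero n₁).2 h) hx)
    simp [hφ, infDist_zero_of_mem hx, this]
  have φc : ContinuousOn φ {c}ᶜ := by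
    refine ContinuousOn.div (continuous_infDist_pt _).continuousOn
      ((continuous_infDist_pt _).add (continuous_infDist_pt _)).continuousOn fun x hx h => hx ?_
    have e₁ := infDist_nonneg (x := x) (s := K₁)
    have e₂ := infDist_nonneg (x := x) (s := K₂)
    exact hK x ((h₁.mem_iff_infDist_zero n₁).2 (by linarith))
      ((h₂.mem_iff_infDist_zero n₂).2 (by linarith))
  have φc' : ContinuousOn (fun x => (φ x : ℂ)) {c}ᶜ :=
    Complex.continuous_ofReal.comp_continuousOn φc
  set τ : ℂ := 2 * Real.pi * Complex.I with hτ
  have eτ : Complex.exp τ = 1 := Complex.exp_two_pi_mul_I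
  have nτ : τ ≠ 0 := Complex.two_pi_I_ne_zero
  set h : ℂ → ℂ := fun x => if x ∈ A then Complex.exp (τ * φ x) else 1 with hh
  set θ₁ : ℂ → ℂ := fun x => if x ∈ A then τ * (φ x - 1) else 0 with hθ₁
  set θ₂ : ℂ → ℂ := fun x => if x ∈ A then τ * φ x else 0 with hθ₂
  have s₁ : K₁ᶜ ⊆ {c}ᶜ := fun x hx hxc => hx (by rw [mem_singleton_iff.1 hxc]; exact hc₁)
  have s₂ : K₂ᶜ ⊆ {c}ᶜ := fun x hx hxc => hx (by rw [mem_singleton_iff.1 hxc]; exact hc₂)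
  have hcont : ContinuousOn h {c}ᶜ := by
    refine ContinuousOn.if ?_ ?_ continuousOn_const
    · rintro x ⟨hx, hx'⟩
      rcases hfr x hx' with h' | h'
      · simp [z₁ x h']
      · simp [z₂ x hx h', eτ]
    · exact (Complex.continuous_exp.comp_continuousOn (continuousOn_const.mul φc')).mono
        inter_subset_left
  have c₁ : ContinuousOn θ₁ K₁ᶜ := by
    refine ContinuousOn.if ?_ ?_ continuousOn_const
    · rintro x ⟨hx, hx'⟩
      rcases hfr x hx' with h' | h'
      · exact absurd h' hx
      · simp [z₂ x (s₁ hx) h']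
    · exact (continuousOn_const.mul (φc'.sub continuousOn_const)).mono
        (inter_subset_left.trans s₁)
  have c₂ : ContinuousOn θ₂ K₂ᶜ := by
    refine ContinuousOn.if ?_ ?_ continuousOn_const
    · rintro x ⟨hx, hx'⟩
      rcases hfr x hx' with h' | h'
      · simp [z₁ x h']
      · exact absurd h' hx
    · exact (continuousOn_const.mul φc').mono (inter_subset_left.trans s₂)
  have e₁ : ∀ x, Complex.exp (θ₁ x) = h x := fun x => by
    by_cases hx : x ∈ A <;> simp [hθ₁, hh, hx, mul_sub, Complex.exp_sub, eτ]
  have e₂ : ∀ x, Complex.exp (θ₂ x) = h x := fun x => by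
    by_cases hx : x ∈ A <;> simp [hθ₂, hh, hx]
  have hne : ∀ x, h x ≠ 0 := fun x => by rw [← e₂]; exact Complex.exp_ne_zero _
  obtain ⟨θ, hθ, hθe⟩ := exists_continuous_exp_eq (f := fun w => h (c + Complex.exp w))
    (hcont.comp_continuous (by fun_prop) fun w => by simp) fun w => hne _
  set S : Set ℂ := {w | Real.log r ≤ w.re}
  have hS : IsPreconnected S := (convex_halfSpace_re_ge _).isPreconnected
  have hmS : ∀ w ∈ S, c + Complex.exp w ∈ K₂ᶜ := by
    intro w hw hwK
    have := hb hwK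
    rw [mem_ball, dist_eq_norm, add_sub_cancel_left, Complex.norm_exp] at this
    exact absurd this (not_lt.2 ((Real.log_le_iff_le_exp hr).1 hw))
  have hconst : ∀ w ∈ S, ∀ w' ∈ S, θ w - θ₂ (c + Complex.exp w) = θ w' - θ₂ (c + Complex.exp w') :=
    fun w hw w' hw' => sub_eq_sub_of_exp_eq hS hθ.continuousOn
      (g := fun w => θ₂ (c + Complex.exp w)) (c₂.comp (by fun_prop) hmS)
      (fun x _ => by rw [hθe, e₂]) hw hw'
  have hw₀ : ((Real.log r : ℝ) : ℂ) ∈ S := by simp [S]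
  have hw₁ : ((Real.log r : ℝ) : ℂ) + τ ∈ S := by simp [S, hτ]
  have hper : Function.Periodic θ τ := by
    intro w
    have p₁ := sub_eq_sub_of_exp_eq isPreconnected_univ (f := fun w => θ (w + τ)) (g := θ)
      (by fun_prop) hθ.continuousOn (fun x _ => by
        rw [hθe, hθe, Complex.exp_add, eτ, mul_one]) (mem_univ w) (mem_univ (Real.log r : ℂ))
    have p₂ := hconst _ hw₀ _ hw₁
    rw [Complex.exp_add, eτ, mul_one] at p₂
    linear_combination p₁ - p₂
  set k := θ (Real.log r : ℂ) - θ₂ (c + Complex.exp (Real.log r : ℂ)) with hk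
  have ek : Complex.exp k = 1 := by
    rw [hk, Complex.exp_sub, hθe, e₂, div_self (hne _)]
  set Θ : ℂ → ℂ := fun x => θ (Complex.log (x - c)) - k with hΘ
  have hΘw : ∀ x w, Complex.exp w = x - c → Θ x = θ w - k := by
    intro x w hw
    have : Complex.exp w = Complex.exp (Complex.log (x - c)) := by
      rw [Complex.exp_log (by rw [← hw]; exact Complex.exp_ne_zero _), hw]
    obtain ⟨n, hn⟩ := Complex.exp_eq_exp_iff_exists_int.1 this
    simp only [hΘ]
    rw [hn, hper.int_mul n]
  have cΘ : ContinuousOn Θ {c}ᶜ := by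
    intro x₀ hx₀
    apply ContinuousAt.continuousWithinAt
    have hx₀' : x₀ - c ≠ 0 := sub_ne_zero.2 hx₀
    have : Θ =ᶠ[𝓝 x₀] fun x =>
        θ (Complex.log ((x - c) / (x₀ - c)) + Complex.log (x₀ - c)) - k := by
      filter_upwards [isOpen_compl_singleton.mem_nhds hx₀] with x hx
      have hx' : x - c ≠ 0 := sub_ne_zero.2 hx
      apply hΘw
      rw [Complex.exp_add, Complex.exp_log (div_ne_zero hx' hx₀'), Complex.exp_log hx₀']
      field_simp
    refine ContinuousAt.congr ?_ this.symm
    refine ContinuousAt.sub (hθ.continuousAt.comp (ContinuousAt.add ?_ continuousAt_const))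
      continuousAt_const
    refine ContinuousAt.clog (by fun_prop) ?_
    rw [div_self hx₀']
    exact Complex.one_mem_slitPlane
  have eΘ : ∀ x ∈ ({c}ᶜ : Set ℂ), Complex.exp (Θ x) = h x := by
    intro x hx
    have hx' : x - c ≠ 0 := sub_ne_zero.2 hx
    simp only [hΘ]
    rw [Complex.exp_sub, ek, hθe, Complex.exp_log hx', div_one, add_sub_cancel]
  have far : ∀ x, r ≤ ‖x - c‖ → Θ x = θ₂ x := by
    intro x hx
    have hx' : x - c ≠ 0 := norm_pos_iff.1 (hr.trans_le hx)
    have hxS : Complex.log (x - c) ∈ S := by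
      simp only [S, mem_ofPred_eq, Complex.log_re]
      exact Real.log_le_log hr hx
    have := hconst _ hxS _ hw₀
    rw [Complex.exp_log hx', add_sub_cancel] at this
    simp only [hΘ]
    linear_combination this
  have hP : IsPreconnected (range hJ.somePath) := isPreconnected_range hJ.somePath.continuous
  have hPs : range hJ.somePath ⊆ K₁ᶜ := range_subset_iff.2 hJ.somePath_mem
  have fin := sub_eq_sub_of_exp_eq hP (cΘ.mono (hPs.trans s₁)) (c₁.mono hPs)
    (fun x hx => by rw [eΘ x (s₁ (hPs hx)), e₁])
    (x := L) (y := R) ⟨0, by simp⟩ ⟨1, by simp⟩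
  have hLU : L ∈ U := by
    rintro (h' | h')
    · exact hJ.source_mem h'
    · exact absurd (mem_ball_iff_norm.1 (hb h')) (not_lt.2 hL)
  have hLA : L ∈ A := mem_pathComponentIn_self hLU
  have hRA' : R ∉ A := hRA
  rw [far L hL, far R hR] at fin
  simp only [hθ₁, hθ₂, hLA, hRA', if_true, if_false] at fin
  apply nτ
  linear_combination fin

theorem joinedIn_compl_union_arc {K : Set ℂ} (hK : IsClosed K) {γ : ℝ → ℂ} {a b : ℝ} (hab : a ≤ b)
    (hγ : ContinuousOn γ (Icc a b)) (hi : InjOn γ (Icc a b)) (ha : γ a ∈ K)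
    (hd : ∀ t ∈ Ioc a b, γ t ∉ K) {L R : ℂ} (hL : L ∉ γ '' Icc a b) (hR : R ∉ γ '' Icc a b)
    (hJ : JoinedIn Kᶜ L R) : JoinedIn (K ∪ γ '' Icc a b)ᶜ L R := by
  have hcl : IsClosed (γ '' Icc a b) := (isCompact_Icc.image_of_continuousOn hγ).isClosed
  obtain ⟨r, hr, hrL, hrR⟩ : ∃ r > 0, (∀ t ∈ Icc a b, r ≤ ‖L - γ t‖) ∧
      ∀ t ∈ Icc a b, r ≤ ‖R - γ t‖ := by
    obtain ⟨r₁, h₁, h₁'⟩ := Metric.isOpen_iff.1 hcl.isOpen_compl L hL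
    obtain ⟨r₂, h₂, h₂'⟩ := Metric.isOpen_iff.1 hcl.isOpen_compl R hR
    refine ⟨min r₁ r₂, lt_min h₁ h₂, fun t ht => ?_, fun t ht => ?_⟩
    · by_contra! h
      exact h₁' (mem_ball_iff_norm'.2 (h.trans_le (min_le_left _ _))) (mem_image_of_mem γ ht)
    · by_contra! h
      exact h₂' (mem_ball_iff_norm'.2 (h.trans_le (min_le_right _ _))) (mem_image_of_mem γ ht)
  obtain ⟨η, hη, hηr⟩ := Metric.uniformContinuousOn_iff.1
    (isCompact_Icc.uniformContinuousOn_of_continuous hγ) r hr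
  have key : ∀ n : ℕ, ∀ t ∈ Icc a b, t ≤ a + n * (η / 2) →
      JoinedIn (K ∪ γ '' Icc a t)ᶜ L R := by
    intro n
    induction n with
    | zero =>
      intro t ht hta
      have : t = a := le_antisymm (by simpa using hta) ht.1
      subst this
      simpa [union_eq_self_of_subset_right, ha] using hJ
    | succ n ih =>
      intro t ht hta
      set u := max a (t - η / 2) with hu
      have hut : u ≤ t := max_le ht.1 (by linarith)
      have hau : a ≤ u := le_max_left _ _
      have hum : u ∈ Icc a b := ⟨hau, hut.trans ht.2⟩
      have hun : u ≤ a + n * (η / 2) := by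
        push_cast at hta
        exact max_le (le_add_of_nonneg_right (by positivity)) (by linarith)
      have hsub : Icc u t ⊆ Icc a b := Icc_subset_Icc hau ht.2
      have hsub' : Icc a u ⊆ Icc a b := Icc_subset_Icc le_rfl hum.2
      have := joinedIn_compl_union_of_subset_ball
        (hK.union (isCompact_Icc.image_of_continuousOn (hγ.mono hsub')).isClosed)
        (isCompact_Icc.image_of_continuousOn (hγ.mono hsub)).isClosed (c := γ u) hr
        (Or.inr (mem_image_of_mem γ (right_mem_Icc.2 hau)))
        (mem_image_of_mem γ (left_mem_Icc.2 hut)) ?_ ?_ (hrL u hum) (hrR u hum) (ih u hum hun)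
      · rwa [union_assoc, ← image_union, Icc_union_Icc_eq_Icc hau hut] at this
      · rintro _ hx ⟨v, hv, rfl⟩
        rcases hx with hx | ⟨w, hw, hwv⟩
        · have : v = a := by
            by_contra h
            exact hd v ⟨lt_of_le_of_ne (hau.trans hv.1) (Ne.symm h), (hsub hv).2⟩ hx
          rw [le_antisymm hv.1 (this.le.trans hau)]
        · have := hi (hsub' hw) (hsub hv) hwv
          rw [le_antisymm hv.1 (this ▸ hw.2)]
      · rintro _ ⟨v, hv, rfl⟩
        refine hηr v (hsub hv) u hum ?_
        rw [Real.dist_eq, abs_of_nonneg (by linarith [hv.1])]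
        have := le_max_right a (t - η / 2)
        linarith [hv.2]
  obtain ⟨n, hn⟩ := exists_nat_gt ((b - a) / (η / 2))
  rw [div_lt_iff₀ (by positivity)] at hn
  exact key n b (right_mem_Icc.2 hab) (by linarith)

theorem joinedIn_compl_union_arc' {K : Set ℂ} (hK : IsClosed K) {γ : ℝ → ℂ} {a b : ℝ} (hab : a ≤ b)
    (hγ : ContinuousOn γ (Icc a b)) (hi : InjOn γ (Icc a b)) (hb : γ b ∈ K)
    (hd : ∀ t ∈ Ico a b, γ t ∉ K) {L R : ℂ} (hL : L ∉ γ '' Icc a b) (hR : R ∉ γ '' Icc a b)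
    (hJ : JoinedIn Kᶜ L R) : JoinedIn (K ∪ γ '' Icc a b)ᶜ L R := by
  have hm : MapsTo (fun t : ℝ => -t) (Icc (-b) (-a)) (Icc a b) := fun t ht =>
    ⟨by linarith [ht.2], by linarith [ht.1]⟩
  have him : (fun t => γ (-t)) '' Icc (-b) (-a) = γ '' Icc a b := by
    rw [← Function.comp_def γ, image_comp]
    simp
  rw [← him] at hL hR ⊢
  refine joinedIn_compl_union_arc hK (neg_le_neg hab) (hγ.comp (by fun_prop) hm)
    (fun x hx y hy h => neg_injective (hi (hm hx) (hm hy) h)) (by simpa using hb)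
    (fun t ht => hd _ ⟨by linarith [ht.2], by linarith [ht.1]⟩) hL hR hJ

/-- If two points off an arc are joined off all but an open subarc, they are joined off all but
any smaller open subarc. -/
theorem joinedIn_compl_shrink {K : Set ℂ} (hK : IsClosed K) {γ : ℝ → ℂ}
    (hγ : ContinuousOn γ (Icc 0 1)) (hi : InjOn γ (Icc 0 1)) {s s' t' t : ℝ} (hs : 0 ≤ s)
    (hss : s ≤ s') (hst : s' < t') (htt : t' ≤ t) (ht : t ≤ 1) (hd : ∀ u ∈ Ioo s t, γ u ∉ K)
    {L R : ℂ} (hL : L ∉ γ '' Icc 0 1) (hR : R ∉ γ '' Icc 0 1)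
    (hJ : JoinedIn (K ∪ γ '' Icc 0 s ∪ γ '' Icc t 1)ᶜ L R) :
    JoinedIn (K ∪ γ '' Icc 0 s' ∪ γ '' Icc t' 1)ᶜ L R := by
  have cl : ∀ a b, 0 ≤ a → b ≤ 1 → IsClosed (γ '' Icc a b) := fun a b ha hb =>
    (isCompact_Icc.image_of_continuousOn (hγ.mono (Icc_subset_Icc ha hb))).isClosed
  have nL : ∀ a b, 0 ≤ a → b ≤ 1 → L ∉ γ '' Icc a b := fun a b ha hb h =>
    hL (image_mono (Icc_subset_Icc ha hb) h)
  have nR : ∀ a b, 0 ≤ a → b ≤ 1 → R ∉ γ '' Icc a b := fun a b ha hb h =>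
    hR (image_mono (Icc_subset_Icc ha hb) h)
  have s1 : Icc s s' ⊆ Icc 0 1 := Icc_subset_Icc hs (by linarith)
  have s2 : Icc t' t ⊆ Icc 0 1 := Icc_subset_Icc (by linarith) ht
  have J1 := joinedIn_compl_union_arc ((hK.union (cl 0 s le_rfl (by linarith))).union
    (cl t 1 (by linarith) le_rfl)) hss (hγ.mono s1) (hi.mono s1)
    (Or.inl (Or.inr (mem_image_of_mem γ (right_mem_Icc.2 hs)))) (by
      rintro u hu ((h | ⟨v, hv, hvu⟩) | ⟨v, hv, hvu⟩)
      · exact hd u ⟨hu.1, by linarith [hu.2]⟩ h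
      · have := hi ⟨hv.1, by linarith [hv.2]⟩ (s1 (Ioc_subset_Icc_self hu)) hvu
        linarith [hv.2, hu.1]
      · have := hi ⟨by linarith [hv.1], hv.2⟩ (s1 (Ioc_subset_Icc_self hu)) hvu
        linarith [hv.1, hu.2])
    (nL _ _ hs (by linarith)) (nR _ _ hs (by linarith)) hJ
  have e1 : K ∪ γ '' Icc 0 s ∪ γ '' Icc t 1 ∪ γ '' Icc s s' =
      K ∪ γ '' Icc 0 s' ∪ γ '' Icc t 1 := by
    rw [← Icc_union_Icc_eq_Icc hs hss, image_union]
    simp only [← union_assoc]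
    exact union_right_comm _ _ _
  rw [e1] at J1
  have J2 := joinedIn_compl_union_arc' ((hK.union (cl 0 s' le_rfl (by linarith))).union
    (cl t 1 (by linarith) le_rfl)) htt (hγ.mono s2) (hi.mono s2)
    (Or.inr (mem_image_of_mem γ (left_mem_Icc.2 ht))) (by
      rintro u hu ((h | ⟨v, hv, hvu⟩) | ⟨v, hv, hvu⟩)
      · exact hd u ⟨by linarith [hu.1], hu.2⟩ h
      · have := hi ⟨hv.1, by linarith [hv.2]⟩ (s2 (Ico_subset_Icc_self hu)) hvu
        linarith [hv.2, hu.1]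
      · have := hi ⟨by linarith [hv.1], hv.2⟩ (s2 (Ico_subset_Icc_self hu)) hvu
        linarith [hv.1, hu.2])
    (nL _ _ (by linarith) ht) (nR _ _ (by linarith) ht) J1
  have e2 : K ∪ γ '' Icc 0 s' ∪ γ '' Icc t 1 ∪ γ '' Icc t' t =
      K ∪ γ '' Icc 0 s' ∪ γ '' Icc t' 1 := by
    rw [← Icc_union_Icc_eq_Icc htt ht, image_union, union_assoc, union_comm (γ '' Icc t 1)]
  rwa [e2] at J2

/-- Near an interior point of an arc, all pairs of points off the arc can be joined locally
through an arbitrarily short piece of the arc. -/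
theorem exists_ball_joinedIn {γ : ℝ → ℂ} (hγ : ContinuousOn γ (Icc 0 1)) (hi : InjOn γ (Icc 0 1))
    {m : ℝ} (hm : m ∈ Ioo (0:ℝ) 1) {ε : ℝ} (hε : 0 < ε) :
    ∃ ρ > 0, ∀ L ∈ ball (γ m) ρ, ∀ R ∈ ball (γ m) ρ, L ∉ γ '' Icc 0 1 → R ∉ γ '' Icc 0 1 →
      ∀ s' t', 0 ≤ s' → s' < m → m < t' → t' ≤ 1 →
      JoinedIn (ball (γ m) ε \ (γ '' Icc 0 s' ∪ γ '' Icc t' 1)) L R := by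
  have hca : ContinuousAt γ m := hγ.continuousAt (Icc_mem_nhds hm.1 hm.2)
  obtain ⟨η, hη, hηε⟩ := Metric.continuousAt_iff.1 hca ε hε
  obtain ⟨s, hs0, hsm, hs⟩ : ∃ s, 0 ≤ s ∧ s < m ∧ m - η < s :=
    ⟨max 0 (m - η / 2), le_max_left _ _, max_lt hm.1 (by linarith),
      lt_max_of_lt_right (by linarith)⟩
  obtain ⟨t, ht1, htm, ht⟩ : ∃ t, t ≤ 1 ∧ m < t ∧ t < m + η :=
    ⟨min 1 (m + η / 2), min_le_left _ _, lt_min hm.2 (by linarith),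
      min_lt_of_right_lt (by linarith)⟩
  have cl : ∀ a b, 0 ≤ a → b ≤ 1 → IsClosed (γ '' Icc a b) := fun a b ha hb =>
    (isCompact_Icc.image_of_continuousOn (hγ.mono (Icc_subset_Icc ha hb))).isClosed
  have hmI : m ∈ Icc (0:ℝ) 1 := Ioo_subset_Icc_self hm
  have hnot : γ m ∉ γ '' Icc 0 s ∪ γ '' Icc t 1 := by
    rintro (⟨v, hv, hvm⟩ | ⟨v, hv, hvm⟩)
    · have := hi ⟨hv.1, by linarith [hv.2]⟩ hmI hvm
      linarith [hv.2]
    · have := hi ⟨by linarith [hv.1], hv.2⟩ hmI hvm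
      linarith [hv.1]
  obtain ⟨ρ, hρ, hρs⟩ := Metric.isOpen_iff.1
    ((cl 0 s le_rfl (by linarith)).union (cl t 1 (by linarith) le_rfl)).isOpen_compl _ hnot
  refine ⟨min ρ ε, lt_min hρ hε, fun L hL R hR hLγ hRγ s' t' hs' hsm' htm' ht' => ?_⟩
  have base : JoinedIn ((ball (γ m) ε)ᶜ ∪ γ '' Icc 0 s ∪ γ '' Icc t 1)ᶜ L R := by
    have := ((convex_ball (γ m) (min ρ ε)).isPathConnected ⟨L, hL⟩).joinedIn L hL R hR
    refine this.mono fun x hx => ?_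
    rw [union_assoc]
    rintro (h | h)
    · exact h (ball_subset_ball (min_le_right _ _) hx)
    · exact hρs (ball_subset_ball (min_le_left _ _) hx) h
  have := joinedIn_compl_shrink isOpen_ball.isClosed_compl hγ hi (s' := max s s')
    (t' := min t t') hs0 (le_max_left _ _)
    ((max_lt hsm hsm').trans (lt_min htm htm')) (min_le_left _ _) ht1 (fun u hu h => h
      (hηε (by rw [Real.dist_eq, abs_lt]; constructor <;> linarith [hu.1, hu.2]))) hLγ hRγ base
  refine this.mono fun x hx => ?_
  rw [union_assoc] at hx
  refine ⟨by_contra fun h => hx (Or.inl h), fun h => hx (Or.inr ?_)⟩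
  rcases h with h | h
  · exact Or.inl (image_mono (Icc_subset_Icc le_rfl (le_max_right _ _)) h)
  · exact Or.inr (image_mono (Icc_subset_Icc (min_le_right _ _) le_rfl) h)

/-- Infinitely many paths shrinking to a point can be concatenated. -/
theorem joinedIn_of_seq {E : Type*} [MetricSpace E] {W : Set E} {x : ℕ → E} {p : E} {ε : ℕ → ℝ}
    (hε : Antitone ε) (hε0 : Tendsto ε atTop (𝓝 0))
    (hJ : ∀ k, JoinedIn (ball p (ε k) ∩ W) (x k) (x (k + 1))) :
    JoinedIn (W ∪ {p}) (x 0) p := by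
  choose e he using hJ
  set f : ℝ → E := fun t => (e ⌊t⌋₊).extend (t - ⌊t⌋₊) with hf
  have hfe : ∀ (k : ℕ) (t : ℝ), ⌊t⌋₊ = k → f t = (e k).extend (t - k) := by
    rintro _ t rfl
    rfl
  have hmem : ∀ t, f t ∈ ball p (ε ⌊t⌋₊) ∩ W := fun t => by
    have : f t ∈ range (e ⌊t⌋₊) := by
      rw [← Path.extend_range]
      exact mem_range_self _
    obtain ⟨u, hu⟩ := this
    rw [← hu]
    exact he _ u
  have hfk : ∀ k : ℕ, ContinuousOn f (Icc k (k + 1)) := by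
    intro k
    have : ContinuousOn (fun t : ℝ => (e k).extend (t - k)) (Icc k (k + 1)) :=
      ((e k).continuous_extend.comp (by fun_prop)).continuousOn
    refine this.congr fun t ht => ?_
    rcases ht.2.eq_or_lt with h | h
    · have hfl : ⌊t⌋₊ = k + 1 := by
        rw [h]
        exact_mod_cast Nat.floor_natCast (R := ℝ) (k + 1)
      rw [hfe (k + 1) t hfl, h]
      simp
    · have hfl : ⌊t⌋₊ = k := (Nat.floor_eq_iff (k.cast_nonneg.trans ht.1)).2 ⟨ht.1, h⟩
      exact hfe k t hfl
  have hlf : LocallyFinite fun k : ℕ => Icc (k : ℝ) (k + 1) := by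
    intro t
    refine ⟨Iio (t + 1), Iio_mem_nhds (by linarith), (finite_le_nat ⌈t + 1⌉₊).subset ?_⟩
    rintro k ⟨u, hu, hut⟩
    have : (k : ℝ) < t + 1 := hu.1.trans_lt hut
    exact_mod_cast this.le.trans (Nat.le_ceil _)
  have hfc : ContinuousOn f (Ici 0) := by
    refine (hlf.continuousOn_iUnion (fun k => isClosed_Icc) hfk).mono fun t ht => ?_
    exact mem_iUnion.2 ⟨⌊t⌋₊, Nat.floor_le ht, (Nat.lt_floor_add_one t).le⟩
  refine JoinedIn.ofLine (f := fun t => if t < 1 then f (t / (1 - t)) else p) ?_ ?_ (by simp) ?_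
  · intro t ht
    rcases ht.2.eq_or_lt with h | h
    · subst h
      simp only [ContinuousWithinAt, lt_irrefl, if_false]
      rw [Metric.tendsto_nhdsWithin_nhds]
      intro r hr
      obtain ⟨K, hK⟩ := (hε0.eventually (gt_mem_nhds hr)).exists
      refine ⟨1 / (K + 2), by positivity, fun {t} ht htd => ?_⟩
      split_ifs with h1
      · have hK' : K ≤ ⌊t / (1 - t)⌋₊ := by
          apply Nat.le_floor
          rw [le_div_iff₀ (by linarith)]
          rw [Real.dist_eq, abs_of_neg (by linarith), lt_div_iff₀ (by positivity)] at htd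
          nlinarith
        exact (mem_ball.1 (hmem _).1).trans_le ((hε hK').trans hK.le)
      · simpa using hr
    · have h1 : ContinuousWithinAt (fun t : ℝ => f (t / (1 - t))) unitInterval t := by
        have : ContinuousWithinAt (fun t : ℝ => f (t / (1 - t))) (unitInterval ∩ Iio 1) t := by
          refine ContinuousWithinAt.comp (f := fun t : ℝ => t / (1 - t)) (g := f) (t := Ici 0)
            (hfc _ (div_nonneg ht.1 (sub_nonneg.2 ht.2))) ?_ ?_
          · exact (ContinuousAt.div continuousAt_id (by fun_prop)
              (sub_ne_zero.2 h.ne')).continuousWithinAt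
          · exact fun u hu => div_nonneg hu.1.1 (sub_nonneg.2 hu.1.2)
        rwa [continuousWithinAt_inter (Iio_mem_nhds h)] at this
      refine h1.congr_of_eventuallyEq ?_ (by simp [h])
      filter_upwards [mem_nhdsWithin_of_mem_nhds (Iio_mem_nhds h)] with u hu
      simp [mem_Iio.1 hu]
  · simp [hf]
  · rintro _ ⟨t, ht, rfl⟩
    simp only
    split_ifs with h
    · exact Or.inl (hmem _).2
    · exact Or.inr rfl

/-- If two points can be joined in `B` through arbitrarily short pieces of an arc, but not off
the arc, the first one can be joined off the arc to a point near the middle of those pieces. -/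
theorem exists_mem_ball_joinedIn {γ : ℝ → ℂ} (hγ : ContinuousOn γ (Icc 0 1))
    {m : ℝ} (hm : m ∈ Ioo (0:ℝ) 1) {B : Set ℂ} {L R : ℂ} (hL : L ∉ γ '' Icc 0 1)
    (hJ : ∀ s' t', 0 ≤ s' → s' < m → m < t' → t' ≤ 1 →
      JoinedIn (B \ (γ '' Icc 0 s' ∪ γ '' Icc t' 1)) L R)
    (hn : ¬ JoinedIn (B \ γ '' Icc 0 1) L R) {σ : ℝ} (hσ : 0 < σ) :
    ∃ L' ∈ ball (γ m) σ, JoinedIn (B \ γ '' Icc 0 1) L L' := by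
  have hca : ContinuousAt γ m := hγ.continuousAt (Icc_mem_nhds hm.1 hm.2)
  obtain ⟨η, hη, hησ⟩ := Metric.continuousAt_iff.1 hca σ hσ
  obtain ⟨s, hs0, hsm, hs⟩ : ∃ s, 0 ≤ s ∧ s < m ∧ m - η < s :=
    ⟨max 0 (m - η / 2), le_max_left _ _, max_lt hm.1 (by linarith),
      lt_max_of_lt_right (by linarith)⟩
  obtain ⟨t, ht1, htm, ht⟩ : ∃ t, t ≤ 1 ∧ m < t ∧ t < m + η :=
    ⟨min 1 (m + η / 2), min_le_left _ _, lt_min hm.2 (by linarith),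
      min_lt_of_right_lt (by linarith)⟩
  obtain ⟨f, hf⟩ := hJ s t hs0 hsm htm ht1
  have hcl : IsClosed (γ '' Icc 0 1) := (isCompact_Icc.image_of_continuousOn hγ).isClosed
  set T := f ⁻¹' (γ '' Icc 0 1) with hT
  have hTc : IsClosed T := hcl.preimage f.continuous
  have hTn : T.Nonempty := by
    by_contra h
    rw [not_nonempty_iff_eq_empty] at h
    exact hn ⟨f, fun u => ⟨(hf u).1, fun hu => (h ▸ (show u ∈ T from hu) : u ∈ (∅ : Set _))⟩⟩
  obtain ⟨u, hu, humin⟩ := hTc.isCompact.exists_isLeast hTn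
  have hfu : f u ∈ ball (γ m) σ := by
    obtain ⟨v, hv, hvu⟩ : f u ∈ γ '' Icc 0 1 := hu
    have hsv : s < v := by
      by_contra! h
      exact (hf u).2 (Or.inl ⟨v, ⟨hv.1, h⟩, hvu⟩)
    have hvt : v < t := by
      by_contra! h
      exact (hf u).2 (Or.inr ⟨v, ⟨h, hv.2⟩, hvu⟩)
    rw [← hvu]
    exact hησ (by rw [Real.dist_eq, abs_lt]; constructor <;> linarith)
  have hu0 : 0 < u := by
    refine unitInterval.pos_iff_ne_zero.2 fun h => hL ?_
    have : f u ∈ γ '' Icc 0 1 := hu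
    rwa [h, f.source] at this
  obtain ⟨l, hl, hlu⟩ := exists_Ioc_subset_of_mem_nhds
    (f.continuous.continuousAt.preimage_mem_nhds (isOpen_ball.mem_nhds hfu)) ⟨0, hu0⟩
  obtain ⟨w, hlw, hwu⟩ := exists_between hl
  refine ⟨f w, hlu ⟨hlw, hwu.le⟩, ?_⟩
  have := JoinedIn.ofLine (F := B \ γ '' Icc 0 1) (x := L) (y := f w)
    (f := fun r : ℝ => f.extend (r * w)) (f.continuous_extend.comp (by fun_prop)).continuousOn
    (by simp) (by simp) ?_
  · exact this
  · rintro _ ⟨r, hr, rfl⟩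
    have hrw : r * w ∈ unitInterval := unitInterval.mul_mem hr w.2
    simp only [f.extend_apply hrw]
    refine ⟨(hf _).1, fun h => ?_⟩
    have h1 : u ≤ ⟨r * w, hrw⟩ := humin h
    have h2 : (u : ℝ) ≤ r * w := h1
    have h3 : (w : ℝ) < u := hwu
    nlinarith [hr.2, w.2.1]

theorem joinedIn_through_point {γ : ℝ → ℂ} (hγ : ContinuousOn γ (Icc 0 1))
    (hi : InjOn γ (Icc 0 1)) {X : Set ℂ} (hX : IsOpen X) {b : ℝ} (hb : b ∈ Ioc (0:ℝ) 1)
    (hbX : ∀ u ∈ Ioo 0 b, γ u ∈ X) {L R : ℂ} (hL : L ∉ γ '' Icc 0 1) (hR : R ∉ γ '' Icc 0 1)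
    (hJ : JoinedIn (X \ (γ '' Icc 0 0 ∪ γ '' Icc b 1)) L R) {m : ℝ} (hm : m ∈ Ioo 0 b) :
    JoinedIn (X \ γ '' Icc 0 1 ∪ {γ m}) L R := by
  by_cases hn : JoinedIn (X \ γ '' Icc 0 1) L R
  · exact hn.mono subset_union_left
  have hm1 : m ∈ Ioo (0:ℝ) 1 := ⟨hm.1, hm.2.trans_le hb.2⟩
  have first : ∀ s' t', 0 ≤ s' → s' < m → m < t' → t' ≤ 1 →
      JoinedIn (X \ (γ '' Icc 0 s' ∪ γ '' Icc t' 1)) L R := by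
    intro s' t' hs hsm htm ht
    have := joinedIn_compl_shrink hX.isClosed_compl hγ hi (s' := s') (t' := min t' b) le_rfl hs
      (hsm.trans (lt_min htm hm.2)) (min_le_right _ _) hb.2 (fun u hu h => h (hbX u hu)) hL hR
      (hJ.mono fun x hx => by
        rw [union_assoc]
        rintro (h | h)
        · exact h hx.1
        · exact hx.2 h)
    refine this.mono fun x hx => ?_
    rw [union_assoc] at hx
    refine ⟨by_contra fun h => hx (Or.inl h), fun h => hx (Or.inr ?_)⟩
    rcases h with h | h
    · exact Or.inl h
    · exact Or.inr (image_mono (Icc_subset_Icc (min_le_left _ _) le_rfl) h)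
  obtain ⟨ε₀, hε₀, hε₀X⟩ := Metric.isOpen_iff.1 hX (γ m) (hbX m hm)
  set ε : ℕ → ℝ := fun k => ε₀ / (k + 1) with hε
  have hεpos : ∀ k, 0 < ε k := fun k => by positivity
  have hεa : Antitone ε := fun i j hij => by
    have : (i : ℝ) ≤ j := by exact_mod_cast hij
    simp only [hε]
    gcongr
  have hε0 : Tendsto ε atTop (𝓝 0) := 
    tendsto_const_nhds.div_atTop (tendsto_natCast_atTop_atTop.atTop_add tendsto_const_nhds)
  have hεX : ∀ k, ball (γ m) (ε k) ⊆ X := fun k =>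
    (ball_subset_ball ((hεa (Nat.zero_le k)).trans (by simp [hε]))).trans hε₀X
  choose ρ hρ hρJ using fun k => exists_ball_joinedIn hγ hi hm1 (hεpos k)
  set W := X \ γ '' Icc 0 1 with hW
  set S : ℕ → ℂ × ℂ → Prop := fun k q => q.1 ∈ ball (γ m) (ρ k) ∧ q.2 ∈ ball (γ m) (ρ k) ∧
    q.1 ∉ γ '' Icc 0 1 ∧ q.2 ∉ γ '' Icc 0 1 ∧ ¬ JoinedIn W q.1 q.2 with hS
  have gen : ∀ (B : Set ℂ) (q : ℂ × ℂ) (k : ℕ), B ⊆ X → q.1 ∉ γ '' Icc 0 1 → q.2 ∉ γ '' Icc 0 1 →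
      ¬ JoinedIn W q.1 q.2 → (∀ s' t', 0 ≤ s' → s' < m → m < t' → t' ≤ 1 →
      JoinedIn (B \ (γ '' Icc 0 s' ∪ γ '' Icc t' 1)) q.1 q.2) →
      ∃ q', S k q' ∧ JoinedIn (B \ γ '' Icc 0 1) q.1 q'.1 ∧
        JoinedIn (B \ γ '' Icc 0 1) q.2 q'.2 := by
    intro B q k hBX h1 h2 hnj hj
    have hBW : B \ γ '' Icc 0 1 ⊆ W := sdiff_subset_sdiff_left hBX
    obtain ⟨x, hx, hxJ⟩ := exists_mem_ball_joinedIn hγ hm1 h1 hj (fun h => hnj (h.mono hBW)) (hρ k)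
    obtain ⟨y, hy, hyJ⟩ := exists_mem_ball_joinedIn hγ hm1 h2
      (fun s' t' a b c d => (hj s' t' a b c d).symm) (fun h => hnj (h.symm.mono hBW)) (hρ k)
    exact ⟨(x, y), ⟨hx, hy, hxJ.target_mem.2, hyJ.target_mem.2, fun h =>
      hnj (((hxJ.mono hBW).trans h).trans (hyJ.mono hBW).symm)⟩, hxJ, hyJ⟩
  obtain ⟨q₀, hq₀, hL₀, hR₀⟩ := gen X (L, R) 0 subset_rfl hL hR hn first
  have step : ∀ k q, S k q → ∃ q', S (k + 1) q' ∧
      JoinedIn (ball (γ m) (ε k) ∩ W) q.1 q'.1 ∧ JoinedIn (ball (γ m) (ε k) ∩ W) q.2 q'.2 := by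
    rintro k q ⟨a1, a2, a3, a4, a5⟩
    obtain ⟨q', h1, h2, h3⟩ := gen (ball (γ m) (ε k)) q (k + 1) (hεX k) a3 a4 a5
      (hρJ k _ a1 _ a2 a3 a4)
    have hs : ball (γ m) (ε k) \ γ '' Icc 0 1 ⊆ ball (γ m) (ε k) ∩ W := fun x hx =>
      ⟨hx.1, hεX k hx.1, hx.2⟩
    exact ⟨q', h1, h2.mono hs, h3.mono hs⟩
  choose! nxt hnxt using step
  set q : ℕ → ℂ × ℂ := fun k => Nat.rec q₀ (fun k q => nxt k q) k with hq
  have hqS : ∀ k, S k (q k) := fun k => by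
    induction k with
    | zero => exact hq₀
    | succ k ih => exact (hnxt k (q k) ih).1
  have JL := joinedIn_of_seq (x := fun k => (q k).1) hεa hε0 fun k => (hnxt k (q k) (hqS k)).2.1
  have JR := joinedIn_of_seq (x := fun k => (q k).2) hεa hε0 fun k => (hnxt k (q k) (hqS k)).2.2
  exact (((hL₀.mono subset_union_left).trans JL).trans JR.symm).trans
    (hR₀.mono subset_union_left).symm

/-- The closed subsets of `[0,1]` containing `0` and `1` such that `f` takes equal values at the
two ends of every complementary interval. -/
def gapEqSets {E : Type*} (f : ℝ → E) : Set (Set ℝ) :=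
  {F | IsClosed F ∧ F ⊆ Icc 0 1 ∧ 0 ∈ F ∧ 1 ∈ F ∧
    ∀ u ∈ F, ∀ v ∈ F, u < v → Ioo u v ∩ F = ∅ → f u = f v}

theorem exists_isGreatest_inter_Iic {F : Set ℝ} (hF : IsClosed F) (hb : F ⊆ Icc 0 1)
    (h0 : (0:ℝ) ∈ F) {t : ℝ} (ht : 0 ≤ t) : ∃ p, IsGreatest (F ∩ Iic t) p := by
  have hc : IsCompact (F ∩ Iic t) :=
    isCompact_Icc.of_isClosed_subset (hF.inter isClosed_Iic) (inter_subset_left.trans hb)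
  exact hc.exists_isGreatest ⟨0, h0, ht⟩

theorem exists_isLeast_inter_Ici {F : Set ℝ} (hF : IsClosed F) (hb : F ⊆ Icc 0 1)
    (h1 : (1:ℝ) ∈ F) {t : ℝ} (ht : t ≤ 1) : ∃ p, IsLeast (F ∩ Ici t) p := by
  have hc : IsCompact (F ∩ Ici t) :=
    isCompact_Icc.of_isClosed_subset (hF.inter isClosed_Ici) (inter_subset_left.trans hb)
  exact hc.exists_isLeast ⟨1, h1, ht⟩

theorem exists_minimal_gapEqSets {E : Type*} [MetricSpace E] {f : ℝ → E}
    (hf : ContinuousOn f (Icc 0 1)) : ∃ F, Minimal (· ∈ gapEqSets f) F := by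
  refine zorn_superset _ fun c hc hch => ?_
  rcases c.eq_empty_or_nonempty with rfl | hcn
  · refine ⟨Icc 0 1, ⟨isClosed_Icc, subset_rfl, by simp, by simp, fun u hu v hv huv h => ?_⟩,
      by simp⟩
    obtain ⟨w, hw⟩ := exists_between huv
    exact absurd (show w ∈ Ioo u v ∩ Icc 0 1 from
      ⟨hw, hu.1.trans hw.1.le, hw.2.le.trans hv.2⟩) (by simp [h])
  refine ⟨⋂₀ c, ⟨isClosed_sInter fun F hF => (hc hF).1, ?_, fun F hF => (hc hF).2.2.1,
    fun F hF => (hc hF).2.2.2.1, ?_⟩, fun F hF => sInter_subset_of_mem hF⟩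
  · obtain ⟨F, hF⟩ := hcn
    exact (sInter_subset_of_mem hF).trans (hc hF).2.1
  intro u hu v hv huv hgap
  have hu1 : u ∈ Icc (0:ℝ) 1 := by
    obtain ⟨F, hF⟩ := hcn
    exact (hc hF).2.1 (hu F hF)
  have hv1 : v ∈ Icc (0:ℝ) 1 := by
    obtain ⟨F, hF⟩ := hcn
    exact (hc hF).2.1 (hv F hF)
  refine eq_of_forall_dist_le fun r hr => ?_
  obtain ⟨η₁, hη₁, H1⟩ := Metric.continuousWithinAt_iff.1 (hf u hu1) (r / 2) (half_pos hr)
  obtain ⟨η₂, hη₂, H2⟩ := Metric.continuousWithinAt_iff.1 (hf v hv1) (r / 2) (half_pos hr)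
  obtain ⟨a, hua, ha⟩ : ∃ a, u < a ∧ a < min (u + η₁) ((u + v) / 2) :=
    exists_between (lt_min (by linarith) (by linarith))
  obtain ⟨b, hb, hbv⟩ : ∃ b, max (v - η₂) ((u + v) / 2) < b ∧ b < v :=
    exists_between (max_lt (by linarith) (by linarith))
  rw [lt_min_iff] at ha
  rw [max_lt_iff] at hb
  have hab : a < b := ha.2.trans hb.2
  obtain ⟨F, hF, hFe⟩ : ∃ F ∈ c, Icc a b ∩ F = ∅ := by
    by_contra! h
    have hne : (⋂ F : c, Icc a b ∩ (F : Set ℝ)).Nonempty := by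
      have := hcn.to_subtype
      refine IsCompact.nonempty_iInter_of_directed_nonempty_isCompact_isClosed _ ?_
        (fun F => h F F.2)
        (fun F => isCompact_Icc.inter_right (hc F.2).1)
        (fun F => isClosed_Icc.inter (hc F.2).1)
      intro F F'
      rcases hch.total F.2 F'.2 with h | h
      · exact ⟨F, subset_rfl, inter_subset_inter_right _ h⟩
      · exact ⟨F', inter_subset_inter_right _ h, subset_rfl⟩
    obtain ⟨w, hw⟩ := hne
    rw [mem_iInter] at hw
    have hw1 : w ∈ Icc a b := (hw ⟨_, hcn.some_mem⟩).1
    have hw2 : w ∈ ⋂₀ c := fun F hF => (hw ⟨F, hF⟩).2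
    exact absurd (show w ∈ Ioo u v ∩ ⋂₀ c from
      ⟨⟨hua.trans_le hw1.1, hw1.2.trans_lt hbv⟩, hw2⟩) (by simp [hgap])
  obtain ⟨hFc, hFs, hF0, hF1, hFg⟩ := hc hF
  obtain ⟨p, ⟨hpF, hpa⟩, hpm⟩ := exists_isGreatest_inter_Iic hFc hFs hF0 (hu1.1.trans hua.le)
  obtain ⟨q, ⟨hqF, hqb⟩, hqm⟩ := exists_isLeast_inter_Ici hFc hFs hF1 (hbv.le.trans hv1.2)
  have hup : u ≤ p := hpm ⟨hu F hF, hua.le⟩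
  have hqv : q ≤ v := hqm ⟨hv F hF, hbv.le⟩
  rw [mem_Iic] at hpa
  rw [mem_Ici] at hqb
  have hpq : f p = f q := by
    refine hFg p hpF q hqF (by linarith) ?_
    rw [eq_empty_iff_forall_notMem]
    rintro w ⟨hw, hwF⟩
    have h1 : a < w := by
      by_contra! h
      exact absurd (hpm ⟨hwF, h⟩) (not_le.2 hw.1)
    have h2 : w < b := by
      by_contra! h
      exact absurd (hqm ⟨hwF, h⟩) (not_le.2 hw.2)
    exact absurd (show w ∈ Icc a b ∩ F from ⟨⟨h1.le, h2.le⟩, hwF⟩) (by simp [hFe])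
  have d1 : dist (f p) (f u) < r / 2 :=
    H1 (hFs hpF) (by rw [Real.dist_eq, abs_lt]; constructor <;> linarith)
  have d2 : dist (f q) (f v) < r / 2 :=
    H2 (hFs hqF) (by rw [Real.dist_eq, abs_lt]; constructor <;> linarith)
  rw [dist_comm] at d1
  rw [← hpq] at d2
  linarith [dist_triangle (f u) (f p) (f v)]

/-- Every path can be replaced by one inside its image with the same ends and connected fibers. -/
theorem exists_ordConnected_fibers {E : Type*} [MetricSpace E] {f : ℝ → E}
    (hf : ContinuousOn f (Icc 0 1)) : ∃ g : ℝ → E, ContinuousOn g (Icc 0 1) ∧ g 0 = f 0 ∧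
      g 1 = f 1 ∧ (∀ t ∈ Icc (0:ℝ) 1, g t ∈ f '' Icc 0 1) ∧
      ∀ s u t, 0 ≤ s → s ≤ u → u ≤ t → t ≤ 1 → g s = g t → g u = g s := by
  obtain ⟨F, hF⟩ := exists_minimal_gapEqSets hf
  obtain ⟨hFc, hFs, hF0, hF1, hFg⟩ := hF.prop
  have key : ∀ u ∈ F, ∀ v ∈ F, u < v → f u = f v → ∀ w ∈ F, w ∉ Ioo u v := by
    intro u hu v hv huv he w hw hwuv
    have hmem : F \ Ioo u v ∈ gapEqSets f := by
      refine ⟨hFc.sdiff isOpen_Ioo, sdiff_subset.trans hFs,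
        ⟨hF0, fun h => absurd (hFs hu).1 (not_le.2 h.1)⟩,
        ⟨hF1, fun h => absurd (hFs hv).2 (not_le.2 h.2)⟩, fun p hp q hq hpq hg => ?_⟩
      by_cases hpq' : Ioo p q ∩ F = ∅
      · exact hFg p hp.1 q hq.1 hpq hpq'
      obtain ⟨x, hx, hxF⟩ := nonempty_iff_ne_empty.2 hpq'
      have hxuv : x ∈ Ioo u v := by
        by_contra h
        exact absurd (show x ∈ Ioo p q ∩ (F \ Ioo u v) from ⟨hx, hxF, h⟩) (by simp [hg])
      have hpu : p ≤ u := by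
        by_contra! h
        exact hp.2 ⟨h, hx.1.trans hxuv.2⟩
      have hqv : v ≤ q := by
        by_contra! h
        exact hq.2 ⟨hxuv.1.trans hx.2, h⟩
      have hpu' : p = u := by
        refine hpu.eq_or_lt.resolve_right fun h => ?_
        exact absurd (show u ∈ Ioo p q ∩ (F \ Ioo u v) from
          ⟨⟨h, huv.trans_le hqv⟩, hu, by simp⟩) (by simp [hg])
      have hqv' : v = q := by
        refine hqv.eq_or_lt.resolve_right fun h => ?_
        exact absurd (show v ∈ Ioo p q ∩ (F \ Ioo u v) from
          ⟨⟨hpu.trans_lt huv, h⟩, hv, by simp⟩) (by simp [hg])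
      rw [hpu', ← hqv', he]
    exact (hF.le_of_le hmem sdiff_subset hw).2 hwuv
  have hl : ∀ t : ℝ, ∃ p, 0 ≤ t → IsGreatest (F ∩ Iic t) p := fun t => by
    by_cases h : 0 ≤ t
    · obtain ⟨p, hp⟩ := exists_isGreatest_inter_Iic hFc hFs hF0 h
      exact ⟨p, fun _ => hp⟩
    · exact ⟨0, fun h' => absurd h' h⟩
  choose l hl using hl
  have hll : ∀ t, 0 ≤ t → l t ≤ t := fun t ht => (hl t ht).1.2
  have hlF : ∀ t, 0 ≤ t → l t ∈ F := fun t ht => (hl t ht).1.1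
  have hlm : ∀ s t, 0 ≤ s → s ≤ t → l s ≤ l t := fun s t hs hst =>
    (hl t (hs.trans hst)).2 ⟨hlF s hs, (hll s hs).trans hst⟩
  have hlid : ∀ t ∈ F, l t = t := fun t ht =>
    le_antisymm (hll t (hFs ht).1) ((hl t (hFs ht).1).2 ⟨ht, mem_Iic.2 le_rfl⟩)
  refine ⟨fun t => f (l t), ?_, by simp [hlid 0 hF0], by simp [hlid 1 hF1],
    fun t ht => ⟨_, hFs (hlF t ht.1), rfl⟩, fun s u t hs hsu hut ht h => ?_⟩
  · have hfu := isCompact_Icc.uniformContinuousOn_of_continuous hf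
    refine UniformContinuousOn.continuousOn ?_
    rw [Metric.uniformContinuousOn_iff] at hfu ⊢
    intro ε hε
    obtain ⟨δ, hδ, H⟩ := hfu ε hε
    have main : ∀ s ∈ Icc (0:ℝ) 1, ∀ t ∈ Icc (0:ℝ) 1, s ≤ t → dist s t < δ →
        dist (f (l s)) (f (l t)) < ε := by
      intro s hs t ht hst hd
      obtain ⟨r, ⟨hrF, hrs⟩, hrm⟩ := exists_isLeast_inter_Ici hFc hFs hF1 hs.2
      rw [mem_Ici] at hrs
      by_cases hrt : r ≤ t
      · have hrl : r ≤ l t := (hl t ht.1).2 ⟨hrF, hrt⟩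
        have hlt := hll t ht.1
        have : f (l s) = f r := by
          rcases ((hll s hs.1).trans hrs).eq_or_lt with h | h
          · rw [h]
          · refine hFg _ (hlF s hs.1) _ hrF h ?_
            rw [eq_empty_iff_forall_notMem]
            rintro w ⟨hw, hwF⟩
            rcases le_total w s with hws | hws
            · exact absurd ((hl s hs.1).2 ⟨hwF, hws⟩) (not_le.2 hw.1)
            · exact absurd (hrm ⟨hwF, hws⟩) (not_le.2 hw.2)
        rw [this]
        refine H _ (hFs hrF) _ (hFs (hlF t ht.1)) ?_
        rw [Real.dist_eq, abs_lt] at hd ⊢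
        constructor <;> linarith
      · have : l t ≤ l s := by
          refine (hl s hs.1).2 ⟨hlF t ht.1, ?_⟩
          rw [mem_Iic]
          by_contra! h
          exact hrt ((hrm ⟨hlF t ht.1, h.le⟩).trans (hll t ht.1))
        rw [le_antisymm this (hlm s t hs.1 hst)]
        simpa using hε
    refine ⟨δ, hδ, fun s hs t ht hd => ?_⟩
    rcases le_total s t with h | h
    · exact main s hs t ht h hd
    · rw [dist_comm] at hd ⊢
      exact main t ht s hs h hd
  · simp only at h ⊢
    have h1 := hlm s u hs hsu
    have h2 := hlm u t (hs.trans hsu) hut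
    rcases (h1.trans h2).eq_or_lt with e | e
    · rw [le_antisymm (h2.trans e.ge) h1]
    · have := key _ (hlF s hs) _ (hlF t (hs.trans (hsu.trans hut))) e h _ (hlF u (hs.trans hsu))
      rcases h1.eq_or_lt with e1 | e1
      · rw [e1]
      rcases h2.eq_or_lt with e2 | e2
      · rw [e2, h]
      exact absurd ⟨e1, e2⟩ this

/-- The oscillation of `g` from `q`, up to time `t`. -/
noncomputable def oscFrom {E : Type*} [MetricSpace E] (g : ℝ → E) (q t : ℝ) : ℝ :=
  sSup ((fun r => dist (g (q + r * (max t q - q))) (g q)) '' Icc (0:ℝ) 1)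

theorem continuous_oscFrom {E : Type*} [MetricSpace E] {g : ℝ → E} (hg : Continuous g) :
    Continuous fun p : ℝ × ℝ => oscFrom g p.2 p.1 := by
  refine IsCompact.continuous_sSup (f := fun (p : ℝ × ℝ) (r : ℝ) =>
    dist (g (p.2 + r * (max p.1 p.2 - p.2))) (g p.2)) isCompact_Icc ?_
  exact (hg.comp (by fun_prop)).dist (hg.comp (by fun_prop))

theorem oscFrom_le {E : Type*} [MetricSpace E] {g : ℝ → E} {q t B : ℝ}
    (h : ∀ u, q ≤ u → u ≤ max t q → dist (g u) (g q) ≤ B) : oscFrom g q t ≤ B := by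
  refine csSup_le ((nonempty_Icc.2 zero_le_one).image _) ?_
  rintro _ ⟨r, hr, rfl⟩
  have := le_max_right t q
  refine h _ ?_ ?_
  · nlinarith [hr.1]
  · nlinarith [hr.2]

theorem le_oscFrom {E : Type*} [MetricSpace E] {g : ℝ → E} (hg : Continuous g) {q u t : ℝ}
    (h1 : q ≤ u) (h2 : u ≤ max t q) : dist (g u) (g q) ≤ oscFrom g q t := by
  have hb : BddAbove ((fun r => dist (g (q + r * (max t q - q))) (g q)) '' Icc (0:ℝ) 1) := by
    refine (isCompact_Icc.image ?_).bddAbove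
    exact (hg.comp (by fun_prop)).dist continuous_const
  rcases (h1.trans h2).eq_or_lt with h | h
  · have : u = q := le_antisymm (h2.trans h.ge) h1
    subst this
    refine le_csSup hb ⟨0, by simp, by simp⟩
  · refine le_csSup hb ⟨(u - q) / (max t q - q), ⟨div_nonneg (by linarith) (by linarith),
      (div_le_one (by linarith)).2 (by linarith)⟩, ?_⟩
    have : q + (u - q) / (max t q - q) * (max t q - q) = u := by
      rw [div_mul_cancel₀ _ (by linarith)]
      ring
    simp only [this]

theorem oscFrom_mono {E : Type*} [MetricSpace E] {g : ℝ → E} (hg : Continuous g) {q s t : ℝ}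
    (h : s ≤ t) : oscFrom g q s ≤ oscFrom g q t :=
  oscFrom_le fun _ h1 h2 => le_oscFrom hg h1 (h2.trans (max_le_max_right _ h))

theorem exists_arc_of_ordConnected_fibers {E : Type*} [MetricSpace E] {g : ℝ → E}
    (hg : ContinuousOn g (Icc 0 1)) (h01 : g 0 ≠ g 1)
    (hf : ∀ s u t, 0 ≤ s → s ≤ u → u ≤ t → t ≤ 1 → g s = g t → g u = g s) :
    ∃ c : ℝ → E, ContinuousOn c (Icc 0 1) ∧ InjOn c (Icc 0 1) ∧ c 0 = g 0 ∧ c 1 = g 1 ∧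
      c '' Icc 0 1 ⊆ g '' Icc 0 1 := by
  set G : ℝ → E := IccExtend zero_le_one (fun t : Icc (0:ℝ) 1 => g t) with hG
  have hGc : Continuous G := (continuousOn_iff_continuous_domRestrict.1 hg).Icc_extend'
  have hGe : ∀ t ∈ Icc (0:ℝ) 1, G t = g t := fun t ht => IccExtend_of_mem _ _ ht
  set φ : ℝ → ℝ := fun t => ∫ q in (0:ℝ)..1, oscFrom G q t with hφ
  have hφc : Continuous φ :=
    intervalIntegral.continuous_parametric_intervalIntegral_of_continuous'
      (f := fun t q => oscFrom G q t) (continuous_oscFrom hGc) 0 1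
  have hosc : ∀ t, Continuous fun q => oscFrom G q t := fun t =>
    (continuous_oscFrom hGc).comp (f := fun q : ℝ => (t, q)) (by fun_prop)
  have hmono : Monotone φ := fun s t hst =>
    intervalIntegral.integral_mono zero_le_one ((hosc s).intervalIntegrable _ _)
      ((hosc t).intervalIntegrable _ _) fun q => oscFrom_mono hGc hst
  have hlt : ∀ s ∈ Icc (0:ℝ) 1, ∀ t ∈ Icc (0:ℝ) 1, s < t → g s ≠ g t → φ s < φ t := by
    intro s hs t ht hst hne
    refine intervalIntegral.integral_lt_integral_of_continuousOn_of_le_of_exists_lt zero_lt_one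
      (hosc s).continuousOn (hosc t).continuousOn (fun q _ => oscFrom_mono hGc hst.le)
      ⟨s, hs, ?_⟩
    have h1 : oscFrom G s s ≤ 0 := oscFrom_le fun u h1 h2 => by
      rw [max_self] at h2
      rw [le_antisymm h2 h1, dist_self]
    refine h1.trans_lt ((dist_pos.2 ?_).trans_le
      (le_oscFrom hGc hst.le (le_max_left t s)))
    rw [hGe s hs, hGe t ht]
    exact hne.symm
  have heq : ∀ s ∈ Icc (0:ℝ) 1, ∀ t ∈ Icc (0:ℝ) 1, s < t → g s = g t → φ s = φ t := by
    intro s hs t ht hst he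
    refine intervalIntegral.integral_congr fun q hq => ?_
    rw [uIcc_of_le zero_le_one] at hq
    have hgu : ∀ u, s ≤ u → u ≤ t → G u = G s := fun u h1 h2 => by
      rw [hGe u ⟨hs.1.trans h1, h2.trans ht.2⟩, hGe s hs]
      exact hf s u t hs.1 h1 h2 ht.2 he
    refine le_antisymm (oscFrom_mono hGc hst.le) (oscFrom_le fun u h1 h2 => ?_)
    rcases le_total u (max s q) with h | h
    · exact le_oscFrom hGc h1 h
    · have hsu : s ≤ u := (le_max_left _ _).trans h
      by_cases hut : u ≤ t
      · rw [hgu u hsu hut]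
        by_cases hqs : q ≤ s
        · exact le_oscFrom hGc hqs (le_max_left _ _)
        · rw [← hgu q (not_le.1 hqs).le (h1.trans hut)]
          exact le_oscFrom hGc le_rfl (le_max_right _ _)
      · have : u = q := by
          rcases le_max_iff.1 h2 with h | h
          · exact absurd h hut
          · exact le_antisymm h h1
        rw [this]
        exact le_oscFrom hGc le_rfl (le_max_right _ _)
  have h01' := hlt 0 (by simp) 1 (by simp) zero_lt_one h01
  set d := φ 1 - φ 0 with hd
  have hdpos : 0 < d := sub_pos.2 h01'
  set ψ : Icc (0:ℝ) 1 → Icc (0:ℝ) 1 := fun t => ⟨(φ t - φ 0) / d,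
    div_nonneg (sub_nonneg.2 (hmono t.2.1)) hdpos.le,
    (div_le_one hdpos).2 (sub_le_sub_right (hmono t.2.2) _)⟩ with hψ
  have hψc : Continuous ψ := by
    refine Continuous.subtype_mk ?_ _
    exact ((hφc.comp continuous_subtype_val).sub continuous_const).div_const _
  have hψs : Function.Surjective ψ := by
    intro y
    obtain ⟨t, ht, hty⟩ := intermediate_value_Icc zero_le_one hφc.continuousOn
      (show φ 0 + y * d ∈ Icc (φ 0) (φ 1) by
        constructor
        · nlinarith [y.2.1]
        · nlinarith [y.2.2])
    refine ⟨⟨t, ht⟩, Subtype.ext ?_⟩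
    simp only [hψ, hty]
    field_simp
    ring
  have hψe : ∀ s t, ψ s = ψ t ↔ g s = g t := by
    intro s t
    have h1 : ψ s = ψ t ↔ φ s = φ t := by
      rw [Subtype.ext_iff]
      simp only [hψ]
      rw [div_left_inj' hdpos.ne', sub_left_inj]
    rw [h1]
    rcases lt_trichotomy s t with h | h | h
    · exact ⟨fun e => by_contra fun hne => (hlt s s.2 t t.2 h hne).ne e, heq s s.2 t t.2 h⟩
    · simp [h]
    · exact ⟨fun e => by_contra fun hne => (hlt t t.2 s s.2 h (Ne.symm hne)).ne e.symm,
        fun e => (heq t t.2 s s.2 h e.symm).symm⟩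
  have hq := IsQuotientMap.of_surjective_continuous hψs hψc
  set c₀ : Icc (0:ℝ) 1 → E := fun y => g ((Function.surjInv hψs y : Icc (0:ℝ) 1) : ℝ) with hc₀
  have hcψ : ∀ t, c₀ (ψ t) = g t := fun t => (hψe _ _).1 (Function.surjInv_eq hψs _)
  have hc₀c : Continuous c₀ := by
    rw [hq.continuous_iff]
    have : c₀ ∘ ψ = fun t : Icc (0:ℝ) 1 => g t := funext hcψ
    rw [this]
    exact continuousOn_iff_continuous_domRestrict.1 hg
  have hc₀i : Function.Injective c₀ := by
    intro y y' h
    have := (hψe _ _).2 h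
    exact (Function.surjInv_eq hψs y).symm.trans (this.trans (Function.surjInv_eq hψs y'))
  have e0 : ψ ⟨0, by simp⟩ = ⟨0, by simp⟩ := by simp [hψ]
  have e1 : ψ ⟨1, by simp⟩ = ⟨1, by simp⟩ := by
    refine Subtype.ext ?_
    simp only [hψ]
    exact div_self hdpos.ne'
  refine ⟨IccExtend zero_le_one c₀, hc₀c.Icc_extend'.continuousOn, ?_, ?_, ?_, ?_⟩
  · intro s hs t ht h
    rw [IccExtend_of_mem _ _ hs, IccExtend_of_mem _ _ ht] at h
    exact congrArg Subtype.val (hc₀i h)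
  · rw [IccExtend_of_mem _ _ (by simp), ← e0, hcψ]
  · rw [IccExtend_of_mem _ _ (by simp), ← e1, hcψ]
  · rintro _ ⟨t, ht, rfl⟩
    rw [IccExtend_of_mem _ _ ht]
    exact ⟨_, Subtype.coe_prop _, rfl⟩

/-- A path between distinct points contains an arc between them. -/
theorem exists_arc_of_path {E : Type*} [MetricSpace E] {f : ℝ → E}
    (hf : ContinuousOn f (Icc 0 1)) (h01 : f 0 ≠ f 1) :
    ∃ c : ℝ → E, ContinuousOn c (Icc 0 1) ∧ InjOn c (Icc 0 1) ∧ c 0 = f 0 ∧ c 1 = f 1 ∧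
      c '' Icc 0 1 ⊆ f '' Icc 0 1 := by
  obtain ⟨g, hg, h0, h1, hm, hfib⟩ := exists_ordConnected_fibers hf
  obtain ⟨c, hc, hi, hc0, hc1, hs⟩ :=
    exists_arc_of_ordConnected_fibers hg (by rwa [h0, h1]) hfib
  refine ⟨c, hc, hi, hc0.trans h0, hc1.trans h1, hs.trans ?_⟩
  rintro _ ⟨t, ht, rfl⟩
  exact hm t ht

theorem exists_arc_of_joinedIn {E : Type*} [MetricSpace E] {K : Set E} {p q : E}
    (h : JoinedIn K p q) (hpq : p ≠ q) :
    ∃ c : ℝ → E, ContinuousOn c (Icc 0 1) ∧ InjOn c (Icc 0 1) ∧ c 0 = p ∧ c 1 = q ∧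
      ∀ t ∈ Icc (0:ℝ) 1, c t ∈ K := by
  obtain ⟨f, hf⟩ := h
  obtain ⟨c, hc, hi, h0, h1, hs⟩ := exists_arc_of_path (f := f.extend)
    f.continuous_extend.continuousOn (by simpa using hpq)
  refine ⟨c, hc, hi, by simpa using h0, by simpa using h1, fun t ht => ?_⟩
  obtain ⟨u, hu, hut⟩ := hs ⟨t, ht, rfl⟩
  rw [← hut, f.extend_apply hu]
  exact hf _

theorem joinedIn_vertical {K : Set (ℝ × ℝ)} {x y₁ y₂ : ℝ}
    (h : ∀ y ∈ uIcc y₁ y₂, (x, y) ∈ K) : JoinedIn K (x, y₁) (x, y₂) := by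
  have hp : IsPathConnected (uIcc y₁ y₂) := (convex_uIcc y₁ y₂).isPathConnected ⟨_, left_mem_uIcc⟩
  refine ((hp.image (f := fun y => (x, y)) (by fun_prop)).joinedIn _
    ⟨_, left_mem_uIcc, rfl⟩ _ ⟨_, right_mem_uIcc, rfl⟩).mono ?_
  rintro _ ⟨y, hy, rfl⟩
  exact h y hy

theorem joinedIn_horizontal {K : Set (ℝ × ℝ)} {x₁ x₂ y : ℝ}
    (h : ∀ x ∈ uIcc x₁ x₂, (x, y) ∈ K) : JoinedIn K (x₁, y) (x₂, y) := by
  have hp : IsPathConnected (uIcc x₁ x₂) := (convex_uIcc x₁ x₂).isPathConnected ⟨_, left_mem_uIcc⟩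
  refine ((hp.image (f := fun x => (x, y)) (by fun_prop)).joinedIn _
    ⟨_, left_mem_uIcc, rfl⟩ _ ⟨_, right_mem_uIcc, rfl⟩).mono ?_
  rintro _ ⟨y, hy, rfl⟩
  exact h y hy

theorem exists_eq_zero_of_continuous {E : Type*} [TopologicalSpace E] {c : ℝ → E}
    (hc : ContinuousOn c (Icc 0 1)) {h : E → ℝ} (hh : Continuous h)
    (h01 : h (c 0) ≤ 0 ∧ 0 ≤ h (c 1) ∨ 0 ≤ h (c 0) ∧ h (c 1) ≤ 0) :
    ∃ t ∈ Icc (0:ℝ) 1, h (c t) = 0 := by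
  have hcont := hh.comp_continuousOn hc
  rcases h01 with h | h
  · exact intermediate_value_Icc zero_le_one hcont h
  · exact intermediate_value_Icc' zero_le_one hcont ⟨h.2, h.1⟩

/-- A string hanging from `(b, 0)` and ending at `(b' + δ, -e)` which near both ends follows the
vertical line `x = b` and the horizontal line `y = -e`. -/
structure IsLinkString (b b' δ e' e ε : ℝ) (g : ℝ → ℝ × ℝ) : Prop where
  cont : ContinuousOn g (Icc 0 1)
  inj : InjOn g (Icc 0 1)
  zero : g 0 = (b, 0)
  one : g 1 = (b' + δ, -e)
  below : ∀ t ∈ Ioc (0:ℝ) 1, (g t).2 < 0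
  cases : ∀ t ∈ Icc (0:ℝ) 1, ((g t).1 = b ∧ -e ≤ (g t).2 ∧ (g t).2 ≤ 0) ∨
    ((g t).2 = -e ∧ b ≤ (g t).1 ∧ (g t).1 ≤ b' + δ) ∨
    (b + δ < (g t).1 ∧ (g t).1 < b' ∧ -ε < (g t).2 ∧ (g t).2 < 0)
  mem_left : (b, -e') ∈ g '' Icc 0 1
  mem_right : (b', -e) ∈ g '' Icc 0 1

theorem exists_isLinkString_of_joinedIn {b b' δ e' e ε : ℝ} (hδ : 0 < δ) (hb : b < b')
    (he' : 0 < e') (he : e' < e) {K : Set (ℝ × ℝ)} (hJ : JoinedIn K (b, 0) (b' + δ, -e))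
    (hK : ∀ p ∈ K, (p.1 = b ∧ -e ≤ p.2 ∧ p.2 ≤ 0) ∨ (p.2 = -e ∧ b ≤ p.1 ∧ p.1 ≤ b' + δ) ∨
      (b + δ < p.1 ∧ p.1 < b' ∧ -ε < p.2 ∧ p.2 < 0)) :
    ∃ g, IsLinkString b b' δ e' e ε g ∧ ∀ t ∈ Icc (0:ℝ) 1, g t ∈ K := by
  obtain ⟨g, hc, hi, h0, h1, hg⟩ := exists_arc_of_joinedIn hJ (by
    intro h
    have := congrArg Prod.fst h
    simp only at this
    linarith)
  refine ⟨g, ⟨hc, hi, h0, h1, ?_, fun t ht => hK _ (hg t ht), ?_, ?_⟩, hg⟩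
  · intro t ht
    have ht' : t ∈ Icc (0:ℝ) 1 := Ioc_subset_Icc_self ht
    rcases hK _ (hg t ht') with h | h | h
    · refine h.2.2.lt_of_ne fun h2 => ht.1.ne' (hi ht' (by simp) ?_)
      rw [h0]
      exact Prod.ext h.1 h2
    · linarith [h.1]
    · exact h.2.2.2
  · have hk : 0 < e' / δ := by positivity
    obtain ⟨t, ht, h⟩ := exists_eq_zero_of_continuous hc
      (h := fun p : ℝ × ℝ => p.2 + e' - e' / δ * (p.1 - b)) (by fun_prop) (Or.inr (by
        rw [h0, h1]
        simp only
        constructor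
        · nlinarith
        · nlinarith))
    refine ⟨t, ht, ?_⟩
    rcases hK _ (hg t ht) with h' | h' | h'
    · rw [h'.1] at h
      exact Prod.ext h'.1 (by simp only; linarith)
    · nlinarith
    · have : e' / δ * δ = e' := by field_simp
      nlinarith
  · obtain ⟨t, ht, h⟩ := exists_eq_zero_of_continuous hc
      (h := fun p : ℝ × ℝ => p.1 - b') (by fun_prop) (Or.inl (by
        rw [h0, h1]
        simp only
        constructor <;> linarith))
    refine ⟨t, ht, ?_⟩
    rcases hK _ (hg t ht) with h' | h' | h'
    · linarith
    · exact Prod.ext (by simp only; linarith) h'.1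
    · linarith

theorem exists_isLinkString {b b' δ e' e ε : ℝ} (hδ : 0 < δ) (hb : b < b')
    (he' : 0 < e') (he : e' < e) : ∃ g, IsLinkString b b' δ e' e ε g := by
  have hJ : JoinedIn {p : ℝ × ℝ | (p.1 = b ∧ -e ≤ p.2 ∧ p.2 ≤ 0) ∨
      (p.2 = -e ∧ b ≤ p.1 ∧ p.1 ≤ b' + δ)} (b, 0) (b' + δ, -e) := by
    refine (joinedIn_vertical (y₂ := -e) fun y hy => ?_).trans (joinedIn_horizontal fun x hx => ?_)
    · rw [uIcc_of_ge (by linarith)] at hy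
      exact Or.inl ⟨rfl, hy⟩
    · rw [uIcc_of_le (by linarith)] at hx
      exact Or.inr ⟨rfl, hx⟩
  obtain ⟨g, hg, -⟩ := exists_isLinkString_of_joinedIn (ε := ε) hδ hb he' he hJ
    fun p hp => hp.imp_right Or.inl
  exact ⟨g, hg⟩

/-- The string closing the cycle: it runs down, below everything else to the far left, and comes
back near the grounding line. -/
structure IsClosingString (b B W M δ e e' : ℝ) (g : ℝ → ℝ × ℝ) : Prop where
  cont : ContinuousOn g (Icc 0 1)
  inj : InjOn g (Icc 0 1)
  zero : g 0 = (B, 0)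
  one : g 1 = (b + δ, -e)
  below : ∀ t ∈ Ioc (0:ℝ) 1, (g t).2 < 0
  cases : ∀ t ∈ Icc (0:ℝ) 1, ((g t).1 = B ∧ -M ≤ (g t).2 ∧ (g t).2 ≤ 0) ∨
    ((g t).2 = -M ∧ W ≤ (g t).1 ∧ (g t).1 ≤ B) ∨ ((g t).1 = W ∧ -M ≤ (g t).2 ∧ (g t).2 ≤ -e) ∨
    ((g t).2 = -e ∧ W ≤ (g t).1 ∧ (g t).1 ≤ b + δ)
  mem_left : (b, -e) ∈ g '' Icc 0 1
  mem_right : (B, -e') ∈ g '' Icc 0 1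

theorem exists_isClosingString {b B W M δ e e' : ℝ} (hW : W < b) (hB : b + 2 * δ < B)
    (hδ : 0 < δ) (he : 0 < e) (hee' : e < e') (hM : e' < M) :
    ∃ g, IsClosingString b B W M δ e e' g := by
  set K : Set (ℝ × ℝ) := {p | (p.1 = B ∧ -M ≤ p.2 ∧ p.2 ≤ 0) ∨ (p.2 = -M ∧ W ≤ p.1 ∧ p.1 ≤ B) ∨
    (p.1 = W ∧ -M ≤ p.2 ∧ p.2 ≤ -e) ∨ (p.2 = -e ∧ W ≤ p.1 ∧ p.1 ≤ b + δ)} with hK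
  have hJ : JoinedIn K (B, 0) (b + δ, -e) := by
    refine (((joinedIn_vertical (y₂ := -M) fun y hy => ?_).trans
      (joinedIn_horizontal (x₂ := W) fun x hx => ?_)).trans
      (joinedIn_vertical (y₂ := -e) fun y hy => ?_)).trans (joinedIn_horizontal fun x hx => ?_)
    · rw [uIcc_of_ge (by linarith)] at hy
      exact Or.inl ⟨rfl, hy⟩
    · rw [uIcc_of_ge (by linarith)] at hx
      exact Or.inr (Or.inl ⟨rfl, hx⟩)
    · rw [uIcc_of_le (by linarith)] at hy
      exact Or.inr (Or.inr (Or.inl ⟨rfl, hy⟩))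
    · rw [uIcc_of_le (by linarith)] at hx
      exact Or.inr (Or.inr (Or.inr ⟨rfl, hx⟩))
  obtain ⟨g, hc, hi, h0, h1, hg⟩ := exists_arc_of_joinedIn hJ (by
    intro h
    have := congrArg Prod.fst h
    simp only at this
    linarith)
  refine ⟨g, hc, hi, h0, h1, ?_, hg, ?_, ?_⟩
  · intro t ht
    have ht' : t ∈ Icc (0:ℝ) 1 := Ioc_subset_Icc_self ht
    rcases hg t ht' with h | h | h | h
    · refine h.2.2.lt_of_ne fun h2 => ht.1.ne' (hi ht' (by simp) ?_)
      rw [h0]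
      exact Prod.ext h.1 h2
    · linarith [h.1]
    · linarith [h.2.2]
    · linarith [h.1]
  · obtain ⟨t, ht, h⟩ := exists_eq_zero_of_continuous hc
      (h := fun p : ℝ × ℝ => min (p.1 - b) (min (b + 2 * δ - p.1) (p.2 + e'))) (by fun_prop)
      (Or.inl (by
        rw [h0, h1]
        simp only
        constructor
        · exact min_le_of_right_le (min_le_of_left_le (by linarith))
        · exact le_min (by linarith) (le_min (by linarith) (by linarith))))
    refine ⟨t, ht, ?_⟩
    have hx := min_le_left ((g t).1 - b) (min (b + 2 * δ - (g t).1) ((g t).2 + e'))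
    have hx' := (min_le_right ((g t).1 - b) _).trans
      (min_le_left (b + 2 * δ - (g t).1) ((g t).2 + e'))
    have hx'' := (min_le_right ((g t).1 - b) _).trans
      (min_le_right (b + 2 * δ - (g t).1) ((g t).2 + e'))
    rw [h] at hx hx' hx''
    rcases hg t ht with h' | h' | h' | h'
    · linarith
    · linarith
    · linarith
    · refine Prod.ext ?_ h'.1
      simp only
      by_contra hne
      have h3 : 0 < (g t).1 - b := hx.lt_of_ne fun h => hne (by linarith)
      have : 0 < min ((g t).1 - b) (min (b + 2 * δ - (g t).1) ((g t).2 + e')) :=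
        lt_min h3 (lt_min (by linarith) (by linarith))
      exact this.ne' h
  · set k := e' / (B - b - δ) with hk
    have hkpos : 0 < k := div_pos (by linarith) (by linarith)
    have hke : k * (B - b - δ) = e' := div_mul_cancel₀ _ (by linarith)
    obtain ⟨t, ht, h⟩ := exists_eq_zero_of_continuous hc
      (h := fun p : ℝ × ℝ => p.2 + e' - k * (B - p.1)) (by fun_prop) (Or.inr (by
        rw [h0, h1]
        simp only
        constructor
        · nlinarith
        · nlinarith))
    refine ⟨t, ht, ?_⟩
    rcases hg t ht with h' | h' | h' | h'
    · rw [h'.1] at h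
      exact Prod.ext h'.1 (by simp only; linarith)
    · nlinarith
    · nlinarith
    · nlinarith

/-- The identification of `ℝ × ℝ` with the complex plane. -/
def toComplex (p : ℝ × ℝ) : ℂ := ⟨p.1, p.2⟩

theorem continuous_toComplex : Continuous toComplex :=
  Complex.equivRealProdCLM.symm.continuous

theorem toComplex_injective : Function.Injective toComplex := fun _ _ h =>
  Prod.ext (congrArg Complex.re h) (congrArg Complex.im h)

theorem joinedIn_through_point_prod {γ : ℝ → ℝ × ℝ} (hγ : ContinuousOn γ (Icc 0 1))
    (hi : InjOn γ (Icc 0 1)) {X : Set (ℝ × ℝ)} (hX : IsOpen X) {b : ℝ} (hb : b ∈ Ioc (0:ℝ) 1)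
    (hbX : ∀ u ∈ Ioo 0 b, γ u ∈ X) {L R : ℝ × ℝ} (hL : L ∉ γ '' Icc 0 1) (hR : R ∉ γ '' Icc 0 1)
    (hJ : JoinedIn (X \ (γ '' Icc 0 0 ∪ γ '' Icc b 1)) L R) {m : ℝ} (hm : m ∈ Ioo 0 b) :
    JoinedIn (X \ γ '' Icc 0 1 ∪ {γ m}) L R := by
  have hfc : Continuous fun z : ℂ => (z.re, z.im) := by fun_prop
  have him : ∀ S, (toComplex ∘ γ) '' S = toComplex '' (γ '' S) := fun S => image_comp _ _ _
  have hmem : ∀ p (S : Set (ℝ × ℝ)), toComplex p ∈ toComplex '' S ↔ p ∈ S := fun p S =>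
    toComplex_injective.mem_set_image
  have := joinedIn_through_point (γ := toComplex ∘ γ) (X := (fun z : ℂ => (z.re, z.im)) ⁻¹' X)
    (L := toComplex L) (R := toComplex R) (b := b) (m := m)
    (continuous_toComplex.comp_continuousOn hγ)
    (toComplex_injective.comp_injOn hi) (hX.preimage hfc) hb hbX
    (by rwa [him, hmem]) (by rwa [him, hmem]) ?_ hm
  · refine (this.map hfc).mono ?_
    rintro _ ⟨z, hz, rfl⟩
    rcases hz with hz | hz
    · refine Or.inl ⟨hz.1, fun h => hz.2 ?_⟩
      rw [him]
      exact ⟨_, h, rfl⟩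
    · rw [mem_singleton_iff.1 hz]
      exact Or.inr rfl
  · refine (hJ.map continuous_toComplex).mono ?_
    rintro _ ⟨p, hp, rfl⟩
    refine ⟨hp.1, fun h => hp.2 ?_⟩
    rwa [him, him, ← image_union, hmem] at h

theorem exists_crossing_prod {γ g : ℝ → ℝ × ℝ} {a b c e δ ε : ℝ}
    (hγ : ContinuousOn γ (Icc 0 1)) (hg : ContinuousOn g (Icc 0 1)) (he : 0 < e) (heε : e ≤ ε)
    (hγ0 : γ 0 = (a, 0)) (hbelow : ∀ t ∈ Ioc (0:ℝ) 1, (γ t).2 < 0)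
    (hstrip : ∀ t ∈ Icc (0:ℝ) 1, -ε ≤ (γ t).2 → |(γ t).1 - a| < δ) (hend : (γ 1).2 < -ε)
    (hg0 : g 0 = (b, 0)) (hg1 : g 1 = (c, -e)) (hgb : ∀ t ∈ Ioc (0:ℝ) 1, (g t).2 < 0)
    (hgε : ∀ t ∈ Icc (0:ℝ) 1, -ε ≤ (g t).2) (hba : b < a) (hac : a + δ ≤ c) :
    (γ '' Icc 0 1 ∩ g '' Icc 0 1).Nonempty := by
  obtain ⟨s, hs, t, ht, h⟩ := exists_crossing (γ := toComplex ∘ γ) (C := toComplex ∘ g)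
    (continuous_toComplex.comp_continuousOn hγ) (continuous_toComplex.comp_continuousOn hg)
    (fun t ht => by
      simp only [Complex.mem_slitPlane_iff, Function.comp, toComplex, Complex.sub_re,
        Complex.sub_im, hγ0]
      rcases ht.1.eq_or_lt with h | h
      · rw [← h, hg0]
        simp only
        exact ⟨Or.inl (by linarith), by linarith⟩
      · have := hgb t ⟨h, ht.2⟩
        exact ⟨Or.inr (by linarith), by linarith⟩)
    (fun t ht => by
      simp only [Function.comp, toComplex, Complex.sub_im]
      linarith [hgε t ht])
    (fun s hs => by
      simp only [Complex.mem_slitPlane_iff, Function.comp, toComplex, Complex.sub_re,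
        Complex.sub_im, hg0]
      rcases hs.1.eq_or_lt with h | h
      · rw [← h, hγ0]
        exact Or.inl (by simp only; linarith)
      · have := hbelow s ⟨h, hs.2⟩
        exact Or.inr (by linarith))
    (fun s hs => by
      simp only [Complex.mem_slitPlane_iff, Function.comp, toComplex, Complex.sub_re,
        Complex.sub_im, hg1]
      by_cases h : (γ s).2 = -e
      · have := (abs_lt.1 (hstrip s hs (by linarith))).2
        exact Or.inl (by linarith)
      · exact Or.inr fun h' => h (by linarith))
    (by
      simp only [Function.comp, toComplex, Complex.sub_im, hγ0, hg1]
      linarith)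
  exact ⟨γ s, ⟨s, hs, rfl⟩, t, ht, (toComplex_injective h).symm⟩

/-- A string `γ` which is confined to a narrow column near the grounding line can be crossed
exactly once by a link string running close to that line. -/
theorem exists_isLinkString_crossing {γ : ℝ → ℝ × ℝ} {a δ ε : ℝ}
    (hγ : ContinuousOn γ (Icc 0 1)) (hi : InjOn γ (Icc 0 1)) (hδ : 0 < δ) (hε : 0 < ε)
    (hγ0 : γ 0 = (a, 0)) (hbelow : ∀ t ∈ Ioc (0:ℝ) 1, (γ t).2 < 0)
    (hstrip : ∀ t ∈ Icc (0:ℝ) 1, -ε ≤ (γ t).2 → |(γ t).1 - a| < δ) (hend : (γ 1).2 < -ε) :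
    ∃ e₀ > 0, e₀ ≤ ε ∧ ∀ e' e b', 0 < e' → e' < e → e < e₀ → a + 3 * δ ≤ b' →
      ∃ g, IsLinkString (a - 3 * δ) b' δ e' e ε g ∧ ∃ p, γ '' Icc 0 1 ∩ g '' Icc 0 1 = {p} := by
  obtain ⟨b, hb, hbε⟩ : ∃ b ∈ Ioc (0:ℝ) 1, ∀ t ∈ Icc 0 b, -ε < (γ t).2 := by
    have h : ∀ᶠ t in 𝓝[Icc 0 1] (0:ℝ), -ε < (γ t).2 := by
      have := (continuous_snd.comp_continuousOn hγ) 0 (by simp)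
      refine this.eventually (lt_mem_nhds ?_)
      simp only [Function.comp, hγ0]
      linarith
    rw [eventually_nhdsWithin_iff, Metric.eventually_nhds_iff] at h
    obtain ⟨r, hr, h⟩ := h
    refine ⟨min (r / 2) 1, ⟨lt_min (by linarith) one_pos, min_le_right _ _⟩, fun t ht => ?_⟩
    have h1 := ht.2.trans (min_le_left _ _)
    have h2 := ht.2.trans (min_le_right _ _)
    refine h ?_ ⟨ht.1, h2⟩
    rw [Real.dist_eq, abs_lt]
    constructor <;> linarith [ht.1]
  obtain ⟨d, hd, hdb⟩ : ∃ d > 0, ∀ t ∈ Icc b 1, (γ t).2 ≤ -d := by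
    obtain ⟨t, ht, hmax⟩ := isCompact_Icc.exists_isMaxOn (nonempty_Icc.2 hb.2)
      ((continuous_snd.comp_continuousOn hγ).mono (Icc_subset_Icc_left hb.1.le))
    refine ⟨-(γ t).2, by linarith [hbelow t ⟨hb.1.trans_le ht.1, ht.2⟩], fun u hu => ?_⟩
    rw [neg_neg]
    exact hmax hu
  refine ⟨min d ε, lt_min hd hε, min_le_right _ _, fun e' e b' he' hee' he hb' => ?_⟩
  have hed : e < d := he.trans_le (min_le_left _ _)
  have heε : e < ε := he.trans_le (min_le_right _ _)
  set X : Set (ℝ × ℝ) := {p | a - 2 * δ < p.1 ∧ p.1 < a + 2 * δ ∧ -ε < p.2 ∧ p.2 < 0} with hX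
  have hXo : IsOpen X := by
    simp only [hX, ofPred_and]
    exact (isOpen_lt (by fun_prop) (by fun_prop)).inter
      ((isOpen_lt (by fun_prop) (by fun_prop)).inter
      ((isOpen_lt (by fun_prop) (by fun_prop)).inter (isOpen_lt (by fun_prop) (by fun_prop))))
  have hcol : ∀ p ∈ γ '' Icc 0 1, -ε ≤ p.2 → |p.1 - a| < δ := by
    rintro _ ⟨t, ht, rfl⟩ h
    exact hstrip t ht h
  have hside : ∀ x, δ ≤ |x - a| → (x, -e) ∉ γ '' Icc 0 1 := fun x hx h =>
    hx.not_gt (hcol _ h (by simp only; linarith))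
  have hL : (a - δ, -e) ∉ γ '' Icc 0 1 := hside _ (by
    rw [show a - δ - a = -δ by ring, abs_neg, abs_of_pos hδ])
  have hR : (a + δ, -e) ∉ γ '' Icc 0 1 := hside _ (by
    rw [show a + δ - a = δ by ring, abs_of_pos hδ])
  have hm : b / 2 ∈ Ioo 0 b := ⟨by linarith [hb.1], by linarith [hb.1]⟩
  have hbX : ∀ u ∈ Ioo 0 b, γ u ∈ X := fun u hu => by
    have h1 := hbε u ⟨hu.1.le, hu.2.le⟩
    have h2 := abs_lt.1 (hstrip u ⟨hu.1.le, hu.2.le.trans hb.2⟩ h1.le)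
    exact ⟨by linarith, by linarith, h1, hbelow u ⟨hu.1, hu.2.le.trans hb.2⟩⟩
  have hJ := joinedIn_through_point_prod hγ hi hXo hb hbX hL hR
    (joinedIn_horizontal fun x hx => by
      rw [uIcc_of_le (by linarith)] at hx
      refine ⟨⟨by simp only; linarith [hx.1], by simp only; linarith [hx.2],
        by simp only; linarith, by simp only; linarith⟩, ?_⟩
      rintro (⟨t, ht, h⟩ | ⟨t, ht, h⟩)
      · rw [Icc_self, mem_singleton_iff] at ht
        rw [ht, hγ0] at h
        have := congrArg Prod.snd h
        simp only at this
        linarith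
      · have := hdb t ht
        rw [h] at this
        simp only at this
        linarith) hm
  set K : Set (ℝ × ℝ) := {p | (p.1 = a - 3 * δ ∧ -e ≤ p.2 ∧ p.2 ≤ 0) ∨
    (p.2 = -e ∧ a - 3 * δ ≤ p.1 ∧ p.1 ≤ a - δ) ∨ (p ∈ X \ γ '' Icc 0 1 ∪ {γ (b / 2)}) ∨
    (p.2 = -e ∧ a + δ ≤ p.1 ∧ p.1 ≤ b' + δ)} with hK
  have hKJ : JoinedIn K (a - 3 * δ, 0) (b' + δ, -e) := by
    refine (((joinedIn_vertical (y₂ := -e) fun y hy => ?_).trans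
      (joinedIn_horizontal (x₂ := a - δ) fun x hx => ?_)).trans
      (hJ.mono fun p hp => Or.inr (Or.inr (Or.inl hp)))).trans
      (joinedIn_horizontal fun x hx => ?_)
    · rw [uIcc_of_ge (by linarith)] at hy
      exact Or.inl ⟨rfl, hy⟩
    · rw [uIcc_of_le (by linarith)] at hx
      exact Or.inr (Or.inl ⟨rfl, hx⟩)
    · rw [uIcc_of_le (by linarith)] at hx
      exact Or.inr (Or.inr (Or.inr ⟨rfl, hx⟩))
  obtain ⟨g, hg, hgK⟩ := exists_isLinkString_of_joinedIn (ε := ε) hδ (by linarith) he' hee' hKJ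
    (by
      rintro p (h | h | h | h)
      · exact Or.inl h
      · exact Or.inr (Or.inl ⟨h.1, h.2.1, by linarith [h.2.2]⟩)
      · have hpX : p ∈ X := by
          rcases h with h | h
          · exact h.1
          · rw [mem_singleton_iff.1 h]
            exact hbX _ hm
        exact Or.inr (Or.inr ⟨by linarith [hpX.1], by linarith [hpX.2.1], hpX.2.2⟩)
      · exact Or.inr (Or.inl ⟨h.1, by linarith [h.2.1], h.2.2⟩))
  have hsub : γ '' Icc 0 1 ∩ g '' Icc 0 1 ⊆ {γ (b / 2)} := by
    rintro p ⟨hp, t, ht, rfl⟩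
    rcases hgK t ht with h | h | h | h
    · have := abs_lt.1 (hcol _ hp (by linarith))
      linarith
    · have := abs_lt.1 (hcol _ hp (by linarith))
      linarith
    · rcases h with h | h
      · exact absurd hp h.2
      · exact h
    · have := abs_lt.1 (hcol _ hp (by linarith))
      linarith
  have hne : (γ '' Icc 0 1 ∩ g '' Icc 0 1).Nonempty := by
    refine exists_crossing_prod (δ := δ) hγ hg.cont (he'.trans hee') heε.le hγ0 hbelow hstrip
      hend hg.zero hg.one hg.below (fun t ht => ?_) (by linarith) (by linarith)
    rcases hg.cases t ht with h | h | h <;> linarith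
  exact ⟨g, hg, _, hne.subset_singleton_iff.1 hsub⟩

/-- Strings `y 0, …, y (5 * n - 1)` forming a cycle drawn close to the grounding line of a
representation `R`, hanging from the points `b j` at depths governed by `d`. -/
structure IsCycleOfStrings {n : ℕ} {G : SimpleGraph (Fin n)} (R : Grounded1StringRep G)
    (y : ℕ → ℝ → ℝ × ℝ) (b d : ℕ → ℝ) (δ ε M W : ℝ) : Prop where
  pos : 0 < n
  delta_pos : 0 < δ
  b_step : ∀ j < 5 * n, b j + 2 * δ ≤ b (j + 1)
  b_left : ∀ i : Fin n, b (5 * i + 4) ≤ R.a i - 3 * δ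
  b_right : ∀ i : Fin n, R.a i + 3 * δ ≤ b (5 * i + 5)
  d_mono : StrictMono d
  d_lt : ∀ j ≤ 5 * n, d j < ε
  eps_lt : ε < M
  strip : ∀ i, ∀ t ∈ Icc (0:ℝ) 1, -ε ≤ (R.gam i t).2 → |(R.gam i t).1 - R.a i| < δ
  deep : ∀ i, (R.gam i 1).2 < -ε
  bound : ∀ i, ∀ t ∈ Icc (0:ℝ) 1, |(R.gam i t).1| < M ∧ -M < (R.gam i t).2
  M_lt : M < b (5 * n)
  W_lt : W < -M
  W_lt' : W < b 1
  closing : IsClosingString (b 1) (b (5 * n)) W M δ (d 1) (d (5 * n)) (y 0)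
  link : ∀ j, 1 ≤ j → j < 5 * n → IsLinkString (b j) (b (j + 1)) δ (d j) (d (j + 1)) ε (y j)
  cross : ∀ i : Fin n, ∃ p, R.gam i '' Icc 0 1 ∩ y (5 * i + 4) '' Icc 0 1 = {p}

namespace IsCycleOfStrings

variable {n : ℕ} {G : SimpleGraph (Fin n)} {R : Grounded1StringRep G} {y : ℕ → ℝ → ℝ × ℝ}
  {b d : ℕ → ℝ} {δ ε M W : ℝ}

theorem b_add_le (h : IsCycleOfStrings R y b d δ ε M W) {j k : ℕ} (hjk : j < k)
    (hk : k ≤ 5 * n) : b j + 2 * δ ≤ b k := by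
  induction k, hjk using Nat.le_induction with
  | base => exact h.b_step j hk
  | succ k hjk ih =>
    have := ih (by omega)
    linarith [h.b_step k hk, h.delta_pos]

theorem neg_eps_lt_link (h : IsCycleOfStrings R y b d δ ε M W) {j : ℕ} (hj : 1 ≤ j)
    (hj' : j < 5 * n) {p : ℝ × ℝ} (hp : p ∈ y j '' Icc 0 1) : -ε < p.2 := by
  obtain ⟨t, ht, rfl⟩ := hp
  have := h.d_lt (j + 1) hj'
  rcases (h.link j hj hj').cases t ht with h | h | h <;> linarith

theorem le_fst_link (h : IsCycleOfStrings R y b d δ ε M W) {j : ℕ} (hj : 1 ≤ j)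
    (hj' : j < 5 * n) {p : ℝ × ℝ} (hp : p ∈ y j '' Icc 0 1) : b j ≤ p.1 := by
  obtain ⟨t, ht, rfl⟩ := hp
  have := h.delta_pos
  rcases (h.link j hj hj').cases t ht with h | h | h <;> linarith

theorem fst_link_le (h : IsCycleOfStrings R y b d δ ε M W) {j : ℕ} (hj : 1 ≤ j)
    (hj' : j < 5 * n) {p : ℝ × ℝ} (hp : p ∈ y j '' Icc 0 1) : p.1 ≤ b (j + 1) + δ := by
  obtain ⟨t, ht, rfl⟩ := hp
  have := h.delta_pos
  have := h.b_step j hj'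
  rcases (h.link j hj hj').cases t ht with h | h | h <;> linarith

theorem link_left (h : IsCycleOfStrings R y b d δ ε M W) {j : ℕ} (hj : 1 ≤ j)
    (hj' : j < 5 * n) {p : ℝ × ℝ} (hp : p ∈ y j '' Icc 0 1) (hpb : p.1 ≤ b j + δ) :
    p.1 = b j ∨ p.2 = -d (j + 1) := by
  obtain ⟨t, ht, rfl⟩ := hp
  rcases (h.link j hj hj').cases t ht with h | h | h
  · exact Or.inl h.1
  · exact Or.inr h.1
  · linarith

theorem link_right (h : IsCycleOfStrings R y b d δ ε M W) {j : ℕ} (hj : 1 ≤ j)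
    (hj' : j < 5 * n) {p : ℝ × ℝ} (hp : p ∈ y j '' Icc 0 1) (hpb : b (j + 1) ≤ p.1) :
    p.2 = -d (j + 1) := by
  obtain ⟨t, ht, rfl⟩ := hp
  have := h.delta_pos
  have := h.b_step j hj'
  rcases (h.link j hj hj').cases t ht with h | h | h
  · linarith
  · exact h.1
  · linarith

theorem closing_cases (h : IsCycleOfStrings R y b d δ ε M W) {p : ℝ × ℝ}
    (hp : p ∈ y 0 '' Icc 0 1) : p.1 = b (5 * n) ∨ p.2 = -M ∨ p.1 = W ∨
      (p.2 = -d 1 ∧ p.1 ≤ b 1 + δ) := by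
  obtain ⟨t, ht, rfl⟩ := hp
  rcases h.closing.cases t ht with h | h | h | h
  · exact Or.inl h.1
  · exact Or.inr (Or.inl h.1)
  · exact Or.inr (Or.inr (Or.inl h.1))
  · exact Or.inr (Or.inr (Or.inr ⟨h.1, h.2.2⟩))

theorem link_inter_link_succ (h : IsCycleOfStrings R y b d δ ε M W) {j : ℕ} (hj : 1 ≤ j)
    (hj' : j + 1 < 5 * n) :
    y j '' Icc 0 1 ∩ y (j + 1) '' Icc 0 1 = {(b (j + 1), -d (j + 1))} := by
  refine Subset.antisymm ?_ (singleton_subset_iff.2 ⟨(h.link j hj (by omega)).mem_right,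
    (h.link (j + 1) (by omega) hj').mem_left⟩)
  rintro p ⟨hp, hp'⟩
  have h1 := h.link_right hj (by omega) hp (h.le_fst_link (by omega) hj' hp')
  rcases h.link_left (by omega) hj' hp' (h.fst_link_le hj (by omega) hp) with h2 | h2
  · exact Prod.ext h2 h1
  · linarith [h.d_mono (Nat.lt_succ_self (j + 1))]

theorem link_inter_link (h : IsCycleOfStrings R y b d δ ε M W) {j k : ℕ} (hj : 1 ≤ j)
    (hjk : j + 1 < k) (hk : k < 5 * n) : y j '' Icc 0 1 ∩ y k '' Icc 0 1 = ∅ := by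
  rw [eq_empty_iff_forall_notMem]
  rintro p ⟨hp, hp'⟩
  have h1 := h.fst_link_le hj (by omega) hp
  have h2 := h.le_fst_link (by omega) hk hp'
  linarith [h.b_add_le hjk hk.le, h.delta_pos]

theorem closing_link_cases (h : IsCycleOfStrings R y b d δ ε M W) {j : ℕ} (hj : 1 ≤ j)
    (hj' : j < 5 * n) {p : ℝ × ℝ} (hp0 : p ∈ y 0 '' Icc 0 1) (hp : p ∈ y j '' Icc 0 1) :
    (j = 1 ∧ p = (b 1, -d 1)) ∨ (j + 1 = 5 * n ∧ p = (b (5 * n), -d (5 * n))) := by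
  have hδ := h.delta_pos
  have h1 := h.neg_eps_lt_link hj hj' hp
  have h2 := h.le_fst_link hj hj' hp
  have h3 := h.fst_link_le hj hj' hp
  have h4 : b 1 ≤ b j := by
    rcases hj.eq_or_lt with e | e
    · rw [← e]
    · linarith [h.b_add_le e hj'.le]
  rcases h.closing_cases hp0 with h' | h' | h' | h'
  · rcases (show j + 1 ≤ 5 * n from hj').eq_or_lt with e | e
    · refine Or.inr ⟨e, Prod.ext h' ?_⟩
      have := h.link_right hj hj' hp (by rw [e, h'])
      rwa [e] at this
    · linarith [h.b_add_le e le_rfl]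
  · linarith [h.eps_lt]
  · linarith [h.W_lt']
  · rcases hj.eq_or_lt with e | e
    · subst e
      refine Or.inl ⟨rfl, ?_⟩
      rcases h.link_left le_rfl hj' hp h'.2 with h5 | h5
      · exact Prod.ext h5 h'.1
      · linarith [h.d_mono (Nat.lt_succ_self 1), h'.1]
    · linarith [h.b_add_le e hj'.le]

theorem closing_inter_first (h : IsCycleOfStrings R y b d δ ε M W) :
    y 0 '' Icc 0 1 ∩ y 1 '' Icc 0 1 = {(b 1, -d 1)} := by
  have hn := h.pos
  refine Subset.antisymm ?_ (singleton_subset_iff.2 ⟨h.closing.mem_left,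
    (h.link 1 le_rfl (by omega)).mem_left⟩)
  rintro p ⟨hp, hp'⟩
  rcases h.closing_link_cases le_rfl (by omega) hp hp' with h1 | h1
  · exact h1.2
  · omega

theorem closing_inter_last (h : IsCycleOfStrings R y b d δ ε M W) {j : ℕ} (hj : j + 1 = 5 * n) :
    y 0 '' Icc 0 1 ∩ y j '' Icc 0 1 = {(b (5 * n), -d (5 * n))} := by
  refine Subset.antisymm ?_ (singleton_subset_iff.2 ⟨h.closing.mem_right, ?_⟩)
  · rintro p ⟨hp, hp'⟩
    rcases h.closing_link_cases (by omega) (by omega) hp hp' with h1 | h1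
    · omega
    · exact h1.2
  · rw [← hj]
    exact (h.link j (by omega) (by omega)).mem_right

theorem inter_subsingleton_and_nonempty_iff (h : IsCycleOfStrings R y b d δ ε M W) {j k : ℕ}
    (hjk : j < k) (hk : k < 5 * n) : (y j '' Icc 0 1 ∩ y k '' Icc 0 1).Subsingleton ∧
      ((y j '' Icc 0 1 ∩ y k '' Icc 0 1).Nonempty ↔ k = j + 1 ∨ (j = 0 ∧ k + 1 = 5 * n)) := by
  rcases Nat.eq_zero_or_pos j with rfl | hj
  · by_cases h1 : k = 1
    · subst h1
      rw [h.closing_inter_first]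
      simp
    by_cases h2 : k + 1 = 5 * n
    · rw [h.closing_inter_last h2]
      simp [h2]
    have : y 0 '' Icc 0 1 ∩ y k '' Icc 0 1 = ∅ := by
      rw [eq_empty_iff_forall_notMem]
      rintro p ⟨hp, hp'⟩
      rcases h.closing_link_cases (by omega) hk hp hp' with h3 | h3
      · exact h1 h3.1
      · exact h2 h3.1
    rw [this]
    simp [h1, h2]
  · by_cases h1 : k = j + 1
    · subst h1
      rw [h.link_inter_link_succ hj hk]
      simp
    · rw [h.link_inter_link hj (by omega) hk]
      simp [h1, hj.ne']

theorem b_le_or_le (h : IsCycleOfStrings R y b d δ ε M W) (i : Fin n) {j : ℕ} (hj : j ≤ 5 * n) :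
    (j ≤ 5 * i + 4 ∧ b j ≤ R.a i - 3 * δ) ∨ (5 * i + 5 ≤ j ∧ R.a i + 3 * δ ≤ b j) := by
  have hi := i.2
  have hδ := h.delta_pos
  rcases le_or_gt j (5 * i + 4) with h1 | h1
  · refine Or.inl ⟨h1, ?_⟩
    rcases h1.eq_or_lt with rfl | h2
    · exact h.b_left i
    · linarith [h.b_left i, h.b_add_le h2 (by omega)]
  · refine Or.inr ⟨h1, ?_⟩
    rcases (show 5 * (i : ℕ) + 5 ≤ j from h1).eq_or_lt with h2 | h2
    · rw [← h2]
      exact h.b_right i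
    · linarith [h.b_right i, h.b_add_le h2 hj]

theorem inter_closing (h : IsCycleOfStrings R y b d δ ε M W) (i : Fin n) :
    R.gam i '' Icc 0 1 ∩ y 0 '' Icc 0 1 = ∅ := by
  rw [eq_empty_iff_forall_notMem]
  rintro p ⟨⟨t, ht, rfl⟩, hp⟩
  have hn := h.pos
  have hb := h.bound i t ht
  rw [abs_lt] at hb
  have := h.M_lt
  have := h.W_lt
  have hδ := h.delta_pos
  rcases h.closing_cases hp with h1 | h1 | h1 | h1
  · linarith
  · linarith
  · linarith
  · have h2 := abs_lt.1 (h.strip i t ht (by linarith [h.d_lt 1 (by omega)]))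
    rcases h.b_le_or_le i (j := 1) (by omega) with h3 | h3
    · linarith
    · omega

theorem inter_link (h : IsCycleOfStrings R y b d δ ε M W) (i : Fin n) {j : ℕ} (hj : j < 5 * n)
    (hij : j ≠ 5 * i + 4) : R.gam i '' Icc 0 1 ∩ y j '' Icc 0 1 = ∅ := by
  rcases Nat.eq_zero_or_pos j with rfl | hj0
  · exact h.inter_closing i
  rw [eq_empty_iff_forall_notMem]
  rintro p ⟨⟨t, ht, rfl⟩, hp⟩
  have hδ := h.delta_pos
  have h2 := abs_lt.1 (h.strip i t ht (h.neg_eps_lt_link hj0 hj hp).le)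
  have h3 := h.le_fst_link hj0 hj hp
  have h4 := h.fst_link_le hj0 hj hp
  rcases h.b_le_or_le i hj.le with h5 | h5
  · rcases h.b_le_or_le i (j := j + 1) hj with h6 | h6
    · linarith
    · omega
  · linarith

theorem inter_string_subsingleton_and_nonempty_iff (h : IsCycleOfStrings R y b d δ ε M W)
    (i : Fin n) {j : ℕ} (hj : j < 5 * n) : (R.gam i '' Icc 0 1 ∩ y j '' Icc 0 1).Subsingleton ∧
      ((R.gam i '' Icc 0 1 ∩ y j '' Icc 0 1).Nonempty ↔ j = 5 * i + 4) := by
  by_cases hij : j = 5 * i + 4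
  · subst hij
    obtain ⟨p, hp⟩ := h.cross i
    simp [hp]
  · rw [h.inter_link i hj hij]
    simp [hij]

theorem y_cont (h : IsCycleOfStrings R y b d δ ε M W) {j : ℕ} (hj : j < 5 * n) :
    ContinuousOn (y j) (Icc 0 1) := by
  rcases Nat.eq_zero_or_pos j with rfl | hj0
  · exact h.closing.cont
  · exact (h.link j hj0 hj).cont

theorem y_inj (h : IsCycleOfStrings R y b d δ ε M W) {j : ℕ} (hj : j < 5 * n) :
    InjOn (y j) (Icc 0 1) := by
  rcases Nat.eq_zero_or_pos j with rfl | hj0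
  · exact h.closing.inj
  · exact (h.link j hj0 hj).inj

theorem y_below (h : IsCycleOfStrings R y b d δ ε M W) {j : ℕ} (hj : j < 5 * n) :
    ∀ t ∈ Ioc (0:ℝ) 1, (y j t).2 < 0 := by
  rcases Nat.eq_zero_or_pos j with rfl | hj0
  · exact h.closing.below
  · exact (h.link j hj0 hj).below

theorem y_start (h : IsCycleOfStrings R y b d δ ε M W) {j : ℕ} (hj : j < 5 * n) :
    y j 0 = (b (if j = 0 then 5 * n else j), 0) := by
  rcases Nat.eq_zero_or_pos j with rfl | hj0
  · simpa using h.closing.zero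
  · rw [if_neg hj0.ne']
    exact (h.link j hj0 hj).zero

theorem y_end (h : IsCycleOfStrings R y b d δ ε M W) {j : ℕ} (hj : j < 5 * n) :
    y j 1 = (b (j + 1) + δ, -d (j + 1)) := by
  rcases Nat.eq_zero_or_pos j with rfl | hj0
  · exact h.closing.one
  · exact (h.link j hj0 hj).one

theorem y_end_notMem (h : IsCycleOfStrings R y b d δ ε M W) {j k : ℕ} (hj : j < 5 * n)
    (hk : k < 5 * n) (hjk : j ≠ k) : y j 1 ∉ y k '' Icc 0 1 := by
  intro hp
  rw [h.y_end hj] at hp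
  have hδ := h.delta_pos
  rcases Nat.eq_zero_or_pos k with rfl | hk0
  · have hj0 : 0 < j := Nat.pos_of_ne_zero hjk
    rcases h.closing_cases hp with h1 | h1 | h1 | h1 <;> simp only at h1
    · rcases (show j + 1 ≤ 5 * n from hj).eq_or_lt with e | e
      · rw [e] at h1
        linarith
      · linarith [h.b_add_le e le_rfl]
    · linarith [h.d_lt (j + 1) hj, h.eps_lt]
    · linarith [h.W_lt', h.b_add_le (show 1 < j + 1 by omega) hj]
    · linarith [h.d_mono (show 1 < j + 1 by omega)]
  · rcases lt_trichotomy k (j + 1) with h1 | h1 | h1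
    · have h2 := h.fst_link_le hk0 hk hp
      simp only at h2
      linarith [h.b_add_le (show k + 1 < j + 1 by omega) hj]
    · subst h1
      rcases h.link_left hk0 hk hp le_rfl with h2 | h2 <;> simp only at h2
      · linarith
      · linarith [h.d_mono (Nat.lt_succ_self (j + 1))]
    · have h2 := h.le_fst_link hk0 hk hp
      simp only at h2
      linarith [h.b_add_le h1 hk.le]

theorem y_end_notMem_string (h : IsCycleOfStrings R y b d δ ε M W) (i : Fin n) {j : ℕ}
    (hj : j < 5 * n) : y j 1 ∉ R.gam i '' Icc 0 1 := by
  rintro ⟨t, ht, hp⟩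
  rw [h.y_end hj] at hp
  have hδ := h.delta_pos
  have h1 := h.strip i t ht (by
    rw [hp]
    exact neg_le_neg (h.d_lt (j + 1) hj).le)
  rw [hp, abs_lt] at h1
  simp only at h1
  rcases h.b_le_or_le i (j := j + 1) hj with h2 | h2 <;> linarith

theorem string_end_notMem (h : IsCycleOfStrings R y b d δ ε M W) (i : Fin n) {j : ℕ}
    (hj : j < 5 * n) : R.gam i 1 ∉ y j '' Icc 0 1 := by
  intro hp
  rcases Nat.eq_zero_or_pos j with rfl | hj0
  · have := h.inter_closing i
    rw [eq_empty_iff_forall_notMem] at this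
    exact this _ ⟨⟨1, by simp, rfl⟩, hp⟩
  · linarith [h.neg_eps_lt_link hj0 hj hp, h.deep i]

end IsCycleOfStrings

theorem exists_pos_forall_of_finite {ι : Type*} [Finite ι] {P : ι → ℝ → Prop}
    (hmono : ∀ i r s, 0 < r → r ≤ s → P i s → P i r) (hex : ∀ i, ∃ r > 0, P i r) :
    ∃ r > 0, ∀ i, P i r := by
  have : ∀ᶠ r in 𝓝[>] (0:ℝ), ∀ i, P i r := eventually_all.2 fun i => by
    obtain ⟨s, hs, hP⟩ := hex i
    filter_upwards [Ioc_mem_nhdsGT hs] with r hr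
    exact hmono i r s hr.1 hr.2 hP
  obtain ⟨r, hr, hr0⟩ := (this.and self_mem_nhdsWithin).exists
  exact ⟨r, hr0, hr⟩

theorem exists_strip {γ : ℝ → ℝ × ℝ} {a δ : ℝ} (hγ : ContinuousOn γ (Icc 0 1)) (hδ : 0 < δ)
    (hγ0 : γ 0 = (a, 0)) (hbelow : ∀ t ∈ Ioc (0:ℝ) 1, (γ t).2 < 0) :
    ∃ ε > 0, (∀ t ∈ Icc (0:ℝ) 1, -ε ≤ (γ t).2 → |(γ t).1 - a| < δ) ∧ (γ 1).2 < -ε := by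
  set T := Icc (0:ℝ) 1 ∩ (fun t => |(γ t).1 - a|) ⁻¹' Ici δ with hT
  have hc : ContinuousOn (fun t => |(γ t).1 - a|) (Icc 0 1) :=
    ((continuous_fst.comp_continuousOn hγ).sub continuousOn_const).abs
  have hTc : IsCompact T :=
    isCompact_Icc.of_isClosed_subset (hc.preimage_isClosed_of_isClosed isClosed_Icc isClosed_Ici)
      inter_subset_left
  have h1 := hbelow 1 (by simp)
  rcases T.eq_empty_or_nonempty with hTe | hTn
  · refine ⟨-(γ 1).2 / 2, by linarith, fun t ht _ => ?_, by linarith⟩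
    by_contra! h
    exact absurd (show t ∈ T from ⟨ht, h⟩) (by simp [hTe])
  · obtain ⟨s, hs, hmax⟩ := hTc.exists_isMaxOn hTn
      ((continuous_snd.comp_continuousOn hγ).mono inter_subset_left)
    have hs0 : 0 < s := by
      refine hs.1.1.lt_of_ne fun h => ?_
      have := hs.2
      rw [← h] at this
      simp only [mem_preimage, hγ0, sub_self, abs_zero, mem_Ici] at this
      linarith
    have h2 := hbelow s ⟨hs0, hs.1.2⟩
    have h3 := min_le_left (-(γ 1).2) (-(γ s).2)
    have h4 := min_le_right (-(γ 1).2) (-(γ s).2)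
    have h5 : 0 < min (-(γ 1).2) (-(γ s).2) := lt_min (by linarith) (by linarith)
    refine ⟨min (-(γ 1).2) (-(γ s).2) / 2, by linarith, fun t ht hty => ?_, by linarith⟩
    by_contra! h
    have h6 : (γ t).2 ≤ (γ s).2 := hmax (show t ∈ T from ⟨ht, h⟩)
    linarith

theorem exists_bound {γ : ℝ → ℝ × ℝ} (hγ : ContinuousOn γ (Icc 0 1)) :
    ∃ C, ∀ t ∈ Icc (0:ℝ) 1, |(γ t).1| ≤ C ∧ -C ≤ (γ t).2 := by
  obtain ⟨C, hC⟩ := isCompact_Icc.exists_bound_of_continuousOn hγ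
  refine ⟨C, fun t ht => ⟨(norm_fst_le _).trans (hC t ht), ?_⟩⟩
  exact (abs_le.1 ((norm_snd_le _).trans (hC t ht))).1

/-- Anchors of the cycle strings: the `j`-th one for `j = 5 * q + r` with `r < 5` lies at distance
`(11 - 2 * r) * δ` to the left of the `q`-th anchor, an additional anchor `A` coming last. -/
noncomputable def cycleAnchor {n : ℕ} (a : Fin n → ℝ) (A δ : ℝ) (j : ℕ) : ℝ :=
  (if h : j / 5 < n then a ⟨j / 5, h⟩ else A) - 11 * δ + 2 * δ * (j % 5 : ℕ)

theorem cycleAnchor_step {n : ℕ} {a : Fin n → ℝ} {A δ : ℝ} (hδ : 0 < δ)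
    (ha : ∀ i j, i < j → a i + 14 * δ < a j) (hA : ∀ i, a i + 14 * δ < A) {j : ℕ}
    (hj : j < 5 * n) : cycleAnchor a A δ j + 2 * δ ≤ cycleAnchor a A δ (j + 1) := by
  unfold cycleAnchor
  have hjn : j / 5 < n := by omega
  rw [dif_pos hjn]
  by_cases h4 : j % 5 = 4
  · have h1 : (j + 1) / 5 = j / 5 + 1 := by omega
    have h2 : (j + 1) % 5 = 0 := by omega
    rw [h2, h4]
    push_cast
    split_ifs with h
    · have := ha ⟨j / 5, hjn⟩ ⟨(j + 1) / 5, h⟩ (by simp [Fin.lt_def, h1])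
      linarith
    · linarith [hA ⟨j / 5, hjn⟩]
  · have h1 : (j + 1) / 5 = j / 5 := by omega
    have h2 : (j + 1) % 5 = j % 5 + 1 := by omega
    simp only [h1, h2, dif_pos hjn]
    push_cast
    linarith

theorem cycleAnchor_left {n : ℕ} (a : Fin n → ℝ) (A δ : ℝ) (i : Fin n) :
    cycleAnchor a A δ (5 * i + 4) = a i - 3 * δ := by
  unfold cycleAnchor
  have h1 : (5 * (i : ℕ) + 4) / 5 = i := by omega
  have h2 : (5 * (i : ℕ) + 4) % 5 = 4 := by omega
  simp only [h1, h2, i.2, dif_pos, Fin.eta]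
  push_cast
  ring

theorem cycleAnchor_right {n : ℕ} {a : Fin n → ℝ} {A δ : ℝ}
    (ha : ∀ i j, i < j → a i + 14 * δ < a j) (hA : ∀ i, a i + 14 * δ < A) (i : Fin n) :
    a i + 3 * δ ≤ cycleAnchor a A δ (5 * i + 5) := by
  unfold cycleAnchor
  have h1 : (5 * (i : ℕ) + 5) / 5 = i + 1 := by omega
  have h2 : (5 * (i : ℕ) + 5) % 5 = 0 := by omega
  rw [h2]
  push_cast
  split_ifs with h
  · have := ha i ⟨(5 * (i : ℕ) + 5) / 5, h⟩ (by simp [Fin.lt_def, h1])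
    linarith
  · linarith [hA i]

theorem cycleAnchor_last {n : ℕ} (a : Fin n → ℝ) (A δ : ℝ) :
    cycleAnchor a A δ (5 * n) = A - 11 * δ := by
  unfold cycleAnchor
  rw [dif_neg (by omega), show 5 * n % 5 = 0 by omega]
  simp

theorem exists_isCycleOfStrings {n : ℕ} (hn : 0 < n) {G : SimpleGraph (Fin n)}
    (R : Grounded1StringRep G) (hord : ∀ i j : Fin n, i < j ↔ R.a i < R.a j) :
    ∃ y b d δ ε M W, IsCycleOfStrings R y b d δ ε M W := by
  obtain ⟨δ, hδ, hsep⟩ := exists_pos_forall_of_finite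
    (P := fun (p : Fin n × Fin n) δ => p.1 < p.2 → R.a p.1 + 14 * δ < R.a p.2)
    (fun p r s _ hrs h hp => by linarith [h hp])
    (fun p => by
      by_cases hp : p.1 < p.2
      · have := (hord _ _).1 hp
        exact ⟨(R.a p.2 - R.a p.1) / 15, by linarith, fun _ => by linarith⟩
      · exact ⟨1, one_pos, fun h => absurd h hp⟩)
  have ha : ∀ i j, i < j → R.a i + 14 * δ < R.a j := fun i j => hsep (i, j)
  obtain ⟨ε, hε, hstrip⟩ := exists_pos_forall_of_finite
    (P := fun i ε => (∀ t ∈ Icc (0:ℝ) 1, -ε ≤ (R.gam i t).2 → |(R.gam i t).1 - R.a i| < δ) ∧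
      (R.gam i 1).2 < -ε)
    (fun i r s _ hrs h => ⟨fun t ht hr => h.1 t ht (by linarith), by linarith [h.2]⟩)
    (fun i => exists_strip (R.cont i) hδ (R.start i) (R.below i))
  have hcr := fun i => exists_isLinkString_crossing (R.cont i) (R.inj i) hδ hε (R.start i)
    (R.below i) (hstrip i).1 (hstrip i).2
  obtain ⟨E, hE, hcross⟩ := exists_pos_forall_of_finite
    (P := fun i e₀ => e₀ ≤ ε ∧ ∀ e' e b', 0 < e' → e' < e → e < e₀ → R.a i + 3 * δ ≤ b' →
      ∃ g, IsLinkString (R.a i - 3 * δ) b' δ e' e ε g ∧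
        ∃ p, R.gam i '' Icc 0 1 ∩ g '' Icc 0 1 = {p})
    (fun i r s _ hrs h => ⟨hrs.trans h.1, fun e' e b' h1 h2 h3 =>
      h.2 e' e b' h1 h2 (h3.trans_le hrs)⟩) hcr
  have hEε : E ≤ ε := (hcross ⟨0, hn⟩).1
  choose C hC using fun i => exists_bound (R.cont i)
  obtain ⟨M₀, hM₀⟩ := (finite_range C).bddAbove
  set M := max M₀ ε + 1 with hM
  have hMC : ∀ i, C i < M := fun i =>
    ((hM₀ (mem_range_self i)).trans (le_max_left _ _)).trans_lt (lt_add_one _)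
  have hMε : ε < M := (le_max_right _ _).trans_lt (lt_add_one _)
  set A := M + 14 * δ with hA
  have haM : ∀ i, R.a i < M := fun i => by
    have := (hC i 0 (by simp)).1
    rw [R.start] at this
    exact (le_abs_self _).trans_lt (this.trans_lt (hMC i))
  have hAa : ∀ i, R.a i + 14 * δ < A := fun i => by linarith [haM i]
  set b := cycleAnchor R.a A δ with hb
  have hbs : ∀ j < 5 * n, b j + 2 * δ ≤ b (j + 1) := fun j hj => cycleAnchor_step hδ ha hAa hj
  set d : ℕ → ℝ := fun j => E * j / (5 * n + 1) with hd
  have hdm : StrictMono d := fun j k hjk => by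
    have : (j : ℝ) < k := by exact_mod_cast hjk
    simp only [hd]
    gcongr
  have hd0 : d 0 = 0 := by simp [hd]
  have hdE : ∀ j ≤ 5 * n, d j < E := fun j hj => by
    have : (j : ℝ) ≤ 5 * n := by exact_mod_cast hj
    simp only [hd]
    rw [div_lt_iff₀ (by positivity)]
    nlinarith
  have hdpos : ∀ j, 1 ≤ j → 0 < d j := fun j hj => hd0 ▸ hdm hj
  obtain ⟨W, hW⟩ : ∃ W, W < min (-M) (b 1) := exists_lt _
  rw [lt_min_iff] at hW
  have hb1 : b 1 + 2 * δ < b (5 * n) := by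
    have h1 : ∀ j, 2 ≤ j → j ≤ 5 * n → b 1 + 2 * δ ≤ b j := fun j hj => by
      induction j, hj using Nat.le_induction with
      | base => exact fun h => hbs 1 (by omega)
      | succ k hk ih => exact fun h => by linarith [ih (by omega), hbs k h]
    have h2 := hbs (5 * n - 1) (by omega)
    rw [show 5 * n - 1 + 1 = 5 * n by omega] at h2
    linarith [h1 (5 * n - 1) (by omega) (by omega)]
  obtain ⟨g₀, hg₀⟩ := exists_isClosingString hW.2 hb1 hδ (hdpos 1 le_rfl)
    (hdm (show 1 < 5 * n by omega)) ((hdE _ le_rfl).trans_le hEε |>.trans hMε)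
  have hlink : ∀ j, ∃ g, 1 ≤ j → j < 5 * n →
      IsLinkString (b j) (b (j + 1)) δ (d j) (d (j + 1)) ε g ∧
      ∀ i : Fin n, j = 5 * i + 4 → ∃ p, R.gam i '' Icc 0 1 ∩ g '' Icc 0 1 = {p} := by
    intro j
    by_cases hj : 1 ≤ j ∧ j < 5 * n
    swap
    · exact ⟨fun _ => 0, fun h1 h2 => absurd ⟨h1, h2⟩ hj⟩
    by_cases hi : ∃ i : Fin n, j = 5 * i + 4
    · obtain ⟨i, rfl⟩ := hi
      obtain ⟨g, hg, hp⟩ := (hcross i).2 (d (5 * i + 4)) (d (5 * i + 4 + 1)) (b (5 * i + 4 + 1))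
        (hdpos _ hj.1) (hdm (Nat.lt_succ_self _)) (hdE _ hj.2) (cycleAnchor_right ha hAa i)
      rw [← cycleAnchor_left R.a A δ i] at hg
      refine ⟨g, fun _ _ => ⟨hg, fun i' hi' => ?_⟩⟩
      have : i' = i := Fin.ext (by omega)
      rwa [this]
    · obtain ⟨g, hg⟩ := exists_isLinkString (b := b j) (b' := b (j + 1)) (ε := ε) hδ
        (by linarith [hbs j hj.2]) (hdpos j hj.1) (hdm (Nat.lt_succ_self j))
      exact ⟨g, fun _ _ => ⟨hg, fun i hi' => absurd ⟨i, hi'⟩ hi⟩⟩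
  choose g hg using hlink
  refine ⟨fun j => if j = 0 then g₀ else g j, b, d, δ, ε, M, W, hn, hδ, hbs,
    fun i => (cycleAnchor_left R.a A δ i).le, cycleAnchor_right ha hAa, hdm,
    fun j hj => (hdE j hj).trans_le hEε, hMε, fun i => (hstrip i).1, fun i => (hstrip i).2,
    fun i t ht => ⟨(hC i t ht).1.trans_lt (hMC i), by linarith [(hC i t ht).2, hMC i]⟩, ?_,
    hW.1, hW.2, by simpa using hg₀, fun j hj hj' => ?_, fun i => ?_⟩
  · rw [hb, cycleAnchor_last]
    linarith
  · rw [if_neg (by omega)]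
    exact (hg j hj hj').1
  · simp only [Nat.add_eq_zero_iff, OfNat.ofNat_ne_zero, and_false, if_false]
    exact (hg _ (by omega) (by omega)).2 i rfl

/-- The intersection graph of the images of a family of curves parametrized by the unit interval. -/
def stringGraph {V : Type} (γ : V → ℝ → ℝ × ℝ) : SimpleGraph V where
  Adj u v := u ≠ v ∧ (γ u '' Icc 0 1 ∩ γ v '' Icc 0 1).Nonempty
  symm := ⟨fun _ _ h => ⟨h.1.symm, inter_comm _ _ ▸ h.2⟩⟩
  loopless := ⟨fun _ h => h.1 rfl⟩

/-- A family of strings with distinct anchors, any two of which meet at most once and away from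
their endpoints, represents its intersection graph. -/
def Grounded1StringRep.ofStrings {V : Type} (γ : V → ℝ → ℝ × ℝ) (a : V → ℝ)
    (cont : ∀ v, ContinuousOn (γ v) (Icc 0 1)) (inj : ∀ v, InjOn (γ v) (Icc 0 1))
    (start : ∀ v, γ v 0 = (a v, 0)) (below : ∀ v, ∀ t ∈ Ioc (0 : ℝ) 1, (γ v t).2 < 0)
    (a_inj : Function.Injective a)
    (one_string : ∀ u v, u ≠ v → (γ u '' Icc 0 1 ∩ γ v '' Icc 0 1).Subsingleton)
    (end_off : ∀ u v, u ≠ v → γ v 1 ∉ γ u '' Icc 0 1) :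
    Grounded1StringRep (stringGraph γ) where
  gam := γ
  a := a
  cont := cont
  inj := inj
  start := start
  below := below
  a_inj := a_inj
  one_string := one_string
  endpoints_off u v huv := by
    refine ⟨?_, end_off u v huv⟩
    rintro ⟨t, ht, hut⟩
    rw [start v] at hut
    obtain rfl | h0 := ht.1.eq_or_lt
    · rw [start u, Prod.mk.injEq] at hut
      exact huv (a_inj hut.1)
    · have := below u t ⟨h0, ht.2⟩
      simp [hut] at this
  adj_iff u v huv := by simp [stringGraph, huv]

namespace IsCycleOfStrings

variable {n : ℕ} {G : SimpleGraph (Fin n)} {R : Grounded1StringRep G} {y : ℕ → ℝ → ℝ × ℝ}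
  {b d : ℕ → ℝ} {δ ε M W : ℝ}

theorem anchor_injective (h : IsCycleOfStrings R y b d δ ε M W) :
    Function.Injective
      (Sum.elim R.a fun j : Fin (5 * n) => b (if j.val = 0 then 5 * n else j)) := by
  have hδ := h.delta_pos
  refine R.a_inj.sumElim (fun j k hjk => ?_) fun i j hij => ?_
  · have hj := j.2
    have hk := k.2
    by_contra hne
    rw [Fin.ext_iff] at hne
    rcases lt_trichotomy (if j.val = 0 then 5 * n else j.val)
      (if k.val = 0 then 5 * n else k.val) with hlt | heq | hlt
    · have := h.b_add_le hlt (by split_ifs <;> omega)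
      linarith
    · split_ifs at heq <;> omega
    · have := h.b_add_le hlt (by split_ifs <;> omega)
      linarith
  · rcases h.b_le_or_le i (j := if j.val = 0 then 5 * n else j) (by split_ifs <;> omega) with
      ⟨-, hle⟩ | ⟨-, hle⟩ <;> linarith

theorem isCycleExtension (h : IsCycleOfStrings R y b d δ ε M W) :
    IsCycleExtension n G (stringGraph (Sum.elim R.gam fun j : Fin (5 * n) => y j)) := by
  have hn := h.pos
  have hsucc : ∀ i j : ℕ, i < 5 * n → j < 5 * n →
      ((i + 1) % (5 * n) = j ↔ j = i + 1 ∨ (j = 0 ∧ i + 1 = 5 * n)) := by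
    intro i j hi hj
    obtain hlt | heq := Nat.lt_or_eq_of_le (Nat.succ_le_of_lt hi)
    · rw [Nat.mod_eq_of_lt hlt]
      omega
    · rw [show i + 1 = 5 * n from heq, Nat.mod_self]
      omega
  refine ⟨fun i j => ?_, fun i j => ?_, fun i => Or.inl fun j => ?_⟩
  · by_cases hij : i = j
    · simp [hij]
    · simp [stringGraph, hij, R.adj_iff i j hij]
  · have hi := i.2
    have hj := j.2
    rw [hsucc i j hi hj, hsucc j i hj hi]
    simp only [stringGraph, ne_eq, Sum.inr.injEq, Sum.elim_inr, Fin.ext_iff]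
    rcases lt_trichotomy i.val j.val with hlt | heq | hlt
    · rw [(h.inter_subsingleton_and_nonempty_iff hlt hj).2]
      omega
    · omega
    · rw [inter_comm, (h.inter_subsingleton_and_nonempty_iff hlt hi).2]
      omega
  · simpa only [stringGraph, ne_eq, reduceCtorEq, not_false_eq_true, true_and, Sum.elim_inl,
      Sum.elim_inr] using (h.inter_string_subsingleton_and_nonempty_iff i j.2).2

/-- The strings of `R` together with the added ones. -/
noncomputable def rep (h : IsCycleOfStrings R y b d δ ε M W) :
    Grounded1StringRep (stringGraph (Sum.elim R.gam fun j : Fin (5 * n) => y j)) :=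
  .ofStrings _ (Sum.elim R.a fun j => b (if j.val = 0 then 5 * n else j))
    (by rintro (i | j); exacts [R.cont i, h.y_cont j.2])
    (by rintro (i | j); exacts [R.inj i, h.y_inj j.2])
    (by rintro (i | j); exacts [R.start i, h.y_start j.2])
    (by rintro (i | j); exacts [R.below i, h.y_below j.2])
    h.anchor_injective
    (by
      rintro (i | j) (i' | k) hne
      · exact R.one_string i i' (by simpa using hne)
      · exact (h.inter_string_subsingleton_and_nonempty_iff i k.2).1
      · rw [inter_comm]
        exact (h.inter_string_subsingleton_and_nonempty_iff i' j.2).1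
      · obtain hlt | hlt := Nat.lt_or_gt_of_ne (show j.val ≠ k.val by simpa [Fin.ext_iff] using hne)
        · exact (h.inter_subsingleton_and_nonempty_iff hlt k.2).1
        · rw [inter_comm]
          exact (h.inter_subsingleton_and_nonempty_iff hlt j.2).1)
    (by
      rintro (i | j) (i' | k) hne
      · exact (R.endpoints_off i i' (by simpa using hne)).2
      · exact h.y_end_notMem_string i k.2
      · exact h.string_end_notMem i' j.2
      · exact h.y_end_notMem k.2 j.2 (by simpa [Fin.ext_iff, eq_comm] using hne))

end IsCycleOfStrings

end

/-- Every grounded 1-string representation of a graph `G` on `Fin n`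
inducing the natural order can be extended (keeping the strings of the original
vertices) to a grounded 1-string representation of some cycle extension `H` of `G`. -/
theorem extend_grounded1String_to_cycle_extension (n : ℕ) (G : SimpleGraph (Fin n))
    (R : Grounded1StringRep G) (hord : ∀ i j : Fin n, i < j ↔ R.a i < R.a j) :
    ∃ H : SimpleGraph (Fin n ⊕ Fin (5 * n)), IsCycleExtension n G H ∧
      ∃ R' : Grounded1StringRep H, ∀ i : Fin n,
        R'.a (Sum.inl i) = R.a i ∧
        ∀ t ∈ Set.Icc (0 : ℝ) 1, R'.gam (Sum.inl i) t = R.gam i t := by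
  obtain rfl | hn := Nat.eq_zero_or_pos n
  · have hV : IsEmpty (Fin 0 ⊕ Fin (5 * 0)) := inferInstanceAs (IsEmpty (Fin 0 ⊕ Fin 0))
    exact ⟨⊥, ⟨fun i => i.elim0, fun i => i.elim0, fun i => i.elim0⟩,
      ⟨hV.elim, hV.elim, hV.elim, hV.elim, hV.elim, hV.elim, hV.elim, hV.elim, hV.elim, hV.elim⟩,
      fun i => i.elim0⟩
  · obtain ⟨y, b, d, δ, ε, M, W, h⟩ := exists_isCycleOfStrings hn R hord
    exact ⟨_, h.isCycleExtension, h.rep, fun i => ⟨rfl, fun t _ => rfl⟩⟩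
end

section
/- Let G be a finite simple graph with vertices x_1, …, x_n equipped with the linear order < given by x_1 < ⋯ < x_n, and let H be a cycle extension of (G,<). Then in every grounded 1-string representation of H, the linear order induced by the representation on the vertices x_1, …, x_n (ordering them by their anchors) is equivalent to < (i.e., it can be obtained from < by a sequence of cyclic shifts and reversals). -/
open Set

/-- A continuous real function whose sine is nonnegative cannot leave `[0, π]`. -/
lemma mem_Icc_zero_pi_of_sin_nonneg {φ : ℝ → ℝ} (hφ : Continuous φ)
    (hs : ∀ t, 0 ≤ Real.sin (φ t)) {a : ℝ} (ha : φ a ∈ Icc 0 Real.pi) (b : ℝ) :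
    φ b ∈ Icc 0 Real.pi := by
  have hpi := Real.pi_pos
  have key : ∀ w, (φ a ≤ w ∧ w ≤ φ b ∨ φ b ≤ w ∧ w ≤ φ a) → 0 ≤ Real.sin w := by
    rintro w (⟨h₁, h₂⟩ | ⟨h₁, h₂⟩)
    · obtain ⟨t, rfl⟩ := mem_range_of_exists_le_of_exists_ge hφ ⟨a, h₁⟩ ⟨b, h₂⟩
      exact hs t
    · obtain ⟨t, rfl⟩ := mem_range_of_exists_le_of_exists_ge hφ ⟨b, h₁⟩ ⟨a, h₂⟩
      exact hs t
  constructor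
  · by_contra! h
    have h₁ := key (max (φ b) (-(Real.pi / 2)))
      (Or.inr ⟨le_max_left _ _, max_le (by linarith [ha.1]) (by linarith [ha.1])⟩)
    have h₂ : Real.sin (max (φ b) (-(Real.pi / 2))) < 0 :=
      Real.sin_neg_of_neg_of_neg_pi_lt (max_lt h (by linarith))
        (lt_max_of_lt_right (by linarith))
    linarith
  · by_contra! h
    set w := min (φ b) (Real.pi + Real.pi / 2)
    have hw₁ : Real.pi < w := lt_min h (by linarith)
    have hw₂ : w ≤ Real.pi + Real.pi / 2 := min_le_right _ _
    have h₁ := key w (Or.inl ⟨by linarith [ha.2], min_le_left _ _⟩)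
    have h₂ : 0 < Real.sin (w - Real.pi) :=
      Real.sin_pos_of_pos_of_lt_pi (by linarith) (by linarith)
    rw [Real.sin_sub_pi] at h₂
    linarith

lemma eq_pi_of_sin_eq_zero_of_cos_neg {x : ℝ} (hx : x ∈ Icc 0 Real.pi)
    (hs : Real.sin x = 0) (hc : Real.cos x < 0) : x = Real.pi := by
  refine hx.2.eq_of_not_lt fun h => ?_
  rcases hx.1.eq_or_lt with h' | h'
  · rw [← h', Real.cos_zero] at hc
    linarith
  · exact (Real.sin_pos_of_pos_of_lt_pi h' h).ne' hs

/-- Two curves in the closed lower half plane with interleaving end points on the boundary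
line meet. -/
lemma exists_eq_of_interleaving {f g : ℝ → ℝ × ℝ} (hf : Continuous f) (hg : Continuous g)
    (hf₂ : ∀ t, (f t).2 ≤ 0) (hg₂ : ∀ t, (g t).2 ≤ 0) {p q r s : ℝ}
    (hf0 : f 0 = (p, 0)) (hg0 : g 0 = (q, 0)) (hf1 : f 1 = (r, 0)) (hg1 : g 1 = (s, 0))
    (hpq : p < q) (hqr : q < r) (hrs : r < s) : ∃ t u, f t = g u := by
  by_contra! hne
  let h : C(ℝ × ℝ, ℂ) :=
    ⟨fun z => ((f z.1).1 - (g z.2).1 : ℝ) + ((f z.1).2 - (g z.2).2 : ℝ) * Complex.I, by fun_prop⟩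
  have hre : ∀ t u, (h (t, u)).re = (f t).1 - (g u).1 := fun t u => by simp [h]
  have him : ∀ t u, (h (t, u)).im = (f t).2 - (g u).2 := fun t u => by simp [h]
  have h0 : ∀ z, h z ∈ ({0}ᶜ : Set ℂ) := by
    rintro ⟨t, u⟩ hz
    refine hne t u (Prod.ext ?_ ?_)
    · have := hre t u
      rw [hz] at this
      simp at this
      linarith
    · have := him t u
      rw [hz] at this
      simp at this
      linarith
  obtain ⟨F, ⟨hF0, hF⟩, -⟩ := Complex.isCoveringMapOn_exp.existsUnique_continuousMap_lifts h
    (Complex.exp_log (h0 (0, 0))) h0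
  let θ : ℝ → ℝ → ℝ := fun t u => (F (t, u)).im
  have hexp : ∀ t u, h (t, u) = Complex.exp (F (t, u)) := fun t u => (congrFun hF (t, u)).symm
  have hsin : ∀ t u, (f t).2 - (g u).2 = Real.exp (F (t, u)).re * Real.sin (θ t u) := by
    intro t u
    rw [← him, hexp, Complex.exp_im]
  have hcos : ∀ t u, (f t).1 - (g u).1 = Real.exp (F (t, u)).re * Real.cos (θ t u) := by
    intro t u
    rw [← hre, hexp, Complex.exp_re]
  have sin_nonneg : ∀ t u, (f t).2 = 0 → 0 ≤ Real.sin (θ t u) := by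
    intro t u ht
    have h₁ := hsin t u
    have h₂ := hg₂ u
    exact nonneg_of_mul_nonneg_right (by linarith) (Real.exp_pos _)
  have sin_nonpos : ∀ t u, (g u).2 = 0 → Real.sin (θ t u) ≤ 0 := by
    intro t u hu
    have h₁ := hsin t u
    have h₂ := hf₂ t
    by_contra! h₃
    have := mul_pos (Real.exp_pos (F (t, u)).re) h₃
    linarith
  have cos_neg : ∀ t u, (f t).1 < (g u).1 → Real.cos (θ t u) < 0 := by
    intro t u htu
    have h₁ := hcos t u
    by_contra! h₃
    have := mul_nonneg (Real.exp_pos (F (t, u)).re).le h₃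
    linarith
  have cos_pos : ∀ t u, (g u).1 < (f t).1 → 0 < Real.cos (θ t u) := by
    intro t u htu
    have h₁ := hcos t u
    exact pos_of_mul_pos_right (by linarith) (Real.exp_pos _).le
  have sin_zero : ∀ t u, (f t).2 = 0 → (g u).2 = 0 → Real.sin (θ t u) = 0 := fun t u ht hu =>
    le_antisymm (sin_nonpos t u hu) (sin_nonneg t u ht)
  have c₁ : ∀ t, Continuous (θ t) := fun t => by fun_prop
  have c₂ : ∀ u, Continuous (fun t => θ t u) := fun u => by fun_prop
  have f0 : (f 0).2 = 0 := by rw [hf0]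
  have f1 : (f 1).2 = 0 := by rw [hf1]
  have g0 : (g 0).2 = 0 := by rw [hg0]
  have g1 : (g 1).2 = 0 := by rw [hg1]
  have hpi := Real.pi_pos
  have θ00 : θ 0 0 = Real.pi := by
    have : h (0, 0) = ((p - q : ℝ) : ℂ) := by simp [h, hf0, hg0]
    simp only [θ]
    rw [hF0, Complex.log_im, this, Complex.arg_ofReal_of_neg (by linarith)]
  have θ01 : θ 0 1 = Real.pi :=
    eq_pi_of_sin_eq_zero_of_cos_neg
      (mem_Icc_zero_pi_of_sin_nonneg (c₁ 0) (fun u => sin_nonneg 0 u f0) (a := 0)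
        (by rw [θ00]; exact ⟨hpi.le, le_rfl⟩) 1)
      (sin_zero 0 1 f0 g1) (cos_neg 0 1 (by rw [hf0, hg1]; simp; linarith))
  have θ11 : θ 1 1 - Real.pi ∈ Icc 0 Real.pi :=
    mem_Icc_zero_pi_of_sin_nonneg (φ := fun t => θ t 1 - Real.pi) (by fun_prop)
      (fun t => by rw [Real.sin_sub_pi]; linarith [sin_nonpos t 1 g1]) (a := 0)
      (by rw [θ01]; simp [hpi.le]) 1
  have θ10 : θ 1 0 - Real.pi = Real.pi := by
    have hmem : θ 1 0 - Real.pi ∈ Icc 0 Real.pi :=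
      mem_Icc_zero_pi_of_sin_nonneg (φ := fun t => θ t 0 - Real.pi) (by fun_prop)
        (fun t => by rw [Real.sin_sub_pi]; linarith [sin_nonpos t 0 g0]) (a := 0)
        (by rw [θ00]; simp [hpi.le]) 1
    refine eq_pi_of_sin_eq_zero_of_cos_neg hmem ?_ ?_
    · rw [Real.sin_sub_pi, sin_zero 1 0 f1 g0, neg_zero]
    · rw [Real.cos_sub_pi]
      linarith [cos_pos 1 0 (by rw [hf1, hg0]; exact hqr)]
  have θ11' : θ 1 1 - 2 * Real.pi = Real.pi := by
    have hmem : θ 1 1 - 2 * Real.pi ∈ Icc 0 Real.pi :=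
      mem_Icc_zero_pi_of_sin_nonneg (φ := fun u => θ 1 u - 2 * Real.pi)
        (by have := c₁ 1; fun_prop)
        (fun u => by rw [Real.sin_sub_two_pi]; exact sin_nonneg 1 u f1) (a := 0)
        (by constructor <;> linarith) 1
    refine eq_pi_of_sin_eq_zero_of_cos_neg hmem ?_ ?_
    · rw [Real.sin_sub_two_pi, sin_zero 1 1 f1 g1]
    · rw [Real.cos_sub_two_pi]
      exact cos_neg 1 1 (by rw [hf1, hg1]; exact hrs)
  linarith [θ11.2]

/-- `r` lies strictly between `p` and `q`, in either order. -/
def StrictBetween (p q r : ℝ) : Prop := p < r ∧ r < q ∨ q < r ∧ r < p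

/-- The chord between `r` and `s` does not cross the one between `p` and `q`. -/
def NonCrossing (p q r s : ℝ) : Prop := StrictBetween p q r ↔ StrictBetween p q s

namespace Grounded1StringRep

variable {V : Type} {H : SimpleGraph V} (R : Grounded1StringRep H)

/-- The union of the strings of the vertices in `S`. -/
def region (S : Set V) : Set (ℝ × ℝ) := ⋃ v ∈ S, R.gam v '' Icc 0 1

lemma snd_nonpos_of_mem_region {S : Set V} {z : ℝ × ℝ} (hz : z ∈ R.region S) : z.2 ≤ 0 := by
  simp only [region, mem_iUnion] at hz
  obtain ⟨v, -, t, ht, rfl⟩ := hz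
  rcases ht.1.eq_or_lt with rfl | h
  · rw [R.start]
  · exact (R.below v t ⟨h, ht.2⟩).le

lemma joinedIn_of_mem_image {S : Set V} {v : V} (hv : v ∈ S) {z : ℝ × ℝ}
    (hz : z ∈ R.gam v '' Icc 0 1) : JoinedIn (R.region S) (R.a v, 0) z := by
  have hc : IsPathConnected (R.gam v '' Icc 0 1) :=
    ((convex_Icc (0 : ℝ) 1).isPathConnected ⟨0, by simp⟩).image' (R.cont v)
  refine (hc.joinedIn _ ?_ _ hz).mono (subset_biUnion_of_mem (u := fun v => R.gam v '' Icc 0 1) hv)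
  exact ⟨0, by simp, R.start v⟩

lemma joinedIn_of_adj {S : Set V} {u v : V} (hu : u ∈ S) (hv : v ∈ S) (h : H.Adj u v) :
    JoinedIn (R.region S) (R.a u, 0) (R.a v, 0) := by
  obtain ⟨z, hzu, hzv⟩ := (R.adj_iff u v h.ne).1 h
  exact (R.joinedIn_of_mem_image hu hzu).trans (R.joinedIn_of_mem_image hv hzv).symm

lemma not_interleaving {S T : Set V} (hST : ∀ u ∈ S, ∀ v ∈ T, u ≠ v ∧ ¬ H.Adj u v)
    {s s' t t' : V} (hs : JoinedIn (R.region S) (R.a s, 0) (R.a s', 0))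
    (ht : JoinedIn (R.region T) (R.a t, 0) (R.a t', 0)) :
    ¬ (R.a s < R.a t ∧ R.a t < R.a s' ∧ R.a s' < R.a t') := by
  rintro ⟨h₁, h₂, h₃⟩
  obtain ⟨x, y, hxy⟩ := exists_eq_of_interleaving
    (f := hs.somePath.extend) (g := ht.somePath.extend) (by fun_prop) (by fun_prop)
    (fun x => R.snd_nonpos_of_mem_region (hs.somePath_mem _))
    (fun x => R.snd_nonpos_of_mem_region (ht.somePath_mem _))
    (by simp) (by simp) (by simp) (by simp) h₁ h₂ h₃
  have hx : hs.somePath.extend x ∈ R.region S := hs.somePath_mem _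
  have hy : hs.somePath.extend x ∈ R.region T := hxy ▸ ht.somePath_mem _
  simp only [region, mem_iUnion] at hx hy
  obtain ⟨u, hu, hxu⟩ := hx
  obtain ⟨v, hv, hxv⟩ := hy
  have huv := hST u hu v hv
  exact huv.2 ((R.adj_iff u v huv.1).2 ⟨_, hxu, hxv⟩)

lemma nonCrossing {S T : Set V} (hST : ∀ u ∈ S, ∀ v ∈ T, u ≠ v ∧ ¬ H.Adj u v)
    {s s' t t' : V} (hs : s ∈ S) (hs' : s' ∈ S) (ht : t ∈ T) (ht' : t' ∈ T)
    (hss' : JoinedIn (R.region S) (R.a s, 0) (R.a s', 0))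
    (htt' : JoinedIn (R.region T) (R.a t, 0) (R.a t', 0)) :
    NonCrossing (R.a s) (R.a s') (R.a t) (R.a t') := by
  have hTS : ∀ u ∈ T, ∀ v ∈ S, u ≠ v ∧ ¬ H.Adj u v := fun u hu v hv =>
    ⟨(hST v hv u hu).1.symm, fun h => (hST v hv u hu).2 h.symm⟩
  have n₁ := R.a_inj.ne (hST s hs t ht).1
  have n₂ := R.a_inj.ne (hST s hs t' ht').1
  have n₃ := R.a_inj.ne (hST s' hs' t ht).1
  have n₄ := R.a_inj.ne (hST s' hs' t' ht').1
  have e₁ := R.not_interleaving hST hss' htt'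
  have e₂ := R.not_interleaving hST hss'.symm htt'
  have e₃ := R.not_interleaving hST hss' htt'.symm
  have e₄ := R.not_interleaving hST hss'.symm htt'.symm
  have e₅ := R.not_interleaving hTS htt' hss'
  have e₆ := R.not_interleaving hTS htt'.symm hss'
  have e₇ := R.not_interleaving hTS htt' hss'.symm
  have e₈ := R.not_interleaving hTS htt'.symm hss'.symm
  unfold NonCrossing StrictBetween
  grind

lemma joinedIn_arc {S : Set V} {Y : ℕ → V} (hY : ∀ k, H.Adj (Y k) (Y (k + 1))) {p q : ℕ}
    (hpq : p ≤ q) (hS : Y '' Icc p q ⊆ S) :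
    JoinedIn (R.region S) (R.a (Y p), 0) (R.a (Y q), 0) := by
  induction q, hpq using Nat.le_induction with
  | base => exact R.joinedIn_of_mem_image (hS ⟨p, by simp, rfl⟩) ⟨0, by simp, R.start _⟩
  | succ q hq ih =>
    refine (ih ((image_mono (Icc_subset_Icc_right q.le_succ)).trans hS)).trans
      (R.joinedIn_of_adj (hS ⟨q, ⟨hq, q.le_succ⟩, rfl⟩) (hS ⟨q + 1, ⟨by omega, le_rfl⟩, rfl⟩)
        (hY q))

end Grounded1StringRep

/-- In a family whose cyclically consecutive pairs of points never cross, the listing that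
starts from the least point is, up to reversal, a rotation of the natural listing. -/
lemma exists_rotated_listing_of_nonCrossing {n : ℕ} [NeZero n] {p : Fin n → ℝ}
    (hp : Function.Injective p)
    (hnc : ∀ i j k l : ℕ, i < j → j < k → k < l → l < i + n →
      NonCrossing (p (Fin.ofNat n i)) (p (Fin.ofNat n j)) (p (Fin.ofNat n k))
        (p (Fin.ofNat n l))) :
    ∃ L : List (Fin n), L.Nodup ∧ (∀ x, x ∈ L) ∧ L.IsChain (fun i j => p i < p j) ∧
      (List.IsRotated (List.finRange n) L ∨ List.IsRotated (List.finRange n) L.reverse) := by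
  obtain ⟨m, hm⟩ := Finite.exists_min p
  obtain ⟨k, rfl⟩ := Nat.exists_eq_succ_of_ne_zero (NeZero.ne n)
  let e : Fin (k + 1) → Fin (k + 1) := fun t => Fin.ofNat (k + 1) (m + t)
  have he0 : e 0 = m := by ext; simp [e]
  have he : Function.Injective e := by
    intro s t hst
    have h : (m + s : ℕ) ≡ m + t [MOD k + 1] := congrArg Fin.val hst
    have h' := Nat.ModEq.add_left_cancel' _ h
    exact Fin.ext (Nat.ModEq.eq_of_lt_of_lt h' s.2 t.2)
  set q : Fin k → ℝ := fun t => p (e t.succ)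
  have hqinj : Function.Injective q := hp.comp (he.comp (Fin.succ_injective k))
  have hmin : ∀ t, p (e 0) < q t := fun t =>
    (he0 ▸ hm (e t.succ)).lt_of_ne (hp.ne (he.ne (Fin.succ_ne_zero t).symm))
  have hlt : ∀ a b c : Fin k, a < c → c < b → q c ∈ uIcc (q a) (q b) := by
    intro a b c hac hcb
    have hb := b.2
    have h₁ := hnc m (m + (a + 1)) (m + (c + 1)) (m + (b + 1)) (by omega)
      (by simpa using hac) (by simpa using hcb) (by omega)
    have h₂ := hnc (m + (a + 1)) (m + (c + 1)) (m + (b + 1)) (m + (k + 1))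
      (by simpa using hac) (by simpa using hcb) (by omega) (by omega)
    have hm' : Fin.ofNat (k + 1) m = e 0 := by simp [e]
    have hm'' : Fin.ofNat (k + 1) (m + (k + 1)) = e 0 := by
      rw [he0]; ext; simp [Nat.mod_eq_of_lt m.2]
    rw [hm'] at h₁
    rw [hm''] at h₂
    change NonCrossing (p (e 0)) (q a) (q c) (q b) at h₁
    change NonCrossing (q a) (q c) (q b) (p (e 0)) at h₂
    have := hmin a
    have := hmin b
    have := hmin c
    have := hqinj.ne hac.ne
    have := hqinj.ne hcb.ne
    have := hqinj.ne (hac.trans hcb).ne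
    rw [mem_uIcc]
    unfold NonCrossing StrictBetween at h₁ h₂
    generalize p (e 0) = w at *
    generalize q a = x at *
    generalize q b = y at *
    generalize q c = z at *
    clear hnc hm hmin
    grind
  have hmono : Monotone q ∨ Antitone q := by
    rw [monotone_or_antitone_iff_uIcc]
    intro a b c hc
    rcases eq_or_ne c a with rfl | hca
    · exact left_mem_uIcc
    rcases eq_or_ne c b with rfl | hcb
    · exact right_mem_uIcc
    rcases mem_uIcc.1 hc with ⟨h₁, h₂⟩ | ⟨h₁, h₂⟩
    · exact hlt a b c (h₁.lt_of_ne hca.symm) (h₂.lt_of_ne hcb)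
    · exact uIcc_comm (q a) (q b) ▸ hlt b a c (h₁.lt_of_ne hcb.symm) (h₂.lt_of_ne hca)
  set tl : List (Fin (k + 1)) := List.ofFn fun t : Fin k => e t.succ
  have hcons : List.ofFn e = e 0 :: tl := List.ofFn_succ
  have hrot : List.IsRotated (List.finRange (k + 1)) (e 0 :: tl) := by
    refine ⟨m, ?_⟩
    rw [← hcons]
    refine List.ext_getElem (by simp) fun i h₁ h₂ => ?_
    rw [List.getElem_rotate, List.getElem_ofFn]
    ext
    simp [e, add_comm]
  have hnodup : (e 0 :: tl).Nodup := hrot.nodup_iff.1 (List.nodup_finRange _)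
  have hmem : ∀ x, x ∈ e 0 :: tl := fun x => hrot.mem_iff.1 (List.mem_finRange x)
  rcases hmono with h | h
  · refine ⟨e 0 :: tl, hnodup, hmem, List.Pairwise.isChain ?_, Or.inl hrot⟩
    rw [List.pairwise_cons]
    refine ⟨fun x hx => ?_, List.pairwise_ofFn.2 fun i j hij => h.strictMono_of_injective hqinj hij⟩
    obtain ⟨t, rfl⟩ := (List.mem_ofFn' _ _).1 hx
    exact hmin t
  · refine ⟨e 0 :: tl.reverse, by simpa using hnodup, by simpa using hmem,
      List.Pairwise.isChain ?_, Or.inr (hrot.trans ⟨1, by simp⟩)⟩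
    rw [List.pairwise_cons, List.pairwise_reverse]
    refine ⟨fun x hx => ?_,
      List.pairwise_ofFn.2 fun i j hij => h.strictAnti_of_injective hqinj hij⟩
    obtain ⟨t, rfl⟩ := (List.mem_ofFn' _ _).1 (List.mem_reverse.1 hx)
    exact hmin t

lemma strictBetween_comm {p q r : ℝ} : StrictBetween p q r ↔ StrictBetween q p r := or_comm

/-- If neither pair of opposite sides of a quadrilateral crosses, then its diagonals do. -/
lemma strictBetween_iff_not_of_nonCrossing {p q r s : ℝ} (hpq : p ≠ q) (hpr : p ≠ r)
    (hps : p ≠ s) (hqr : q ≠ r) (hqs : q ≠ s) (hrs : r ≠ s) (h₁ : NonCrossing p q r s)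
    (h₂ : NonCrossing q r s p) : StrictBetween p r q ↔ ¬ StrictBetween p r s := by
  unfold NonCrossing StrictBetween at *
  grind

/-- Two chords on opposite sides of a third one do not cross. -/
lemma nonCrossing_of_separated {a b p q r s : ℝ} (hqa : q ≠ a)
    (hqb : q ≠ b) (hra : r ≠ a) (hrb : r ≠ b) (hsa : s ≠ a) (hsb : s ≠ b)
    (hpq : StrictBetween a b p ↔ StrictBetween a b q)
    (hrs : StrictBetween a b r ↔ StrictBetween a b s)
    (hpr : StrictBetween a b p ↔ ¬ StrictBetween a b r) : NonCrossing p q r s := by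
  unfold NonCrossing StrictBetween at *
  grind

section CycleExtension

variable {n : ℕ} [NeZero n] {G : SimpleGraph (Fin n)} {H : SimpleGraph (Fin n ⊕ Fin (5 * n))}

/-- The original vertex with cyclic index `i`. -/
def baseVertex (n : ℕ) [NeZero n] (i : ℕ) : Fin n ⊕ Fin (5 * n) := Sum.inl (Fin.ofNat n i)

/-- The cycle vertex with cyclic index `k`. -/
def cycleVertex (n : ℕ) [NeZero n] (k : ℕ) : Fin n ⊕ Fin (5 * n) :=
  Sum.inr ⟨k % (5 * n), Nat.mod_lt _ (by have := NeZero.pos n; omega)⟩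

lemma cycleVertex_add (k : ℕ) : cycleVertex n (k + 5 * n) = cycleVertex n k := by
  simp [cycleVertex]

lemma mod_ne_mod_of_lt {N a b : ℕ} (h₁ : a < b) (h₂ : b < a + N) : a % N ≠ b % N := by
  intro h
  have := Nat.le_of_dvd (by omega) ((Nat.modEq_iff_dvd' h₁.le).1 h)
  omega

lemma five_mul_mod_add (n i c : ℕ) [NeZero n] (hc : c < 5) :
    5 * (i % n) + c = (5 * i + c) % (5 * n) := by
  have hr := Nat.mod_lt i (NeZero.pos n)
  have h : 5 * i + c = 5 * (i % n) + c + 5 * n * (i / n) := by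
    have := Nat.mod_add_div i n
    rw [mul_assoc]
    set d := n * (i / n)
    omega
  rw [h, Nat.add_mul_mod_self_left, Nat.mod_eq_of_lt (a := 5 * (i % n) + c) (by omega)]

namespace IsCycleExtension

lemma adj_cycleVertex_succ (hH : IsCycleExtension n G H)
    (k : ℕ) : H.Adj (cycleVertex n k) (cycleVertex n (k + 1)) :=
  (hH.2.1 _ _).2 (Or.inl (by simp))

lemma adj_baseVertex (hH : IsCycleExtension n G H)
    (i : ℕ) : H.Adj (baseVertex n i) (cycleVertex n (5 * i + 4)) := by
  have h := five_mul_mod_add n i 4 (by omega)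
  rcases hH.2.2 (Fin.ofNat n i) with h' | h'
  · exact (h' _).2 h.symm
  · exact (h' _).2 (Or.inr h.symm)

lemma ne_and_not_adj_cycleVertex (hH : IsCycleExtension n G H)
    {k l : ℕ} (h₁ : k + 2 ≤ l) (h₂ : l + 2 ≤ k + 5 * n) :
    cycleVertex n k ≠ cycleVertex n l ∧ ¬ H.Adj (cycleVertex n k) (cycleVertex n l) := by
  constructor
  · intro h
    exact mod_ne_mod_of_lt (N := 5 * n) (by omega : k < l) (by omega)
      (congrArg Fin.val (Sum.inr_injective h))
  · intro h
    rcases (hH.2.1 _ _).1 h with h | h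
    · rw [Nat.mod_add_mod] at h
      exact mod_ne_mod_of_lt (by omega : k + 1 < l) (by omega) h
    · rw [Nat.mod_add_mod] at h
      exact mod_ne_mod_of_lt (by omega : l + 1 < k + 5 * n) (by omega)
        (h.trans (Nat.add_mod_right k _).symm)

lemma ne_and_not_adj_baseVertex (hH : IsCycleExtension n G H)
    {i k : ℕ} (h₁ : 5 * i + 5 ≤ k) (h₂ : k ≤ 5 * i + 2 + 5 * n) :
    baseVertex n i ≠ cycleVertex n k ∧ ¬ H.Adj (baseVertex n i) (cycleVertex n k) := by
  have h₃ := mod_ne_mod_of_lt (by omega : 5 * i + 3 < k) (by omega : k < 5 * i + 3 + 5 * n)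
  have h₄ := mod_ne_mod_of_lt (by omega : 5 * i + 4 < k) (by omega : k < 5 * i + 4 + 5 * n)
  rw [← five_mul_mod_add n i _ (by omega)] at h₃ h₄
  refine ⟨Sum.inl_ne_inr, fun h => ?_⟩
  rcases hH.2.2 (Fin.ofNat n i) with h' | h'
  · exact h₄ ((h' _).1 h).symm
  · rcases (h' _).1 h with h | h
    · exact h₃ h.symm
    · exact h₄ h.symm

lemma nonCrossing_cycleVertex (hH : IsCycleExtension n G H) (R : Grounded1StringRep H)
    {p q r s : ℕ} (hpq : p ≤ q) (hrs : r ≤ s) (hqr : q + 2 ≤ r)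
    (hsp : s + 2 ≤ p + 5 * n) :
    NonCrossing (R.a (cycleVertex n p)) (R.a (cycleVertex n q)) (R.a (cycleVertex n r))
      (R.a (cycleVertex n s)) := by
  refine R.nonCrossing (S := cycleVertex n '' Icc p q) (T := cycleVertex n '' Icc r s) ?_
    ⟨p, ⟨le_rfl, hpq⟩, rfl⟩ ⟨q, ⟨hpq, le_rfl⟩, rfl⟩ ⟨r, ⟨le_rfl, hrs⟩, rfl⟩
    ⟨s, ⟨hrs, le_rfl⟩, rfl⟩ (R.joinedIn_arc hH.adj_cycleVertex_succ hpq le_rfl)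
    (R.joinedIn_arc hH.adj_cycleVertex_succ hrs le_rfl)
  rintro _ ⟨k, hk, rfl⟩ _ ⟨l, hl, rfl⟩
  have := hk.1
  have := hk.2
  have := hl.1
  have := hl.2
  exact hH.ne_and_not_adj_cycleVertex (by omega) (by omega)

/-- An original vertex and its neighbour on the cycle lie on the same side of every chord of
the arc opposite to them. -/
lemma nonCrossing_baseVertex (hH : IsCycleExtension n G H) (R : Grounded1StringRep H)
    {i r s : ℕ} (hr₁ : 5 * i + 6 ≤ r) (hr₂ : r ≤ 5 * i + 1 + 5 * n)
    (hs₁ : 5 * i + 6 ≤ s) (hs₂ : s ≤ 5 * i + 1 + 5 * n) :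
    NonCrossing (R.a (cycleVertex n r)) (R.a (cycleVertex n s)) (R.a (baseVertex n i))
      (R.a (cycleVertex n (5 * i + 4))) := by
  set T := cycleVertex n '' Icc (5 * i + 6) (5 * i + 1 + 5 * n)
  set S : Set (Fin n ⊕ Fin (5 * n)) := {baseVertex n i, cycleVertex n (5 * i + 4)} with hS
  have hj : ∀ t, 5 * i + 6 ≤ t → t ≤ 5 * i + 1 + 5 * n →
      JoinedIn (R.region T) (R.a (cycleVertex n (5 * i + 6)), 0) (R.a (cycleVertex n t), 0) :=
    fun t h₁ h₂ => R.joinedIn_arc hH.adj_cycleVertex_succ h₁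
      (image_mono (Icc_subset_Icc_right h₂))
  refine R.nonCrossing (S := T) (T := S) ?_ ⟨r, ⟨hr₁, hr₂⟩, rfl⟩ ⟨s, ⟨hs₁, hs₂⟩, rfl⟩
    (by simp [hS]) (by simp [hS]) ((hj r hr₁ hr₂).symm.trans (hj s hs₁ hs₂))
    (R.joinedIn_of_adj (by simp [hS]) (by simp [hS]) (hH.adj_baseVertex i))
  rintro _ ⟨k, ⟨hk₁, hk₂⟩, rfl⟩ v (rfl | rfl)
  · have h := hH.ne_and_not_adj_baseVertex (i := i) (k := k) (by omega) (by omega)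
    exact ⟨h.1.symm, fun h' => h.2 h'.symm⟩
  · have h := hH.ne_and_not_adj_cycleVertex (k := 5 * i + 4) (l := k) (by omega) (by omega)
    exact ⟨h.1.symm, fun h' => h.2 h'.symm⟩

lemma nonCrossing_baseVertices (hH : IsCycleExtension n G H) (R : Grounded1StringRep H)
    {i j k l : ℕ} (hij : i < j) (hjk : j < k) (hkl : k < l)
    (hli : l < i + n) :
    NonCrossing (R.a (baseVertex n i)) (R.a (baseVertex n j)) (R.a (baseVertex n k))
      (R.a (baseVertex n l)) := by
  set za := R.a (cycleVertex n (5 * i + 1))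
  set zb := R.a (cycleVertex n (5 * j + 6))
  have ea : za = R.a (cycleVertex n (5 * i + 1 + 5 * n)) := by rw [cycleVertex_add]
  have eb : zb = R.a (cycleVertex n (5 * j + 6 + 5 * n)) := by rw [cycleVertex_add]
  -- Each `x` lies on the same side of the chord from `za` to `zb` as its neighbour.
  have xi : NonCrossing za zb _ _ := ea ▸ hH.nonCrossing_baseVertex R (i := i)
    (r := 5 * i + 1 + 5 * n) (s := 5 * j + 6) (by omega) (by omega) (by omega) (by omega)
  have xj : NonCrossing za zb _ _ := ea ▸ hH.nonCrossing_baseVertex R (i := j)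
    (r := 5 * i + 1 + 5 * n) (s := 5 * j + 6) (by omega) (by omega) (by omega) (by omega)
  have xk : NonCrossing za zb _ _ := ea ▸ eb ▸ hH.nonCrossing_baseVertex R (i := k)
    (r := 5 * i + 1 + 5 * n) (s := 5 * j + 6 + 5 * n) (by omega) (by omega) (by omega) (by omega)
  have xl : NonCrossing za zb _ _ := ea ▸ eb ▸ hH.nonCrossing_baseVertex R (i := l)
    (r := 5 * i + 1 + 5 * n) (s := 5 * j + 6 + 5 * n) (by omega) (by omega) (by omega) (by omega)
  have yij : NonCrossing zb za _ _ := ea ▸ hH.nonCrossing_cycleVertex R (p := 5 * j + 6)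
    (q := 5 * i + 1 + 5 * n) (r := 5 * i + 4 + 5 * n) (s := 5 * j + 4 + 5 * n)
    (by omega) (by omega) (by omega) (by omega)
  rw [cycleVertex_add, cycleVertex_add, NonCrossing, strictBetween_comm,
    strictBetween_comm (p := zb)] at yij
  have ykl : NonCrossing za zb _ _ := hH.nonCrossing_cycleVertex R (p := 5 * i + 1)
    (q := 5 * j + 6) (r := 5 * k + 4) (s := 5 * l + 4)
    (by omega) (by omega) (by omega) (by omega)
  have yik : NonCrossing za _ zb _ := hH.nonCrossing_cycleVertex R (p := 5 * i + 1)
    (q := 5 * i + 4) (r := 5 * j + 6) (s := 5 * k + 4)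
    (by omega) (by omega) (by omega) (by omega)
  have yki : NonCrossing _ zb _ za := ea ▸ hH.nonCrossing_cycleVertex R (p := 5 * i + 4)
    (q := 5 * j + 6) (r := 5 * k + 4) (s := 5 * i + 1 + 5 * n)
    (by omega) (by omega) (by omega) (by omega)
  have ne : ∀ {u v}, 5 * i ≤ u → u + 2 ≤ v → v + 2 ≤ u + 5 * n →
      R.a (cycleVertex n u) ≠ R.a (cycleVertex n v) := fun _ h₁ h₂ =>
    R.a_inj.ne (hH.ne_and_not_adj_cycleVertex h₁ h₂).1
  have hsep := strictBetween_iff_not_of_nonCrossing (ne (by omega) (by omega) (by omega))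
    (ne (by omega) (by omega) (by omega)) (ne (by omega) (by omega) (by omega))
    (ne (by omega) (by omega) (by omega)) (ne (by omega) (by omega) (by omega))
    (ne (by omega) (by omega) (by omega)) yik yki
  have hne : ∀ u v, R.a (baseVertex n u) ≠ R.a (cycleVertex n v) := fun u v =>
    R.a_inj.ne Sum.inl_ne_inr
  exact nonCrossing_of_separated (a := za) (b := zb) (hne j _) (hne j _) (hne k _)
    (hne k _) (hne l _) (hne l _) (xi.trans (yij.trans xj.symm)) (xk.trans (ykl.trans xl.symm))
    (xi.trans (hsep.trans (not_congr xk.symm)))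

end IsCycleExtension

end CycleExtension

/-- If `H` is a cycle extension of the graph `G` on `Fin n` with
its natural order `<`, then in every grounded 1-string representation of `H` the
induced order of the original vertices (by anchors) is equivalent to `<`, i.e. it
arises from `<` by cyclic shifts and reversals.  Equivalence is expressed via the
listings of `Fin n` in the two orders: the listing in the induced order is a
rotation of the listing in the natural order, or of its reverse. -/
theorem cycle_extension_forces_order (n : ℕ) (G : SimpleGraph (Fin n))
    (H : SimpleGraph (Fin n ⊕ Fin (5 * n))) (hH : IsCycleExtension n G H)
    (R : Grounded1StringRep H) :
    ∃ L L' : List (Fin n),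
      L.Nodup ∧ (∀ x : Fin n, x ∈ L) ∧ L.Chain' (· < ·) ∧
      L'.Nodup ∧ (∀ x : Fin n, x ∈ L') ∧
      L'.Chain' (fun i j => R.a (Sum.inl i) < R.a (Sum.inl j)) ∧
      (List.IsRotated L L' ∨ List.IsRotated L L'.reverse) := by
  rcases Nat.eq_zero_or_pos n with rfl | hn
  · exact ⟨[], [], by simp, fun x => x.elim0, .nil, by simp, fun x => x.elim0, .nil,
      Or.inl (.refl _)⟩
  have : NeZero n := ⟨hn.ne'⟩
  obtain ⟨L, hnodup, hmem, hchain, hrot⟩ := exists_rotated_listing_of_nonCrossing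
    (p := fun i : Fin n => R.a (Sum.inl i)) (R.a_inj.comp Sum.inl_injective)
    fun _ _ _ _ => hH.nonCrossing_baseVertices R
  exact ⟨List.finRange n, L, List.nodup_finRange n, List.mem_finRange,
    (List.pairwise_lt_finRange n).isChain, hnodup, hmem, hchain, hrot⟩
end

section
/- There exists a finite simple graph that admits a grounded {L,J}-representation but admits no grounded L-representation. -/
/-- The grounded L-shape with anchor `(a, 0)`, depth `h` and width `w`:
the union of the vertical segment from `(a, 0)` to `(a, -h)` and the
horizontal segment from `(a, -h)` to `(a + w, -h)`. -/
def LShape (a h w : ℝ) : Set (ℝ × ℝ) :=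
  segment ℝ ((a, 0) : ℝ × ℝ) ((a, -h) : ℝ × ℝ) ∪
    segment ℝ ((a, -h) : ℝ × ℝ) ((a + w, -h) : ℝ × ℝ)

/-- A grounded L-representation of a simple graph `G`. -/
structure GroundedLRep {V : Type} (G : SimpleGraph V) where
  a : V → ℝ
  ht : V → ℝ
  wd : V → ℝ
  ht_pos : ∀ v, 0 < ht v
  wd_pos : ∀ v, 0 < wd v
  a_inj : Function.Injective a
  ht_inj : Function.Injective ht
  endpoint_off : ∀ u v, u ≠ v →
    ((a v + wd v, -ht v) : ℝ × ℝ) ∉ LShape (a u) (ht u) (wd u)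
  adj_iff : ∀ u v, u ≠ v →
    (G.Adj u v ↔ (LShape (a u) (ht u) (wd u) ∩ LShape (a v) (ht v) (wd v)).Nonempty)

/-- The grounded J-shape with anchor `(a, 0)`, depth `h` and width `w`. -/
def JShape (a h w : ℝ) : Set (ℝ × ℝ) :=
  segment ℝ ((a, 0) : ℝ × ℝ) ((a, -h) : ℝ × ℝ) ∪
    segment ℝ ((a - w, -h) : ℝ × ℝ) ((a, -h) : ℝ × ℝ)

/-- The shape of a vertex in a grounded {L,J}-representation:
an L-shape if `isL = true`, a J-shape otherwise. -/
def LJShape (isL : Bool) (a h w : ℝ) : Set (ℝ × ℝ) :=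
  if isL then LShape a h w else JShape a h w

/-- The horizontal endpoint of an L-shape or a J-shape. -/
def LJEnd (isL : Bool) (a h w : ℝ) : ℝ × ℝ :=
  if isL then (a + w, -h) else (a - w, -h)

/-- A grounded {L,J}-representation of a simple graph `G`. -/
structure GroundedLJRep {V : Type} (G : SimpleGraph V) where
  a : V → ℝ
  ht : V → ℝ
  wd : V → ℝ
  isL : V → Bool
  ht_pos : ∀ v, 0 < ht v
  wd_pos : ∀ v, 0 < wd v
  a_inj : Function.Injective a
  ht_inj : Function.Injective ht
  endpoint_off : ∀ u v, u ≠ v →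
    LJEnd (isL v) (a v) (ht v) (wd v) ∉ LJShape (isL u) (a u) (ht u) (wd u)
  adj_iff : ∀ u v, u ≠ v →
    (G.Adj u v ↔
      (LJShape (isL u) (a u) (ht u) (wd u) ∩ LJShape (isL v) (a v) (ht v) (wd v)).Nonempty)

theorem mem_vertical_segment {a h : ℝ} (hh : 0 < h) (p : ℝ × ℝ) :
    p ∈ segment ℝ ((a, 0) : ℝ × ℝ) ((a, -h) : ℝ × ℝ) ↔ p.1 = a ∧ -h ≤ p.2 ∧ p.2 ≤ 0 := by
  obtain ⟨x, y⟩ := p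
  rw [← Prod.image_mk_segment_right, segment_symm, segment_eq_Icc (by linarith)]
  simp only [Set.mem_image, Set.mem_Icc, Prod.mk.injEq]
  grind

theorem mem_horizontal_segment {l r y₀ : ℝ} (hlr : l ≤ r) (p : ℝ × ℝ) :
    p ∈ segment ℝ ((l, y₀) : ℝ × ℝ) ((r, y₀) : ℝ × ℝ) ↔ p.2 = y₀ ∧ l ≤ p.1 ∧ p.1 ≤ r := by
  obtain ⟨x, y⟩ := p
  rw [← Prod.image_mk_segment_left, segment_eq_Icc hlr]
  simp only [Set.mem_image, Set.mem_Icc, Prod.mk.injEq]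
  grind

/-- Left end of the horizontal segment of a shape. -/
def LJLeft (isL : Bool) (a w : ℝ) : ℝ := if isL then a else a - w

/-- Right end of the horizontal segment of a shape. -/
def LJRight (isL : Bool) (a w : ℝ) : ℝ := if isL then a + w else a

theorem mem_LJShape {b : Bool} {a h w : ℝ} (hh : 0 < h) (hw : 0 < w) (p : ℝ × ℝ) :
    p ∈ LJShape b a h w ↔ (p.1 = a ∧ -h ≤ p.2 ∧ p.2 ≤ 0) ∨
      (p.2 = -h ∧ LJLeft b a w ≤ p.1 ∧ p.1 ≤ LJRight b a w) := by
  cases b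
  · simp only [LJShape, JShape, LJLeft, LJRight, Bool.false_eq_true, if_false, Set.mem_union]
    rw [mem_vertical_segment hh, mem_horizontal_segment (by linarith)]
  · simp only [LJShape, LShape, LJLeft, LJRight, if_true, Set.mem_union]
    rw [mem_vertical_segment hh, mem_horizontal_segment (by linarith)]

/-- Of two shapes with distinct anchors and depths, the shallower meets the deeper one exactly
when its horizontal segment crosses the vertical segment of the deeper one. -/
theorem LJShape_inter_nonempty_iff {b b' : Bool} {a h w a' h' w' : ℝ} (hh : 0 < h) (hw : 0 < w)
    (hw' : 0 < w') (ha : a ≠ a') (hlt : h < h') :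
    (LJShape b a h w ∩ LJShape b' a' h' w').Nonempty ↔
      LJLeft b a w ≤ a' ∧ a' ≤ LJRight b a w := by
  constructor
  · rintro ⟨p, hp, hp'⟩
    rw [mem_LJShape hh hw] at hp
    rw [mem_LJShape (hh.trans hlt) hw'] at hp'
    grind
  · intro h₀
    refine ⟨(a', -h), ?_, ?_⟩
    · rw [mem_LJShape hh hw]
      exact Or.inr ⟨rfl, h₀⟩
    · rw [mem_LJShape (hh.trans hlt) hw']
      exact Or.inl ⟨rfl, by simp; linarith, by simp; linarith⟩

namespace GroundedLRep

variable {V : Type} {G : SimpleGraph V} (R : GroundedLRep G)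

theorem adj_iff_of_lt {u v : V} (h : R.a u < R.a v) :
    G.Adj u v ↔ R.ht u < R.ht v ∧ R.a v ≤ R.a u + R.wd u := by
  have hne : u ≠ v := by rintro rfl; exact lt_irrefl _ h
  rw [R.adj_iff u v hne]
  change (LJShape true _ _ _ ∩ LJShape true _ _ _).Nonempty ↔ _
  rcases lt_or_gt_of_ne (R.ht_inj.ne hne) with hlt | hlt
  · rw [LJShape_inter_nonempty_iff (R.ht_pos u) (R.wd_pos u) (R.wd_pos v) h.ne hlt]
    simp only [LJLeft, LJRight, if_true]
    grind
  · rw [Set.inter_comm,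
      LJShape_inter_nonempty_iff (R.ht_pos v) (R.wd_pos v) (R.wd_pos u) h.ne' hlt]
    simp only [LJLeft, LJRight, if_true]
    grind

end GroundedLRep

/-- Two patterns on four vertices listed from left to right which cannot occur in a grounded
L-representation. -/
def forbiddenPattern {V : Type} (adj : V → V → Bool) (a b c d : V) : Bool :=
  (adj a b && (adj b c && (!adj a c && adj a d))) ||
    (!adj a b && (!adj b c && (adj a c && adj b d)))

theorem GroundedLRep.forbiddenPattern_eq_false {V : Type} {G : SimpleGraph V}
    (R : GroundedLRep G) {adj : V → V → Bool} (hadj : ∀ u v, G.Adj u v ↔ adj u v = true)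
    {a b c d : V} (hab : R.a a < R.a b) (hbc : R.a b < R.a c) (hcd : R.a c < R.a d) :
    forbiddenPattern adj a b c d = false := by
  have key : ∀ {u v : V}, R.a u < R.a v →
      (adj u v = true ↔ R.ht u < R.ht v ∧ R.a v ≤ R.a u + R.wd u) := fun h => by
    rw [← hadj, R.adj_iff_of_lt h]
  have iab := key hab
  have ibc := key hbc
  have iac := key (hab.trans hbc)
  have iad := key ((hab.trans hbc).trans hcd)
  have ibd := key (hbc.trans hcd)
  have nab : R.ht a ≠ R.ht b := fun h => hab.ne (congrArg R.a (R.ht_inj h))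
  have nbc : R.ht b ≠ R.ht c := fun h => hbc.ne (congrArg R.a (R.ht_inj h))
  have nac : R.ht a ≠ R.ht c := fun h => (hab.trans hbc).ne (congrArg R.a (R.ht_inj h))
  rw [Bool.eq_false_iff]
  intro hf
  simp only [forbiddenPattern, Bool.or_eq_true, Bool.and_eq_true, Bool.not_eq_true',
    ← Bool.not_eq_true, iab, ibc, iac, iad, ibd] at hf
  grind

/-- Whether some element of the list, together with the part of the list after it, satisfies
`p`. -/
def anyTail {α : Type} (p : α → List α → Bool) : List α → Bool
  | [] => false
  | a :: l => p a l || anyTail p l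

theorem exists_of_anyTail {α : Type} {r : α → α → Prop} {p : α → List α → Bool} {l : List α}
    (hl : l.Pairwise r) (h : anyTail p l = true) :
    ∃ a t, (∀ x ∈ t, r a x) ∧ t.Pairwise r ∧ a ∈ l ∧ p a t = true := by
  induction l with
  | nil => simp [anyTail] at h
  | cons a l ih =>
    rw [List.pairwise_cons] at hl
    rw [anyTail, Bool.or_eq_true] at h
    rcases h with h | h
    · exact ⟨a, l, hl.1, hl.2, by simp, h⟩
    · obtain ⟨b, t, h₁, h₂, h₃, h₄⟩ := ih hl.2 h
      exact ⟨b, t, h₁, h₂, List.mem_cons_of_mem _ h₃, h₄⟩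

/-- Whether the list contains a forbidden pattern as a subsequence. -/
def hasForbiddenPattern {V : Type} (adj : V → V → Bool) (l : List V) : Bool :=
  anyTail (fun a => anyTail fun b => anyTail fun c t =>
    t.any fun d => forbiddenPattern adj a b c d) l

theorem GroundedLRep.hasForbiddenPattern_eq_false {V : Type} {G : SimpleGraph V}
    (R : GroundedLRep G) {adj : V → V → Bool} (hadj : ∀ u v, G.Adj u v ↔ adj u v = true)
    {l : List V} (hl : l.Pairwise (fun u v => R.a u < R.a v)) :
    hasForbiddenPattern adj l = false := by
  rw [Bool.eq_false_iff]
  intro h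
  obtain ⟨a, t, ha, ht, -, h⟩ := exists_of_anyTail hl h
  obtain ⟨b, s, hb, hs, hbt, h⟩ := exists_of_anyTail ht h
  obtain ⟨c, r, hc, -, hcs, h⟩ := exists_of_anyTail hs h
  obtain ⟨d, hd, h⟩ := List.any_eq_true.1 h
  rw [R.forbiddenPattern_eq_false hadj (ha b hbt) (hb c hcs) (hc d hd)] at h
  exact Bool.false_ne_true h

/-- All lists obtained by inserting `x` into a given list. -/
def insertions {α : Type} (x : α) : List α → List (List α)
  | [] => [[x]]
  | y :: l => (x :: y :: l) :: (insertions x l).map (y :: ·)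

theorem exists_mem_insertions_pairwise {α : Type} {f : α → ℝ} (hf : Function.Injective f) {x : α}
    {l : List α} (hx : x ∉ l) (hl : l.Pairwise (fun u v => f u < f v)) :
    ∃ l' ∈ insertions x l, l'.Pairwise (fun u v => f u < f v) ∧ ∀ z, z ∈ l' ↔ z = x ∨ z ∈ l := by
  induction l with
  | nil => exact ⟨[x], by simp [insertions]⟩
  | cons y l ih =>
    rw [List.pairwise_cons] at hl
    rw [List.mem_cons, not_or] at hx
    rcases lt_or_gt_of_ne (hf.ne hx.1) with h | h
    · refine ⟨x :: y :: l, by simp [insertions], ?_, by simp⟩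
      simp only [List.pairwise_cons, List.mem_cons]
      exact ⟨by grind, hl⟩
    · obtain ⟨l', hm, hp, hz⟩ := ih hx.2 hl.2
      refine ⟨y :: l', by simp [insertions, hm], ?_, by grind⟩
      rw [List.pairwise_cons]
      exact ⟨by grind, hp⟩

/-- Whether every way of inserting the vertices of the first list one by one into the second list
leads to a forbidden pattern. -/
def everyInsertionForbidden {V : Type} (adj : V → V → Bool) : List V → List V → Bool
  | [], _ => false
  | x :: xs, l => (insertions x l).all fun l' =>
      hasForbiddenPattern adj l' || everyInsertionForbidden adj xs l'

theorem GroundedLRep.everyInsertionForbidden_eq_false {V : Type} {G : SimpleGraph V}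
    (R : GroundedLRep G) {adj : V → V → Bool} (hadj : ∀ u v, G.Adj u v ↔ adj u v = true)
    {xs l : List V} (hxs : xs.Nodup) (hd : ∀ x ∈ xs, x ∉ l)
    (hl : l.Pairwise (fun u v => R.a u < R.a v)) :
    everyInsertionForbidden adj xs l = false := by
  induction xs generalizing l with
  | nil => rfl
  | cons x xs ih =>
    rw [List.nodup_cons] at hxs
    obtain ⟨l', hm, hp, hz⟩ := exists_mem_insertions_pairwise R.a_inj (hd x (by simp)) hl
    rw [Bool.eq_false_iff]
    intro h
    have h' := List.all_eq_true.1 h l' hm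
    rw [R.hasForbiddenPattern_eq_false hadj hp, ih hxs.2 (by grind) hp] at h'
    exact Bool.false_ne_true h'

namespace LJExample

/-- Neighbours of a vertex of the example graph. -/
def neighbours : Fin 8 → List (Fin 8) :=
  ![[3, 4, 7], [2, 4, 7], [1, 3, 5], [0, 2, 6], [0, 1, 5], [2, 4, 6], [3, 5, 7], [0, 1, 6]]

/-- Adjacency in the example graph. -/
def adj (u v : Fin 8) : Bool := (neighbours u).contains v

/-- Anchors in a grounded {L,J}-representation of the example graph. -/
def anchor : Fin 8 → ℤ := ![4, 10, 6, 8, 14, 12, 2, 0]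

/-- Depths in a grounded {L,J}-representation of the example graph. -/
def depth : Fin 8 → ℤ := ![5, 6, 1, 2, 4, 8, 7, 3]

/-- Widths in a grounded {L,J}-representation of the example graph. -/
def width : Fin 8 → ℤ := ![5, 5, 7, 7, 11, 3, 13, 11]

/-- Orientations in a grounded {L,J}-representation of the example graph. -/
def orient : Fin 8 → Bool := ![true, false, true, false, false, true, true, true]

/-- The left end of the horizontal segment of a vertex. -/
def left (v : Fin 8) : ℤ := if orient v then anchor v else anchor v - width v

/-- The right end of the horizontal segment of a vertex. -/
def right (v : Fin 8) : ℤ := if orient v then anchor v + width v else anchor v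

/-- The example graph. -/
def graph : SimpleGraph (Fin 8) where
  Adj u v := adj u v = true
  symm := ⟨by decide +kernel⟩
  loopless := ⟨by decide +kernel⟩

theorem LJLeft_eq (v : Fin 8) : LJLeft (orient v) (anchor v) (width v) = (left v : ℝ) := by
  unfold LJLeft left; split <;> simp

theorem LJRight_eq (v : Fin 8) : LJRight (orient v) (anchor v) (width v) = (right v : ℝ) := by
  unfold LJRight right; split <;> simp

theorem depth_pos (v : Fin 8) : (0 : ℝ) < depth v := by
  have : ∀ v, 0 < depth v := by decide +kernel
  exact_mod_cast this v

theorem width_pos (v : Fin 8) : (0 : ℝ) < width v := by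
  have : ∀ v, 0 < width v := by decide +kernel
  exact_mod_cast this v

theorem anchor_injective : Function.Injective anchor := by decide +kernel

theorem depth_injective : Function.Injective depth := by decide +kernel

theorem adj_iff_of_depth_lt {u v : Fin 8} (h : depth u < depth v) :
    adj u v = true ↔ left u ≤ anchor v ∧ anchor v ≤ right u := by
  have : ∀ u v, depth u < depth v →
      (adj u v = true ↔ left u ≤ anchor v ∧ anchor v ≤ right u) := by decide +kernel
  exact this u v h

theorem inter_nonempty_iff {u v : Fin 8} (h : depth u < depth v) :
    (LJShape (orient u) (anchor u) (depth u) (width u) ∩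
      LJShape (orient v) (anchor v) (depth v) (width v)).Nonempty ↔ adj u v = true := by
  have hne : u ≠ v := by rintro rfl; exact lt_irrefl _ h
  rw [LJShape_inter_nonempty_iff (depth_pos u) (width_pos u) (width_pos v)
    (by exact_mod_cast anchor_injective.ne hne) (by exact_mod_cast h), LJLeft_eq, LJRight_eq,
    adj_iff_of_depth_lt h]
  norm_cast

/-- The coordinate of the horizontal endpoint of a vertex. -/
def endCoord (v : Fin 8) : ℤ := if orient v then anchor v + width v else anchor v - width v

theorem endCoord_ne_anchor (u v : Fin 8) : endCoord v ≠ anchor u := by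
  have : ∀ u v, endCoord v ≠ anchor u := by decide +kernel
  exact this u v

theorem LJEnd_eq (v : Fin 8) :
    LJEnd (orient v) (anchor v) (depth v) (width v) = ((endCoord v : ℝ), -(depth v : ℝ)) := by
  unfold LJEnd endCoord; split <;> simp

/-- A grounded {L,J}-representation of the example graph. -/
def rep : GroundedLJRep graph where
  a v := anchor v
  ht v := depth v
  wd v := width v
  isL := orient
  ht_pos := depth_pos
  wd_pos := width_pos
  a_inj := Int.cast_injective.comp anchor_injective
  ht_inj := Int.cast_injective.comp depth_injective
  endpoint_off u v huv := by
    rw [LJEnd_eq, mem_LJShape (depth_pos u) (width_pos u)]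
    rintro (⟨h, -⟩ | ⟨h, -⟩)
    · exact endCoord_ne_anchor u v (Int.cast_injective h)
    · exact depth_injective.ne huv (by exact_mod_cast (neg_injective h).symm)
  adj_iff u v huv := by
    rcases lt_or_gt_of_ne (depth_injective.ne huv) with h | h
    · exact (inter_nonempty_iff h).symm
    · rw [graph.adj_comm, Set.inter_comm]
      exact (inter_nonempty_iff h).symm

theorem everyInsertionForbidden_adj :
    everyInsertionForbidden adj (List.finRange 8) [] = true := by
  decide +kernel

end LJExample

/-- Some finite simple graph admits a grounded {L,J}-representation
but no grounded L-representation. -/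
theorem exists_groundedLJ_not_groundedL :
    ∃ (n : ℕ) (G : SimpleGraph (Fin n)),
      Nonempty (GroundedLJRep G) ∧ IsEmpty (GroundedLRep G) := by
  refine ⟨8, LJExample.graph, ⟨LJExample.rep⟩, ⟨fun R => ?_⟩⟩
  have h := R.everyInsertionForbidden_eq_false (adj := LJExample.adj) (fun _ _ => Iff.rfl)
    (xs := List.finRange 8) (l := []) (List.nodup_finRange 8) (by simp) List.Pairwise.nil
  rw [LJExample.everyInsertionForbidden_adj] at h
  exact Bool.false_ne_true h.symm
end
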